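/- If G is a graph in obs(P1) that is not isomorphic to any of the 33 graphs in O, then either K4 is not a minor of G, or G is triconnected. -/

import Mathlib

open SimpleGraph

/-- `H` is a minor of `G` (branch-set definition): there is a family of connected, nonempty,
pairwise disjoint branch sets in `G`, indexed by the vertices of `H`, such that vertices
adjacent in `H` have an edge of `G` between their branch sets. -/
def IsMinorOf {W V : Type} (H : SimpleGraph W) (G : SimpleGraph V) : Prop :=
  ∃ f : W → Set V,
    (∀ w, (G.induce (f w)).Connected) ∧
    (∀ ⦃w w' : W⦄, w ≠ w' → Disjoint (f w) (f w')) ∧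
    (∀ ⦃w w' : W⦄, H.Adj w w' → ∃ a ∈ f w, ∃ b ∈ f w', G.Adj a b)

/-- A pseudoforest: every connected component contains at most one cycle, i.e. any two
cycles lying in the same connected component have the same edge set. -/
def Pseudoforest {V : Type} (G : SimpleGraph V) : Prop :=
  ∀ ⦃u v : V⦄ (c : G.Walk u u) (c' : G.Walk v v),
    c.IsCycle → c'.IsCycle → G.Reachable u v → ∀ e, e ∈ c.edges ↔ e ∈ c'.edges

/-- An apex-pseudoforest: removing at most one vertex yields a pseudoforest. -/
def ApexPseudoforest {V : Type} (G : SimpleGraph V) : Prop :=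
  ∃ s : Set V, s.Subsingleton ∧ Pseudoforest (G.induce sᶜ)

/-- `G` is a minor-obstruction for the class of apex-pseudoforests: `G` is not an
apex-pseudoforest but every proper minor of `G` is. -/
def ObsApexPseudoforest {V : Type} (G : SimpleGraph V) : Prop :=
  ¬ ApexPseudoforest G ∧
    ∀ (W : Type) [Finite W] (H : SimpleGraph W),
      IsMinorOf H G → IsEmpty (H ≃g G) → ApexPseudoforest H

/-- `G` is `k`-connected: between any two distinct vertices `u ≠ v` there exist `k`
pairwise distinct `(u,v)`-paths, any two of which share no vertices other than `u,v`. -/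
def KConnected {V : Type} (k : ℕ) (G : SimpleGraph V) : Prop :=
  ∀ ⦃u v : V⦄, u ≠ v → ∃ P : Fin k → G.Walk u v,
    Function.Injective P ∧ (∀ i, (P i).IsPath) ∧
      ∀ i j, i ≠ j → ∀ x, x ∈ (P i).support → x ∈ (P j).support → x = u ∨ x = v

/-- The simple graph on `Fin n` with the given list of (0-indexed) edges. -/
def mkGraph (n : ℕ) (E : List (ℕ × ℕ)) : SimpleGraph (Fin n) :=
  SimpleGraph.fromRel fun a b => ((a : ℕ), (b : ℕ)) ∈ E

/-- Obstruction 1: two disjoint diamonds. -/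
def O1 : SimpleGraph (Fin 8) :=
  mkGraph 8 [(0,1),(0,2),(0,3),(1,2),(1,3),(4,5),(4,6),(4,7),(5,6),(5,7)]
/-- Obstruction 2: two disjoint butterflies. -/
def O2 : SimpleGraph (Fin 10) :=
  mkGraph 10 [(0,1),(0,2),(1,2),(0,3),(0,4),(3,4),(5,6),(5,7),(6,7),(5,8),(5,9),(8,9)]
/-- Obstruction 3: a diamond plus a butterfly. -/
def O3 : SimpleGraph (Fin 9) :=
  mkGraph 9 [(0,1),(0,2),(0,3),(1,2),(1,3),(4,5),(4,6),(5,6),(4,7),(4,8),(7,8)]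
def O4 : SimpleGraph (Fin 8) :=
  mkGraph 8 [(0,1),(0,2),(1,2),(2,3),(2,4),(3,4),(3,5),(4,5),(5,6),(5,7),(6,7)]
def O5 : SimpleGraph (Fin 8) :=
  mkGraph 8 [(0,1),(0,2),(1,2),(2,3),(2,4),(3,4),(3,5),(4,6),(5,6),(5,7),(6,7)]
def O6 : SimpleGraph (Fin 8) :=
  mkGraph 8 [(0,1),(0,2),(1,2),(2,3),(2,4),(3,4),(3,5),(4,5),(3,6),(5,6),(4,7),(5,7)]
def O7 : SimpleGraph (Fin 7) :=
  mkGraph 7 [(0,1),(0,6),(1,6),(2,3),(2,4),(2,5),(3,4),(3,5),(4,6),(5,6)]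
def O8 : SimpleGraph (Fin 7) :=
  mkGraph 7 [(0,1),(0,2),(1,2),(2,3),(2,4),(2,5),(3,4),(3,5),(4,5),(4,6),(5,6)]
def O9 : SimpleGraph (Fin 9) :=
  mkGraph 9 [(0,1),(0,2),(1,2),(2,3),(2,4),(3,4),(3,5),(4,5),(2,6),(4,6),(2,7),(3,7),(3,8),(4,8)]
def O10 : SimpleGraph (Fin 9) :=
  mkGraph 9 [(0,1),(1,2),(2,3),(3,0),(0,4),(1,4),(1,5),(2,5),(2,6),(3,6),(0,7),(0,8),(7,8)]
def O11 : SimpleGraph (Fin 9) :=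
  mkGraph 9 [(0,1),(0,2),(1,2),(3,4),(3,5),(4,5),(6,7),(6,8),(7,8),(2,3),(1,8),(4,8)]
def O12 : SimpleGraph (Fin 9) :=
  mkGraph 9 [(0,1),(0,2),(1,2),(3,4),(3,5),(4,5),(6,7),(6,8),(7,8),(2,3),(2,7),(3,6)]
def O13 : SimpleGraph (Fin 9) :=
  mkGraph 9 [(0,1),(0,2),(1,2),(3,4),(3,5),(4,5),(6,7),(6,8),(7,8),(2,3),(2,8),(3,8)]
def O14 : SimpleGraph (Fin 8) :=
  mkGraph 8 [(0,1),(0,2),(1,2),(1,4),(2,3),(2,4),(3,4),(3,5),(4,5),(1,6),(1,7),(6,7)]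
def O15 : SimpleGraph (Fin 9) :=
  mkGraph 9 [(0,1),(0,2),(1,2),(2,3),(2,4),(3,4),(4,5),(4,6),(5,6),(6,7),(6,8),(7,8),(2,6)]
def O16 : SimpleGraph (Fin 6) :=
  mkGraph 6 [(0,2),(0,3),(0,4),(0,5),(1,2),(1,3),(1,4),(1,5),(2,3),(4,5)]
def O17 : SimpleGraph (Fin 6) :=
  mkGraph 6 [(0,1),(1,3),(3,2),(2,0),(4,0),(4,1),(4,2),(4,3),(5,0),(5,1)]
def O18 : SimpleGraph (Fin 8) :=
  mkGraph 8 [(0,1),(1,2),(2,3),(3,0),(4,0),(4,1),(5,1),(5,2),(6,2),(6,3),(7,3),(7,0)]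
def O19 : SimpleGraph (Fin 7) :=
  mkGraph 7 [(0,2),(0,3),(1,2),(1,3),(2,3),(0,4),(4,1),(5,0),(5,4),(6,4),(6,1)]
def O20 : SimpleGraph (Fin 6) :=
  mkGraph 6 [(1,2),(1,4),(1,5),(2,4),(2,5),(4,5),(0,1),(0,4),(2,3),(3,5)]
def O21 : SimpleGraph (Fin 7) :=
  mkGraph 7 [(0,1),(0,3),(0,4),(1,3),(1,4),(3,5),(4,5),(1,2),(2,4),(3,6),(5,6)]
def O22 : SimpleGraph (Fin 8) :=
  mkGraph 8 [(0,1),(0,3),(1,4),(3,4),(1,2),(2,4),(7,0),(7,3),(5,7),(5,0),(6,7),(6,3)]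
def O23 : SimpleGraph (Fin 7) :=
  mkGraph 7 [(2,3),(2,4),(2,6),(3,4),(3,6),(4,6),(5,3),(5,4),(0,2),(0,3),(1,2),(1,4)]
def O24 : SimpleGraph (Fin 7) :=
  mkGraph 7 [(0,1),(0,2),(1,2),(1,3),(2,4),(3,5),(3,6),(4,5),(4,6),(5,6)]
def O25 : SimpleGraph (Fin 8) :=
  mkGraph 8 [(0,1),(0,3),(1,3),(1,2),(1,5),(2,5),(1,7),(2,7),(3,4),(4,5),(3,5),(3,6),(5,6)]
def O26 : SimpleGraph (Fin 9) :=
  mkGraph 9 [(2,3),(2,4),(3,4),(5,3),(5,4),(8,3),(8,4),(0,2),(0,3),(7,2),(7,3),(1,2),(1,4),(6,2),(6,4)]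
def O27 : SimpleGraph (Fin 8) :=
  mkGraph 8 [(0,2),(1,2),(0,3),(2,3),(1,6),(2,6),(3,4),(6,7),(4,5),(5,7),(3,7),(4,7)]
def O28 : SimpleGraph (Fin 7) :=
  mkGraph 7 [(0,1),(0,2),(1,2),(1,3),(1,5),(3,5),(3,4),(3,6),(4,6),(2,5),(5,6)]
def O29 : SimpleGraph (Fin 9) :=
  mkGraph 9 [(0,1),(0,2),(1,2),(3,4),(3,5),(4,5),(6,7),(6,8),(7,8),(2,3),(1,7),(4,6)]
def O30 : SimpleGraph (Fin 8) :=
  mkGraph 8 [(0,1),(0,2),(1,2),(3,4),(3,5),(4,5),(6,7),(1,6),(4,6),(0,7),(5,7)]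
/-- Obstruction 31: the prism. -/
def O31 : SimpleGraph (Fin 6) :=
  mkGraph 6 [(0,1),(0,2),(1,2),(3,4),(3,5),(4,5),(0,3),(1,4),(2,5)]
/-- Obstruction 32: `K₃,₃`. -/
def O32 : SimpleGraph (Fin 6) :=
  mkGraph 6 [(0,3),(0,4),(0,5),(1,3),(1,4),(1,5),(2,3),(2,4),(2,5)]
/-- Obstruction 33: `K₅` minus one edge. -/
def O33 : SimpleGraph (Fin 5) :=
  mkGraph 5 [(0,1),(0,2),(0,3),(0,4),(1,2),(1,3),(1,4),(2,3),(2,4)]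

/-- The list `O` of the 33 obstructions. -/
def OList : List ((n : ℕ) × SimpleGraph (Fin n)) :=
  [⟨8, O1⟩, ⟨10, O2⟩, ⟨9, O3⟩, ⟨8, O4⟩, ⟨8, O5⟩, ⟨8, O6⟩, ⟨7, O7⟩, ⟨7, O8⟩, ⟨9, O9⟩,
   ⟨9, O10⟩, ⟨9, O11⟩, ⟨9, O12⟩, ⟨9, O13⟩, ⟨8, O14⟩, ⟨9, O15⟩, ⟨6, O16⟩, ⟨6, O17⟩,
   ⟨8, O18⟩, ⟨7, O19⟩, ⟨6, O20⟩, ⟨7, O21⟩, ⟨8, O22⟩, ⟨7, O23⟩, ⟨7, O24⟩, ⟨8, O25⟩,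
   ⟨9, O26⟩, ⟨8, O27⟩, ⟨7, O28⟩, ⟨9, O29⟩, ⟨8, O30⟩, ⟨6, O31⟩, ⟨6, O32⟩, ⟨5, O33⟩]

/-- `G` is isomorphic to one of the 33 graphs in `O`. -/
def InO {V : Type} (G : SimpleGraph V) : Prop :=
  ∃ H ∈ OList, Nonempty (G ≃g H.2)

section Density

variable {V : Type}

open Classical in
/-- The number of ordered pairs of adjacent vertices of `S`. -/
noncomputable def dsum (G : SimpleGraph V) (S : Finset V) : ℕ :=
  ∑ x ∈ S, (S.filter fun y => G.Adj x y).card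

open Classical in
/-- The number of ordered adjacent pairs from `A` to `B`. -/
noncomputable def dcross (G : SimpleGraph V) (A B : Finset V) : ℕ :=
  ∑ x ∈ A, (B.filter fun y => G.Adj x y).card

lemma dsum_congr {G H : SimpleGraph V} {S : Finset V}
    (h : ∀ x ∈ S, ∀ y ∈ S, G.Adj x y ↔ H.Adj x y) : dsum G S = dsum H S := by
  classical
  refine Finset.sum_congr rfl fun x hx => ?_
  rw [Finset.filter_congr fun y hy => h x hx y hy]

lemma dcross_comm (G : SimpleGraph V) (A B : Finset V) : dcross G A B = dcross G B A := by
  classical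
  simp only [dcross, Finset.card_filter]
  rw [Finset.sum_comm]
  simp only [G.adj_comm]

lemma dsum_union [DecidableEq V] (G : SimpleGraph V) {A B : Finset V} (h : Disjoint A B) :
    dsum G (A ∪ B) = dsum G A + 2 * dcross G B A + dsum G B := by
  classical
  have e (x : V) : ((A ∪ B).filter fun y => G.Adj x y).card =
      (A.filter fun y => G.Adj x y).card + (B.filter fun y => G.Adj x y).card := by
    rw [Finset.filter_union, Finset.card_union_of_disjoint (Finset.disjoint_filter_filter h)]
  have hc := dcross_comm G A B
  simp only [dsum, Finset.sum_union h, e, Finset.sum_add_distrib]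
  simp only [dcross] at hc ⊢
  omega

lemma dsum_eq_edges (G : SimpleGraph V) (S : Finset V) :
    dsum G S = 2 * Nat.card (G.induce (S : Set V)).edgeSet := by
  classical
  rw [Nat.card_eq_fintype_card, ← edgeFinset_card, ← sum_degrees_eq_twice_card_edges, dsum,
    ← Finset.sum_coe_sort]
  refine Finset.sum_congr rfl fun x _ => ?_
  rw [← card_neighborFinset_eq_degree]
  refine Finset.card_bij' (fun y hy => ⟨y, (Finset.mem_filter.1 hy).1⟩) (fun y _ => y.1) ?_ ?_ ?_ ?_
  · intro y hy
    simpa using (Finset.mem_filter.1 hy).2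
  · intro y hy
    have : G.Adj x y := by simpa using hy
    exact Finset.mem_filter.2 ⟨y.2, this⟩
  · intros; rfl
  · intros; rfl

lemma dsum_delete_add (G : SimpleGraph V) {a b : V} (h : G.Adj a b) (S : Finset V)
    [Decidable (a ∈ S ∧ b ∈ S)] :
    dsum (G.deleteEdges {s(a, b)}) S + (if a ∈ S ∧ b ∈ S then 2 else 0) = dsum G S := by
  classical
  have hne := h.ne
  have aux (c : V) [DecidablePred fun y => y = c] :
      (S.filter fun y => y = c).card = if c ∈ S then 1 else 0 := by
    rw [Finset.card_filter, ← Finset.sum_ite_eq' S c fun _ => 1]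
    exact Finset.sum_congr rfl fun _ _ => by congr
  have e (x : V) : (S.filter fun y => G.Adj x y).card =
      (S.filter fun y => (G.deleteEdges {s(a, b)}).Adj x y).card +
        ((if x = a then if b ∈ S then 1 else 0 else 0) +
          (if x = b then if a ∈ S then 1 else 0 else 0)) := by
    have h1 : (S.filter fun y => G.Adj x y) =
        (S.filter fun y => (G.deleteEdges {s(a, b)}).Adj x y) ∪
          (S.filter fun y => x = a ∧ y = b ∨ x = b ∧ y = a) := by
      ext y
      simp only [Finset.mem_union, Finset.mem_filter, deleteEdges_adj, Set.mem_singleton_iff,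
        Sym2.eq_iff]
      have : x = a ∧ y = b ∨ x = b ∧ y = a → G.Adj x y := by
        rintro (⟨rfl, rfl⟩ | ⟨rfl, rfl⟩)
        exacts [h, h.symm]
      tauto
    rw [h1, Finset.card_union_of_disjoint]
    · congr 1
      rcases eq_or_ne x a with rfl | hxa
      · simpa [hne] using aux b
      · rcases eq_or_ne x b with rfl | hxb
        · simpa [hxa] using aux a
        · simp [hxa, hxb]
    · rw [Finset.disjoint_left]
      intro y hy hy2
      simp only [Finset.mem_filter, deleteEdges_adj, Set.mem_singleton_iff,
        Sym2.eq_iff] at hy hy2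
      tauto
  simp only [dsum, e, Finset.sum_add_distrib, Finset.sum_ite_eq']
  by_cases ha : a ∈ S <;> by_cases hb : b ∈ S <;> simp [ha, hb]

lemma reachable_deleteEdges_of_cycle {G : SimpleGraph V} {w : V} {c : G.Walk w w}
    (hc : c.IsCycle) {a b : V} (h : s(a, b) ∈ c.edges) {x y : V} (hxy : G.Reachable x y) :
    (G.deleteEdges {s(a, b)}).Reachable x y := by
  have hab := (adj_and_reachable_delete_edges_iff_exists_cycle.2 ⟨w, c, hc, h⟩).2
  obtain ⟨p⟩ := hxy
  induction p with
  | nil => rfl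
  | @cons x z y hxz p ih =>
    refine Reachable.trans ?_ ih
    by_cases he : s(x, z) = s(a, b)
    · rcases Sym2.eq_iff.1 he with ⟨rfl, rfl⟩ | ⟨rfl, rfl⟩
      exacts [hab, hab.symm]
    · exact Adj.reachable (deleteEdges_adj.2 ⟨hxz, he⟩)

lemma card_le_dsum_of_reachable [Finite V] (G : SimpleGraph V) (u : V) (S : Finset V)
    (h : ∀ x, x ∈ S ↔ G.Reachable x u) : 2 * S.card ≤ dsum G S + 2 := by
  have h1 := (G.connectedComponentMk u).connected_toSimpleGraph
  have h2 : (G.connectedComponentMk u).supp = (S : Set V) := by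
    ext x
    simp [h]
  have h3 : (G.induce (S : Set V)).Connected := by
    rw [← h2]
    exact h1
  have h4 := h3.card_vert_le_card_edgeSet_add_one
  rw [dsum_eq_edges]
  simp only [SetLike.coe_sort_coe, Nat.card_eq_fintype_card, Fintype.card_coe] at h4
  omega

lemma pseudoforest_of_dsum_le [Finite V] {G : SimpleGraph V}
    (h : ∀ S : Finset V, dsum G S ≤ 2 * S.card) : Pseudoforest G := by
  classical
  suffices key : ∀ ⦃u v : V⦄ (c : G.Walk u u) (c' : G.Walk v v), c.IsCycle → c'.IsCycle →
      G.Reachable u v → ∀ e, e ∈ c.edges → e ∈ c'.edges from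
    fun u v c c' hc hc' huv e => ⟨key c c' hc hc' huv e, key c' c hc' hc huv.symm e⟩
  intro u v c c' hc hc' huv e he
  by_contra hec
  induction e with | h a b =>
  cases nonempty_fintype V
  let S : Finset V := Finset.univ.filter fun x => G.Reachable x u
  have hS (x : V) : x ∈ S ↔ G.Reachable x u := by simp [S]
  let d := c'.toDeleteEdge s(a, b) hec
  have hd : d.IsCycle := hc'.toDeleteEdges _ _ _
  obtain ⟨f, hf⟩ : ∃ f, f ∈ d.edges := by
    have := hd.three_le_length
    rw [← Walk.length_edges] at this
    exact List.exists_mem_of_length_pos (by omega)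
  induction f with | h p q =>
  have hpq := d.adj_of_mem_edges hf
  have hpq2 := (deleteEdges_adj.1 hpq).1
  have hab := c.adj_of_mem_edges he
  have e1 := dsum_delete_add G hab S
  have e2 := dsum_delete_add _ hpq S
  have hu := Walk.fst_mem_support_of_mem_edges c he
  have ha : a ∈ S := (hS a).2 ⟨(c.takeUntil a hu).reverse⟩
  have hb : b ∈ S := (hS b).2 (hab.symm.reachable.trans ((hS a).1 ha))
  have hv := Walk.fst_mem_support_of_mem_edges d hf
  have hp : p ∈ S := (hS p).2 ((Reachable.mono (deleteEdges_le _)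
    ⟨(d.takeUntil p hv).reverse⟩).trans huv.symm)
  have hq : q ∈ S := (hS q).2 (hpq2.symm.reachable.trans ((hS p).1 hp))
  have e3 := card_le_dsum_of_reachable ((G.deleteEdges {s(a, b)}).deleteEdges {s(p, q)}) u S
    fun x => (hS x).trans ⟨fun hx => reachable_deleteEdges_of_cycle hd hf
      (reachable_deleteEdges_of_cycle hc he hx),
      fun hx => hx.mono ((deleteEdges_le _).trans (deleteEdges_le _))⟩
  have e4 := h S
  rw [if_pos ⟨ha, hb⟩] at e1
  rw [if_pos ⟨hp, hq⟩] at e2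
  omega

lemma dsum_le_of_pseudoforest {G : SimpleGraph V} (h : Pseudoforest G) (S : Finset V) :
    dsum G S ≤ 2 * S.card := by
  classical
  induction S using Finset.strongInduction with | H S ih =>
  by_contra! hS
  have hne : S.Nonempty := by
    rw [Finset.nonempty_iff_ne_empty]
    rintro rfl
    simp [dsum] at hS
  have hcard := dsum_eq_edges G S
  set K := G.induce (S : Set V) with hK
  have hconn : K.Connected := by
    obtain ⟨u, hu⟩ := hne
    rw [connected_iff_exists_forall_reachable]
    refine ⟨⟨u, hu⟩, ?_⟩
    by_contra! hcon
    obtain ⟨w, hw⟩ := hcon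
    let A : Finset V := S.filter fun x => ∃ hx : x ∈ S, K.Reachable ⟨u, hu⟩ ⟨x, hx⟩
    let B : Finset V := S.filter fun x => ¬ ∃ hx : x ∈ S, K.Reachable ⟨u, hu⟩ ⟨x, hx⟩
    have hAB : A ∪ B = S := Finset.filter_union_filter_not_eq _ S
    have hd : Disjoint A B := Finset.disjoint_filter_filter_not S S _
    have hA : A ⊂ S := ⟨Finset.filter_subset _ _, fun hs => by
      obtain ⟨hx, hr⟩ := (Finset.mem_filter.1 (hs w.2)).2
      exact hw hr⟩
    have hB : B ⊂ S := ⟨Finset.filter_subset _ _, fun hs =>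
      (Finset.mem_filter.1 (hs hu)).2 ⟨hu, Reachable.refl _⟩⟩
    have hcross : dcross G B A = 0 := by
      refine Finset.sum_eq_zero fun x hx => Finset.card_eq_zero.2 (Finset.filter_eq_empty_iff.2 ?_)
      intro y hy hxy
      obtain ⟨hyS, hr⟩ := (Finset.mem_filter.1 hy).2
      obtain ⟨hxS, hx⟩ := Finset.mem_filter.1 hx
      exact hx ⟨hxS, hr.trans (Adj.reachable (G := K) (by simpa [hK] using hxy.symm))⟩
    have := dsum_union G hd
    rw [hAB] at this
    have c1 := ih A hA
    have c2 := ih B hB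
    have c3 := Finset.card_union_of_disjoint hd
    rw [hAB] at c3
    omega
  have hcV : Nat.card (S : Set V) = S.card := by simp
  have htree (H : SimpleGraph (S : Set V)) (hH : H.Connected)
      (hc : S.card ≤ Nat.card H.edgeSet) : ∃ (x : (S : Set V)) (c : H.Walk x x), c.IsCycle := by
    by_contra! hno
    have ht : H.IsTree := ⟨hH, fun x c => hno x c⟩
    have := ht.card_edgeFinset
    rw [Fintype.card_eq_nat_card, hcV, edgeFinset_card, Fintype.card_eq_nat_card] at this
    omega
  obtain ⟨x, c, hc⟩ := htree K hconn (by omega)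
  obtain ⟨f, hf⟩ : ∃ f, f ∈ c.edges := by
    have := hc.three_le_length
    rw [← Walk.length_edges] at this
    exact List.exists_mem_of_length_pos (by omega)
  induction f with | h p q =>
  have hpq := c.adj_of_mem_edges hf
  have hconn2 := hconn.connected_delete_edge_of_not_isBridge
    (fun hb => hb.notMem_edges_of_isCycle hc hf)
  have hcard2 : Nat.card (K.deleteEdges {s(p, q)}).edgeSet + 1 = Nat.card K.edgeSet := by
    rw [edgeSet_deleteEdges]
    exact Set.ncard_sdiff_singleton_add_one (s := K.edgeSet) hpq (Set.toFinite _)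
  obtain ⟨y, d, hd⟩ := htree _ hconn2 (by omega)
  let i1 : K ↪g G := Embedding.induce _
  let d1 : K.Walk y y := d.map (Hom.ofLE (deleteEdges_le _))
  have hd1 : d1.IsCycle := hd.map (fun _ _ hh => hh)
  have hnot : s(p, q) ∉ d1.edges := by
    intro hm
    simp only [d1, Walk.edges_map, List.mem_map] at hm
    obtain ⟨g, hg, hgp⟩ := hm
    have hg2 := d.edges_subset_edgeSet hg
    have : g = s(p, q) := by simpa using hgp
    rw [this, edgeSet_deleteEdges] at hg2
    exact hg2.2 rfl
  have := h (c.map i1.toHom) (d1.map i1.toHom) (hc.map i1.injective) (hd1.map i1.injective)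
    ((hconn x y).map i1.toHom) (Sym2.map i1 s(p, q))
  rw [Walk.edges_map, Walk.edges_map] at this
  have hm := this.1 (List.mem_map.2 ⟨_, hf, rfl⟩)
  obtain ⟨g, hg, hgp⟩ := List.mem_map.1 hm
  have : g = s(p, q) := Sym2.map.injective i1.injective hgp
  exact hnot (this ▸ hg)

end Density

section Minors

variable {V : Type}

/-- Deleting `z` leaves a graph in which no vertex set spans more edges than vertices. -/
def SparseOff (G : SimpleGraph V) (z : V) : Prop :=
  ∀ T : Finset V, z ∉ T → dsum G T ≤ 2 * T.card

open Classical in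
/-- The neighbours of `x`, as a finset. -/
noncomputable def nbrs [Fintype V] (G : SimpleGraph V) (x : V) : Finset V :=
  Finset.univ.filter fun y => G.Adj x y

@[simp] lemma mem_nbrs [Fintype V] {G : SimpleGraph V} {x y : V} : y ∈ nbrs G x ↔ G.Adj x y := by
  simp [nbrs]

lemma dsum_induce (G : SimpleGraph V) (s : Set V) (S : Finset s) :
    dsum (G.induce s) S = dsum G (S.map (Function.Embedding.subtype _)) := by
  classical
  rw [dsum, dsum, Finset.sum_map]
  refine Finset.sum_congr rfl fun x _ => ?_
  rw [Finset.filter_map, Finset.card_map]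
  rfl

lemma exists_dense_of_not_apex [Finite V] {G : SimpleGraph V} (h : ¬ ApexPseudoforest G) (z : V) :
    ∃ T : Finset V, z ∉ T ∧ 2 * T.card < dsum G T := by
  by_contra! hT
  refine h ⟨{z}, Set.subsingleton_singleton, pseudoforest_of_dsum_le fun S => ?_⟩
  rw [dsum_induce, ← S.card_map (Function.Embedding.subtype _)]
  refine hT _ fun hz => ?_
  simp at hz

lemma exists_sparseOff_of_apex [Nonempty V] {G : SimpleGraph V} (h : ApexPseudoforest G) :
    ∃ z, SparseOff G z := by
  classical
  obtain ⟨s, hs, hp⟩ := h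
  obtain ⟨z, hz⟩ : ∃ z, s ⊆ {z} := by
    rcases hs.eq_empty_or_singleton with rfl | ⟨z, rfl⟩
    · exact ⟨Classical.arbitrary V, Set.empty_subset _⟩
    · exact ⟨z, subset_rfl⟩
  refine ⟨z, fun T hT => ?_⟩
  have hTs (x) (hx : x ∈ T) : x ∈ sᶜ := fun hxs => hT (by rwa [← hz hxs])
  have := dsum_le_of_pseudoforest hp (T.subtype fun x => x ∈ sᶜ)
  rw [dsum_induce] at this
  rw [Finset.card_subtype, Finset.filter_true_of_mem hTs] at this
  have e := Finset.subtype_map_of_mem hTs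
  rwa [e] at this

lemma dsum_erase [Fintype V] [DecidableEq V] (G : SimpleGraph V) {T : Finset V} {b : V}
    (h : b ∈ T) : dsum G T = dsum G (T.erase b) + 2 * (nbrs G b ∩ T).card := by
  classical
  have := dsum_union G (A := T.erase b) (B := {b}) (by simp)
  rw [Finset.union_comm, ← Finset.insert_eq, Finset.insert_erase h] at this
  rw [this]
  have e1 : dsum G {b} = 0 := by simp [dsum, Finset.filter_singleton]
  have e2 : dcross G {b} (T.erase b) = (nbrs G b ∩ T).card := by
    rw [dcross, Finset.sum_singleton]
    congr 1
    ext y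
    simp only [Finset.mem_filter, Finset.mem_erase, Finset.mem_inter, mem_nbrs]
    exact ⟨fun h => ⟨h.2, h.1.2⟩, fun h => ⟨⟨h.1.ne', h.2⟩, h.1⟩⟩
  rw [e1, e2]
  rfl

lemma dsum_insert [Fintype V] [DecidableEq V] (G : SimpleGraph V) {T : Finset V} {b : V}
    (h : b ∉ T) : dsum G (insert b T) = dsum G T + 2 * (nbrs G b ∩ T).card := by
  rw [dsum_erase G (Finset.mem_insert_self b T), Finset.erase_insert h]
  congr 3
  ext y
  simp only [Finset.mem_inter, mem_nbrs, Finset.mem_insert]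
  exact ⟨fun hy => ⟨hy.1, hy.2.resolve_left hy.1.ne'⟩, fun hy => ⟨hy.1, Or.inr hy.2⟩⟩

lemma SparseOff.move [Fintype V] {G : SimpleGraph V} {z a : V} (h : SparseOff G z)
    (hz : (nbrs G z).card ≤ 2) (ha : G.Adj z a) : SparseOff G a := by
  classical
  intro T hT
  by_cases hzT : z ∈ T
  · rw [dsum_erase G hzT]
    have h1 := h (T.erase z) (Finset.notMem_erase z T)
    rw [Finset.card_erase_of_mem hzT] at h1
    have h2 : nbrs G z ∩ T ⊆ (nbrs G z).erase a := fun y hy => by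
      simp only [Finset.mem_inter] at hy
      exact Finset.mem_erase.2 ⟨fun e => hT (e ▸ hy.2), hy.1⟩
    have h3 := Finset.card_le_card h2
    rw [Finset.card_erase_of_mem (by simpa using ha)] at h3
    have := Finset.card_pos.2 ⟨z, hzT⟩
    omega
  · exact h T hzT

lemma induce_singleton_connected (G : SimpleGraph V) (x : V) : (G.induce {x}).Connected := by
  have : Nonempty ({x} : Set V) := ⟨⟨x, rfl⟩⟩
  exact ⟨fun a b => by rw [Subsingleton.elim a b]⟩

namespace ObsApexPseudoforest

variable [Finite V] {G : SimpleGraph V}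

lemma exists_dense (h : ObsApexPseudoforest G) (z : V) :
    ∃ T : Finset V, z ∉ T ∧ 2 * T.card < dsum G T :=
  exists_dense_of_not_apex h.1 z

lemma not_sparseOff (h : ObsApexPseudoforest G) (z : V) : ¬ SparseOff G z := fun hz => by
  obtain ⟨T, h1, h2⟩ := h.exists_dense z
  exact h2.not_ge (hz T h1)

lemma exists_sparseOff_delete (h : ObsApexPseudoforest G) {a b : V} (hab : G.Adj a b) :
    ∃ z, SparseOff (G.deleteEdges {s(a, b)}) z := by
  classical
  have : Nonempty V := ⟨a⟩
  cases nonempty_fintype V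
  refine exists_sparseOff_of_apex (h.2 V _ ⟨fun x => {x}, induce_singleton_connected G, ?_, ?_⟩ ?_)
  · intro x y hxy
    simpa using hxy
  · intro x y hxy
    exact ⟨x, rfl, y, rfl, (deleteEdges_adj.1 hxy).1⟩
  · refine ⟨fun e => ?_⟩
    have h1 := e.card_edgeFinset_eq
    refine absurd h1 (Finset.card_lt_card ?_).ne
    rw [edgeFinset_ssubset_edgeFinset]
    refine (deleteEdges_le _).lt_of_ne fun e => ?_
    rw [← e] at hab
    simpa using (deleteEdges_adj.1 hab).2

lemma exists_sparseOff_induce (h : ObsApexPseudoforest G) (H : SimpleGraph V) {a b : V}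
    (hab : a ≠ b) (hH : IsMinorOf (H.induce {b}ᶜ) G) :
    ∃ z, z ≠ b ∧ ∀ T : Finset V, b ∉ T → z ∉ T → dsum H T ≤ 2 * T.card := by
  classical
  have : Nonempty ({b}ᶜ : Set V) := ⟨⟨a, hab⟩⟩
  cases nonempty_fintype V
  have h1 := h.2 _ _ hH ⟨fun e => by
    have := Fintype.card_congr e.toEquiv
    have h2 : Fintype.card ({b}ᶜ : Set V) < Fintype.card V :=
      Fintype.card_subtype_lt (x := b) (by simp)
    omega⟩
  obtain ⟨z, hz⟩ := exists_sparseOff_of_apex h1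
  refine ⟨z, z.2, fun T hb hzT => ?_⟩
  have hT (x) (hx : x ∈ T) : x ∈ ({b}ᶜ : Set V) := fun e => hb (by rwa [← Set.mem_singleton_iff.1 e])
  have := hz (T.subtype fun x => x ∈ ({b}ᶜ : Set V)) (by simpa using hzT)
  rw [dsum_induce, Finset.card_subtype, Finset.filter_true_of_mem hT,
    Finset.subtype_map_of_mem hT] at this
  exact this

lemma exists_sparseOff_remove (h : ObsApexPseudoforest G) {a b : V} (hab : a ≠ b) :
    ∃ z, z ≠ b ∧ ∀ T : Finset V, b ∉ T → z ∉ T → dsum G T ≤ 2 * T.card := by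
  refine h.exists_sparseOff_induce G hab ⟨fun x => {x.1}, ?_, ?_, ?_⟩
  · exact fun x => induce_singleton_connected G x.1
  · intro x y hxy
    simpa [Subtype.ext_iff] using hxy
  · intro x y hxy
    exact ⟨x, rfl, y, rfl, hxy⟩

end ObsApexPseudoforest

/-- The graph obtained from `G` by contracting `b` into `a` and keeping `b` as isolated vertex. -/
def mergeInto (G : SimpleGraph V) (a b : V) : SimpleGraph V where
  Adj x y := x ≠ b ∧ y ≠ b ∧ x ≠ y ∧ (G.Adj x y ∨ x = a ∧ G.Adj b y ∨ y = a ∧ G.Adj b x)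
  symm := ⟨fun x y h => ⟨h.2.1, h.1, h.2.2.1.symm, by rw [G.adj_comm]; tauto⟩⟩
  loopless := ⟨fun x h => h.2.2.1 rfl⟩

lemma dsum_mergeInto_of_notMem (G : SimpleGraph V) {a b : V} {T : Finset V} (ha : a ∉ T)
    (hb : b ∉ T) : dsum (mergeInto G a b) T = dsum G T := by
  refine dsum_congr fun x hx y hy => ?_
  have h1 : x ≠ a := fun e => ha (e ▸ hx)
  have h2 : x ≠ b := fun e => hb (e ▸ hx)
  have h3 : y ≠ a := fun e => ha (e ▸ hy)
  have h4 : y ≠ b := fun e => hb (e ▸ hy)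
  simp only [mergeInto, h1, h2, h3, h4, false_and, or_false, ne_eq, not_false_eq_true, true_and]
  exact ⟨fun h => h.2, fun h => ⟨h.ne, h⟩⟩

lemma dsum_mergeInto_of_mem [Fintype V] [DecidableEq V] (G : SimpleGraph V) {a b : V}
    (hab : G.Adj a b) {T : Finset V} (ha : a ∈ T) (hb : b ∉ T) :
    dsum (mergeInto G a b) T + 2 + 2 * (nbrs G a ∩ nbrs G b ∩ T).card =
      dsum G (insert b T) := by
  have h1 := dsum_erase (mergeInto G a b) ha
  have h2 := dsum_erase G ha
  have h3 := dsum_insert G hb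
  rw [dsum_mergeInto_of_notMem G (Finset.notMem_erase a T)
    (fun h => hb (Finset.mem_of_mem_erase h))] at h1
  have e1 : nbrs (mergeInto G a b) a ∩ T = nbrs G a ∩ T ∪ (nbrs G b ∩ T).erase a := by
    ext y
    simp only [Finset.mem_inter, Finset.mem_union, Finset.mem_erase, mem_nbrs, mergeInto]
    constructor
    · tauto
    · rintro (⟨h, hy⟩ | ⟨hy, h, hyT⟩)
      · exact ⟨⟨hab.ne, fun e => hb (e ▸ hy), h.ne, Or.inl h⟩, hy⟩
      · exact ⟨⟨hab.ne, h.ne', Ne.symm hy, Or.inr (Or.inl ⟨trivial, h⟩)⟩, hyT⟩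
  have e2 : nbrs G a ∩ T ∩ (nbrs G b ∩ T).erase a = nbrs G a ∩ nbrs G b ∩ T := by
    ext y
    simp only [Finset.mem_inter, Finset.mem_erase, mem_nbrs]
    exact ⟨fun h => ⟨⟨h.1.1, h.2.2.1⟩, h.1.2⟩, fun h => ⟨⟨h.1.1, h.2⟩, h.1.1.ne', h.1.2, h.2⟩⟩
  have e3 := Finset.card_union_add_card_inter (nbrs G a ∩ T) ((nbrs G b ∩ T).erase a)
  have e4 := Finset.card_erase_add_one (s := nbrs G b ∩ T) (a := a) (by simp [hab.symm, ha])
  rw [← e1, e2] at e3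
  omega

namespace ObsApexPseudoforest

variable [Fintype V] {G : SimpleGraph V}

lemma exists_sparseOff_contract (h : ObsApexPseudoforest G) {a b : V} (hab : G.Adj a b) :
    ∃ z, z ≠ b ∧ ∀ T : Finset V, b ∉ T → z ∉ T → dsum (mergeInto G a b) T ≤ 2 * T.card := by
  classical
  have key {s t : Set V} (e : s = t) (ht : (G.induce t).Connected) : (G.induce s).Connected :=
    e ▸ ht
  refine h.exists_sparseOff_induce _ hab.ne
    ⟨fun x => if x.1 = a then {a, b} else {x.1}, ?_, ?_, ?_⟩
  · intro x
    by_cases hx : x.1 = a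
    · exact key (if_pos hx) (induce_pair_connected_of_adj hab)
    · exact key (if_neg hx) (induce_singleton_connected G x.1)
  · rintro ⟨x, hx⟩ ⟨y, hy⟩ hxy
    have hxy : x ≠ y := by simpa using hxy
    simp only [Set.mem_compl_iff, Set.mem_singleton_iff] at hx hy
    dsimp only
    split_ifs with h1 h2 h2
    · exact absurd (h1.trans h2.symm) hxy
    · simp [hy, h2]
    · simp [hx, h1]
    · simpa using hxy
  · rintro ⟨x, hx⟩ ⟨y, hy⟩ hxy
    obtain ⟨-, -, hne, hG⟩ : (mergeInto G a b).Adj x y := hxy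
    have hmem (u : V) : u ∈ (if u = a then {a, b} else {u} : Set V) := by
      split_ifs with e <;> simp [e]
    rcases hG with hG | ⟨rfl, hG⟩ | ⟨rfl, hG⟩
    · exact ⟨x, hmem x, y, hmem y, hG⟩
    · exact ⟨b, by simp, y, hmem y, hG⟩
    · exact ⟨x, hmem x, b, by simp, hG.symm⟩

lemma exists_ne (h : ObsApexPseudoforest G) (b : V) : ∃ a, a ≠ b := by
  by_contra! hall
  obtain ⟨T, h1, h2⟩ := h.exists_dense b
  have : T = ∅ := Finset.eq_empty_of_forall_notMem fun x hx => h1 (hall x ▸ hx)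
  simp [this, dsum] at h2

lemma exists_adj (h : ObsApexPseudoforest G) : ∃ a b, G.Adj a b := by
  by_contra! hno
  have hV : Nonempty V := by
    by_contra hempty
    have := not_nonempty_iff.1 hempty
    exact h.1 ⟨∅, Set.subsingleton_empty, fun u => isEmptyElim u.1⟩
  obtain ⟨T, -, hT⟩ := h.exists_dense (Classical.arbitrary V)
  simp [dsum, hno] at hT

lemma two_le_card_nbrs (h : ObsApexPseudoforest G) (b : V) : 2 ≤ (nbrs G b).card := by
  classical
  by_contra! hb
  obtain ⟨z, hz⟩ : ∃ z, ∀ T : Finset V, z ∉ T → b ∉ T → dsum G T ≤ 2 * T.card := by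
    obtain ⟨a, ha⟩ := h.exists_ne b
    obtain ⟨z, -, hz⟩ := h.exists_sparseOff_remove ha
    exact ⟨z, fun T h1 h2 => hz T h2 h1⟩
  obtain ⟨T, h1, h2⟩ := h.exists_dense z
  by_cases hbT : b ∈ T
  · have h3 := hz (T.erase b) (fun hh => h1 (Finset.mem_of_mem_erase hh)) (Finset.notMem_erase b T)
    have h4 := dsum_erase G hbT
    have h5 := Finset.card_le_card (Finset.inter_subset_left (s₁ := nbrs G b) (s₂ := T))
    rw [Finset.card_erase_of_mem hbT] at h3
    have := Finset.card_pos.2 ⟨b, hbT⟩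
    omega
  · exact h2.not_ge (hz T h1 hbT)

lemma adj_of_nbrs_eq_pair [DecidableEq V] (h : ObsApexPseudoforest G) {x a b : V}
    (hx : nbrs G x = {a, b}) : G.Adj a b := by
  by_contra hnot
  have hxa : G.Adj x a := by rw [← mem_nbrs, hx]; simp
  have hxb : G.Adj x b := by rw [← mem_nbrs, hx]; simp
  obtain ⟨z, -, hz⟩ := h.exists_sparseOff_contract hxa.symm
  have hcommon : nbrs G a ∩ nbrs G x = ∅ := by
    rw [hx]
    ext y
    simp only [Finset.mem_inter, mem_nbrs, Finset.mem_insert, Finset.mem_singleton,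
      Finset.notMem_empty, iff_false, not_and, not_or]
    exact fun hy => ⟨hy.ne', fun e => hnot (e ▸ hy)⟩
  have hmem (T : Finset V) (hxT : x ∉ T) (hzT : z ∉ T) (haT : a ∈ T) :
      dsum G (insert x T) ≤ 2 * T.card + 2 := by
    have h1 := hz T hxT hzT
    have h2 := dsum_mergeInto_of_mem G hxa.symm haT hxT
    simp only [hcommon, Finset.empty_inter, Finset.card_empty] at h2
    omega
  obtain ⟨T, h1, h2⟩ := h.exists_dense z
  by_cases hxT : x ∈ T
  · have h0 : (T.erase x).card + 1 = T.card := Finset.card_erase_add_one hxT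
    have hzx : z ∉ T.erase x := fun hh => h1 (Finset.mem_of_mem_erase hh)
    by_cases haT : a ∈ T
    · have h3 := hmem (T.erase x) (Finset.notMem_erase x T) hzx
        (Finset.mem_erase.2 ⟨hxa.ne', haT⟩)
      rw [Finset.insert_erase hxT] at h3
      omega
    · have haT2 : a ∉ T.erase x := fun hh => haT (Finset.mem_of_mem_erase hh)
      have h3 := hz (T.erase x) (Finset.notMem_erase x T) hzx
      rw [dsum_mergeInto_of_notMem G haT2 (Finset.notMem_erase x T)] at h3
      have h4 := dsum_erase G hxT
      have h5 : nbrs G x ∩ T ⊆ {b} := by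
        rw [hx]
        intro y hy
        simp only [Finset.mem_inter, Finset.mem_insert, Finset.mem_singleton] at hy ⊢
        exact hy.1.resolve_left fun e => haT (e ▸ hy.2)
      have h6 := Finset.card_le_card h5
      rw [Finset.card_singleton] at h6
      omega
  · by_cases haT : a ∈ T
    · have h3 := hmem T hxT h1 haT
      rw [dsum_insert G hxT] at h3
      have : 0 < (nbrs G x ∩ T).card := Finset.card_pos.2 ⟨a, by simp [hxa, haT]⟩
      omega
    · have h3 := hz T hxT h1
      rw [dsum_mergeInto_of_notMem G haT hxT] at h3
      omega

lemma no_triangle_component [DecidableEq V] (h : ObsApexPseudoforest G) {x y t : V}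
    (hx : nbrs G x = {y, t}) (hy : nbrs G y = {x, t}) (ht : nbrs G t = {x, y}) : False := by
  classical
  have hxy : G.Adj x y := by rw [← mem_nbrs, hx]; simp
  obtain ⟨z, hz⟩ := h.exists_sparseOff_delete hxy
  obtain ⟨T, h1, h2⟩ := h.exists_dense z
  let C : Finset V := {x, y, t}
  have h3 := dsum_union G (Finset.disjoint_sdiff_inter T C)
  rw [Finset.sdiff_union_inter] at h3
  have hC (u : V) (hu : u ∈ C) : nbrs G u ⊆ C ∧ (nbrs G u).card ≤ 2 := by
    simp only [C, Finset.mem_insert, Finset.mem_singleton] at hu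
    rcases hu with rfl | rfl | rfl
    · rw [hx]
      exact ⟨by intro; simp [C]; tauto, Finset.card_le_two⟩
    · rw [hy]
      exact ⟨by intro; simp [C]; tauto, Finset.card_le_two⟩
    · rw [ht]
      exact ⟨by intro; simp [C]; tauto, Finset.card_le_two⟩
  have h4 : dcross G (T ∩ C) (T \ C) = 0 := by
    refine Finset.sum_eq_zero fun u hu => Finset.card_eq_zero.2 (Finset.filter_eq_empty_iff.2 ?_)
    intro w hw huw
    exact (Finset.mem_sdiff.1 hw).2 ((hC u (Finset.mem_inter.1 hu).2).1 (by simpa using huw))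
  have h5 : dsum G (T ∩ C) ≤ 2 * (T ∩ C).card := by
    rw [mul_comm]
    refine Finset.sum_le_card_nsmul _ _ _ fun u hu => ?_
    refine (Finset.card_le_card ?_).trans (hC u (Finset.mem_inter.1 hu).2).2
    intro w hw
    simpa using (Finset.mem_filter.1 hw).2
  have h6 := hz (T \ C) fun hh => h1 (Finset.mem_sdiff.1 hh).1
  have h7 := dsum_delete_add G hxy (T \ C)
  rw [if_neg (by simp [C])] at h7
  have h8 := Finset.card_sdiff_add_card_inter T C
  omega

end ObsApexPseudoforest

end Minors

section Cores

variable {V : Type} [Fintype V] [DecidableEq V]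

/-- Every vertex outside `C` has degree two, and either both of its neighbours lie in `C` and
are adjacent, or one of them does and the other one is a vertex of the same kind. -/
structure IsCore (G : SimpleGraph V) (C : Finset V) : Prop where
  ear_or_pendant : ∀ x ∉ C,
    (∃ a ∈ C, ∃ b ∈ C, a ≠ b ∧ G.Adj a b ∧ nbrs G x = {a, b}) ∨
    (∃ a ∈ C, ∃ y ∉ C, x ≠ y ∧ nbrs G x = {a, y} ∧ nbrs G y = {a, x})

/-- A core with two special vertices off which the graph is almost sparse. -/
structure IsBasedCore (G : SimpleGraph V) (C : Finset V) (v w : V) : Prop extends IsCore G C where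
  left_mem : v ∈ C
  right_mem : w ∈ C
  ne : v ≠ w
  card_le : C.card ≤ 6
  three_le : ∀ x ∈ C, x ≠ v → x ≠ w → 3 ≤ (nbrs G x).card
  le_nine : ∀ x ∈ C, x ≠ v → x ≠ w → (nbrs G x).card + C.card ≤ 9
  dsum_left : ∀ S : Finset V, v ∉ S → dsum G S ≤ 2 * S.card + 2
  dsum_right : ∀ S : Finset V, w ∉ S → dsum G S ≤ 2 * S.card + 2
  dsum_both : ∀ S : Finset V, v ∉ S → w ∉ S → dsum G S ≤ 2 * S.card

lemma IsBasedCore.swap {G : SimpleGraph V} {C : Finset V} {v w : V} (h : IsBasedCore G C v w) :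
    IsBasedCore G C w v :=
  ⟨h.1, h.right_mem, h.left_mem, h.ne.symm, h.card_le, fun x hx h1 h2 => h.three_le x hx h2 h1,
    fun x hx h1 h2 => h.le_nine x hx h2 h1, h.dsum_right, h.dsum_left,
    fun S h1 h2 => h.dsum_both S h2 h1⟩

lemma sum_card_nbrs_le {G : SimpleGraph V} {v w : V} (hvw : v ≠ w)
    (hv : ∀ S : Finset V, v ∉ S → dsum G S ≤ 2 * S.card + 2)
    (hw : ∀ S : Finset V, w ∉ S → dsum G S ≤ 2 * S.card + 2) {R : Finset V}
    (hR : ∀ x, x ∈ R ↔ x ≠ v ∧ x ≠ w) :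
    ∑ x ∈ R, (nbrs G x).card ≤ 2 * R.card + 4 := by
  classical
  have hvR : v ∉ R := by simp [hR]
  have hwR : w ∉ R := by simp [hR]
  have h1 := dsum_insert G hvR
  have h2 := dsum_insert G hwR
  have h3 := hv (insert w R) (by simp [hvR, hvw])
  have h4 := hw (insert v R) (by simp [hwR, hvw.symm])
  rw [Finset.card_insert_of_notMem hwR] at h3
  rw [Finset.card_insert_of_notMem hvR] at h4
  have key (x : V) : (nbrs G x).card =
      (R.filter fun y => G.Adj x y).card + ((if G.Adj v x then 1 else 0) +
        (if G.Adj w x then 1 else 0)) := by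
    have e : nbrs G x = (R.filter fun y => G.Adj x y) ∪
        ((({v} : Finset V).filter fun y => G.Adj x y) ∪
          (({w} : Finset V).filter fun y => G.Adj x y)) := by
      ext y
      simp only [mem_nbrs, Finset.mem_union, Finset.mem_filter, hR, Finset.mem_singleton]
      tauto
    rw [e, Finset.card_union_of_disjoint, Finset.card_union_of_disjoint,
      Finset.filter_singleton, Finset.filter_singleton, G.adj_comm x v, G.adj_comm x w]
    · split_ifs <;> simp
    · exact Finset.disjoint_filter_filter (by simpa using hvw)
    · rw [← Finset.filter_union]
      refine Finset.disjoint_filter_filter ?_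
      simp [hvR, hwR]
  have e1 : ∑ x ∈ R, (if G.Adj v x then 1 else 0) = (nbrs G v ∩ R).card := by
    rw [← Finset.card_filter]
    congr 1
    ext y
    simp [and_comm]
  have e2 : ∑ x ∈ R, (if G.Adj w x then 1 else 0) = (nbrs G w ∩ R).card := by
    rw [← Finset.card_filter]
    congr 1
    ext y
    simp [and_comm]
  simp only [key, Finset.sum_add_distrib, e1, e2]
  simp only [dsum] at h1 h2 h3 h4
  omega

namespace ObsApexPseudoforest

variable {G : SimpleGraph V}

lemma exists_isBasedCore (h : ObsApexPseudoforest G) : ∃ C v w, IsBasedCore G C v w := by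
  classical
  obtain ⟨a, b, hab⟩ := h.exists_adj
  obtain ⟨v, hv⟩ := h.exists_sparseOff_delete hab
  obtain ⟨u, hu⟩ : ∃ u, G.Adj v u := by
    obtain ⟨u, hu⟩ := Finset.card_pos.1 (zero_lt_two.trans_le (h.two_le_card_nbrs v))
    exact ⟨u, by simpa using hu⟩
  obtain ⟨w, hw⟩ := h.exists_sparseOff_delete hu
  have hvS (S : Finset V) (hS : v ∉ S) : dsum G S ≤ 2 * S.card + 2 := by
    have h1 := dsum_delete_add G hab S
    have h2 := hv S hS
    split_ifs at h1 <;> omega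
  have hwS (S : Finset V) (hS : w ∉ S) : dsum G S ≤ 2 * S.card + 2 := by
    have h1 := dsum_delete_add G hu S
    have h2 := hw S hS
    split_ifs at h1 <;> omega
  have hvwS (S : Finset V) (hS : v ∉ S) (hS2 : w ∉ S) : dsum G S ≤ 2 * S.card := by
    have h1 := dsum_delete_add G hu S
    have h2 := hw S hS2
    rw [if_neg (by simp [hS])] at h1
    omega
  have hvw : v ≠ w := fun e => h.not_sparseOff v fun T hT => hvwS T hT (e ▸ hT)
  let R : Finset V := Finset.univ.filter fun x => x ≠ v ∧ x ≠ w
  have hR (x : V) : x ∈ R ↔ x ≠ v ∧ x ≠ w := by simp [R]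
  let B : Finset V := R.filter fun x => 3 ≤ (nbrs G x).card
  let C : Finset V := insert v (insert w B)
  have hcardC : C.card = B.card + 2 := by
    rw [Finset.card_insert_of_notMem, Finset.card_insert_of_notMem] <;> simp [B, hR, hvw]
  have hsum := sum_card_nbrs_le hvw hvS hwS hR
  have hB : ∑ x ∈ R, (2 + if 3 ≤ (nbrs G x).card then 1 else 0) = 2 * R.card + B.card := by
    rw [Finset.sum_add_distrib, ← Finset.card_filter]
    simp [B, mul_comm]
  have hle (x : V) : (2 + if 3 ≤ (nbrs G x).card then 1 else 0) ≤ (nbrs G x).card := by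
    have := h.two_le_card_nbrs x
    split_ifs <;> omega
  have hB4 : B.card ≤ 4 := by
    have := Finset.sum_le_sum fun x (_ : x ∈ R) => hle x
    omega
  have hmemC (x : V) : x ∈ C ↔ x = v ∨ x = w ∨ 3 ≤ (nbrs G x).card := by
    simp only [C, B, Finset.mem_insert, Finset.mem_filter, hR]
    tauto
  refine ⟨C, v, w, ⟨?_⟩, by simp [C], by simp [C], hvw, by omega, ?_, ?_, hvS, hwS, hvwS⟩
  · have two (x : V) (hx : x ∉ C) : (nbrs G x).card = 2 := by
      rw [hmemC] at hx
      have := h.two_le_card_nbrs x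
      omega
    have other {x y : V} (hy : y ∉ C) (hxy : G.Adj x y) : ∃ c, c ≠ x ∧ nbrs G y = {x, c} := by
      obtain ⟨p, q, hpq, e⟩ := Finset.card_eq_two.1 (two y hy)
      have : x ∈ nbrs G y := by simpa using hxy.symm
      rw [e] at this
      simp only [Finset.mem_insert, Finset.mem_singleton] at this
      rcases this with rfl | rfl
      · exact ⟨q, hpq.symm, e⟩
      · exact ⟨p, hpq, by rw [e, Finset.pair_comm]⟩
    have pend {x a y : V} (hx : x ∉ C) (hy : y ∉ C) (e : nbrs G x = {a, y}) :
        nbrs G y = {a, x} := by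
      have hxy : G.Adj x y := by rw [← mem_nbrs, e]; simp
      obtain ⟨c, hc, e2⟩ := other hy hxy
      have hay := h.adj_of_nbrs_eq_pair e
      have hxa : G.Adj x a := by rw [← mem_nbrs, e]; simp
      have : a ∈ nbrs G y := by simpa using hay.symm
      rw [e2] at this
      simp only [Finset.mem_insert, Finset.mem_singleton] at this
      rw [e2, this.resolve_left hxa.ne', Finset.pair_comm]
    intro x hx
    obtain ⟨p, q, hpq, e⟩ := Finset.card_eq_two.1 (two x hx)
    have e' : nbrs G x = {q, p} := by rw [e, Finset.pair_comm]
    have hxp : G.Adj x p := by rw [← mem_nbrs, e]; simp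
    have hxq : G.Adj x q := by rw [← mem_nbrs, e]; simp
    by_cases hp : p ∈ C
    · by_cases hq : q ∈ C
      · exact Or.inl ⟨p, hp, q, hq, hpq, h.adj_of_nbrs_eq_pair e, e⟩
      · exact Or.inr ⟨p, hp, q, hq, hxq.ne, e, pend hx hq e⟩
    · by_cases hq : q ∈ C
      · exact Or.inr ⟨q, hq, p, hp, hxp.ne, e', pend hx hp e'⟩
      · exact (h.no_triangle_component e ((pend hx hp e').trans (Finset.pair_comm _ _))
          ((pend hx hq e).trans (Finset.pair_comm _ _))).elim
  · intro x hx h1 h2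
    exact ((hmemC x).1 hx).resolve_left h1 |>.resolve_left h2
  · intro x hx h1 h2
    have h3 := ((hmemC x).1 hx).resolve_left h1 |>.resolve_left h2
    have hxR : x ∈ R := (hR x).2 ⟨h1, h2⟩
    have := Finset.sum_le_sum fun y (_ : y ∈ R.erase x) => hle y
    have e1 := Finset.add_sum_erase R (fun y => 2 + if 3 ≤ (nbrs G y).card then 1 else 0) hxR
    have e2 := Finset.add_sum_erase R (fun y => (nbrs G y).card) hxR
    simp only [h3, if_true] at e1
    omega

end ObsApexPseudoforest

end Cores

section Weights

variable {V : Type} [Fintype V] [DecidableEq V] {G : SimpleGraph V} {C : Finset V}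

open Classical in
/-- The number of edges between `a` and `b` after suppressing the vertices outside `C`. -/
noncomputable def wt (G : SimpleGraph V) (C : Finset V) (a b : V) : ℕ :=
  (if G.Adj a b then 1 else 0) + (Cᶜ.filter fun x => nbrs G x ∩ C = {a, b}).card

lemma wt_comm (G : SimpleGraph V) (C : Finset V) (a b : V) : wt G C a b = wt G C b a := by
  rw [wt, wt, Finset.pair_comm]
  by_cases h : G.Adj a b
  · simp [h, h.symm]
  · simp [h, mt G.adj_symm h]

/-- The set `S` together with the vertices outside `C` that only see `S` within `C`. -/
noncomputable def hull (G : SimpleGraph V) (C S : Finset V) : Finset V :=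
  S ∪ Cᶜ.filter fun x => nbrs G x ∩ C ⊆ S

lemma mem_hull_core {S : Finset V} {z : V} (hz : z ∈ C) : z ∈ hull G C S ↔ z ∈ S := by
  simp [hull, hz]

lemma mem_hull_of_notMem {S : Finset V} {x : V} (hS : S ⊆ C) (hx : x ∉ C) :
    x ∈ hull G C S ↔ nbrs G x ∩ C ⊆ S := by
  have : x ∉ S := fun h => hx (hS h)
  simp [hull, hx, this]

lemma dsum_core_union {S X : Finset V} (hS : Disjoint S X) :
    dsum G (S ∪ X) = dsum G S + ∑ x ∈ X, (2 * (nbrs G x ∩ S).card + (nbrs G x ∩ X).card) := by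
  classical
  have e (x : V) (A : Finset V) : (A.filter fun y => G.Adj x y) = nbrs G x ∩ A := by
    ext y
    simp [and_comm]
  rw [dsum_union G hS, Finset.sum_add_distrib, ← Finset.mul_sum]
  simp only [dcross, dsum, e]
  omega

namespace IsCore

lemma trace_cases (h : IsCore G C) {x : V} (hx : x ∉ C) :
    (∃ a ∈ C, ∃ b ∈ C, a ≠ b ∧ G.Adj a b ∧ nbrs G x = {a, b} ∧ nbrs G x ∩ C = {a, b}) ∨
    (∃ a ∈ C, ∃ y ∉ C, x ≠ y ∧ nbrs G x = {a, y} ∧ nbrs G y = {a, x} ∧ nbrs G x ∩ C = {a} ∧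
      nbrs G y ∩ C = {a}) := by
  rcases h.ear_or_pendant x hx with ⟨a, ha, b, hb, hab, hadj, e⟩ | ⟨a, ha, y, hy, hxy, e, e2⟩
  · exact Or.inl ⟨a, ha, b, hb, hab, hadj, e, by
      rw [e]
      exact Finset.inter_eq_left.2 (by
        intro u hu
        simp only [Finset.mem_insert, Finset.mem_singleton] at hu
        rcases hu with rfl | rfl <;> assumption)⟩
  · refine Or.inr ⟨a, ha, y, hy, hxy, e, e2, ?_, ?_⟩
    · rw [e, Finset.insert_inter_of_mem ha, Finset.singleton_inter_of_notMem hy]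
      rfl
    · rw [e2, Finset.insert_inter_of_mem ha, Finset.singleton_inter_of_notMem hx]
      rfl

lemma exists_trace (h : IsCore G C) {x : V} (hx : x ∉ C) :
    ∃ p ∈ C, ∃ q ∈ C, nbrs G x ∩ C = {p, q} := by
  rcases h.trace_cases hx with ⟨a, ha, b, hb, -, -, -, e⟩ | ⟨a, ha, y, -, -, -, -, e, -⟩
  · exact ⟨a, ha, b, hb, e⟩
  · exact ⟨a, ha, a, ha, by rw [e]; simp⟩

lemma card_trace_filter (h : IsCore G C) {x a : V} {S : Finset V} (hx : x ∉ C) (ha : a ∈ S) :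
    (∑ b ∈ S, if nbrs G x ∩ C = {a, b} then 1 else 0) =
      if a ∈ nbrs G x ∩ C ∧ nbrs G x ∩ C ⊆ S then 1 else 0 := by
  obtain ⟨p, hp, q, hq, e⟩ := h.exists_trace hx
  rw [e, ← Finset.card_filter]
  split_ifs with hc
  · obtain ⟨h1, h2⟩ := hc
    obtain ⟨r, hr⟩ : ∃ r, ({p, q} : Finset V) = {a, r} := by
      simp only [Finset.mem_insert, Finset.mem_singleton] at h1
      rcases h1 with rfl | rfl
      · exact ⟨q, rfl⟩
      · exact ⟨p, Finset.pair_comm _ _⟩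
    rw [hr] at h2 ⊢
    rw [Finset.card_eq_one]
    refine ⟨r, ?_⟩
    ext b
    simp only [Finset.mem_filter, Finset.mem_singleton]
    constructor
    · rintro ⟨-, e⟩
      have h3 : r ∈ ({a, b} : Finset V) := by rw [← e]; simp
      have h4 : b ∈ ({a, r} : Finset V) := by rw [e]; simp
      simp only [Finset.mem_insert, Finset.mem_singleton] at h3 h4
      rcases h4 with rfl | rfl
      · rcases h3 with rfl | rfl <;> rfl
      · rfl
    · rintro rfl
      exact ⟨h2 (by simp), rfl⟩
  · rw [Finset.card_eq_zero, Finset.filter_eq_empty_iff]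
    intro b hb e2
    refine hc ?_
    rw [e2]
    refine ⟨by simp, ?_⟩
    intro u hu
    simp only [Finset.mem_insert, Finset.mem_singleton] at hu
    rcases hu with rfl | rfl <;> assumption

lemma sum_wt (h : IsCore G C) (S : Finset V) :
    ∑ a ∈ S, ∑ b ∈ S, wt G C a b =
      dsum G S + ∑ x ∈ Cᶜ, if nbrs G x ∩ C ⊆ S then (nbrs G x ∩ C).card else 0 := by
  classical
  simp only [wt, Finset.sum_add_distrib]
  congr 1
  · simp only [dsum, Finset.card_filter]
  · simp only [Finset.card_filter]
    rw [Finset.sum_congr rfl fun a _ => Finset.sum_comm, Finset.sum_comm]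
    refine Finset.sum_congr rfl fun x hx => ?_
    rw [Finset.mem_compl] at hx
    rw [Finset.sum_congr rfl fun a ha => h.card_trace_filter hx ha]
    split_ifs with hc
    · simp only [hc, and_true]
      rw [← Finset.card_filter]
      congr 1
      ext u
      simp only [Finset.mem_filter]
      exact ⟨fun hu => hu.2, fun hu => ⟨hc hu, hu⟩⟩
    · simp [hc]

lemma card_nbrs (h : IsCore G C) {a : V} (ha : a ∈ C) :
    (nbrs G a).card = ∑ b ∈ C, wt G C a b := by
  classical
  simp only [wt, Finset.sum_add_distrib, Finset.card_filter]
  rw [Finset.sum_comm, Finset.sum_congr rfl fun x hx =>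
    h.card_trace_filter (Finset.mem_compl.1 hx) ha]
  rw [← Finset.card_filter, ← Finset.card_filter, ← Finset.card_union_of_disjoint]
  · congr 1
    ext y
    simp only [mem_nbrs, Finset.mem_union, Finset.mem_filter, Finset.mem_compl, Finset.mem_inter,
      Finset.inter_subset_right, and_true, G.adj_comm y a]
    tauto
  · rw [Finset.disjoint_left]
    intro y hy hy2
    exact (Finset.mem_compl.1 (Finset.mem_filter.1 hy2).1) (Finset.mem_filter.1 hy).1

lemma dsum_add_le (h : IsCore G C) (T : Finset V) :
    dsum G T + 2 * (T ∩ C).card ≤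
      2 * T.card + ∑ a ∈ T ∩ C, ∑ b ∈ T ∩ C, wt G C a b := by
  classical
  have hd : Disjoint (T ∩ C) (T \ C) := (Finset.disjoint_sdiff_inter T C).symm
  have h1 := dsum_core_union (G := G) hd
  rw [Finset.union_comm, Finset.sdiff_union_inter] at h1
  have h2 := Finset.card_sdiff_add_card_inter T C
  rw [h.sum_wt]
  have h3 : ∑ x ∈ T \ C, (2 * (nbrs G x ∩ (T ∩ C)).card + (nbrs G x ∩ (T \ C)).card) ≤
      ∑ x ∈ T \ C, (2 + if nbrs G x ∩ C ⊆ T ∩ C then (nbrs G x ∩ C).card else 0) := by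
    refine Finset.sum_le_sum fun x hx => ?_
    obtain ⟨-, hx⟩ := Finset.mem_sdiff.1 hx
    have e1 : nbrs G x ∩ (T ∩ C) = (nbrs G x ∩ C) ∩ T := by
      rw [Finset.inter_comm T, Finset.inter_assoc]
    have e2 : nbrs G x ∩ (T \ C) ⊆ nbrs G x \ C := fun u hu => by
      simp only [Finset.mem_inter, Finset.mem_sdiff] at hu ⊢
      exact ⟨hu.1, hu.2.2⟩
    have e3 := Finset.card_le_card e2
    have e4 : nbrs G x ∩ C ⊆ T ∩ C ↔ nbrs G x ∩ C ⊆ T := by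
      rw [Finset.subset_inter_iff]
      exact and_iff_left Finset.inter_subset_right
    rw [e1]
    simp only [e4]
    have e5 := Finset.card_le_card (Finset.inter_subset_left (s₁ := nbrs G x ∩ C) (s₂ := T))
    rcases h.trace_cases hx with ⟨a, ha, b, hb, hab, -, f1, f2⟩ | ⟨a, ha, y, hy, -, f1, -, f2, -⟩
    · have f3 : nbrs G x \ C = ∅ := by
        rw [Finset.sdiff_eq_empty_iff_subset, f1, ← f2]
        exact Finset.inter_subset_right
      have f4 : (nbrs G x ∩ C).card = 2 := by rw [f2, Finset.card_pair hab]
      rw [f3, Finset.card_empty] at e3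
      split_ifs with hc
      · omega
      · have : nbrs G x ∩ C ∩ T ≠ nbrs G x ∩ C := fun e => hc (Finset.inter_eq_left.1 e)
        have := Finset.card_lt_card (Finset.inter_subset_left.ssubset_of_ne this)
        omega
    · have f4 : (nbrs G x ∩ C).card = 1 := by rw [f2, Finset.card_singleton]
      have f3 := Finset.card_sdiff_add_card_inter (nbrs G x) C
      have f5 : (nbrs G x).card ≤ 2 := by rw [f1]; exact Finset.card_le_two
      split_ifs with hc
      · omega
      · have : nbrs G x ∩ C ∩ T ≠ nbrs G x ∩ C := fun e => hc (Finset.inter_eq_left.1 e)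
        have := Finset.card_lt_card (Finset.inter_subset_left.ssubset_of_ne this)
        omega
  have h4 : ∑ x ∈ T \ C, (if nbrs G x ∩ C ⊆ T ∩ C then (nbrs G x ∩ C).card else 0) ≤
      ∑ x ∈ Cᶜ, (if nbrs G x ∩ C ⊆ T ∩ C then (nbrs G x ∩ C).card else 0) :=
    Finset.sum_le_sum_of_subset fun x hx => Finset.mem_compl.2 (Finset.mem_sdiff.1 hx).2
  rw [Finset.sum_add_distrib (f := fun _ => 2), Finset.sum_const, smul_eq_mul] at h3
  omega

lemma dsum_hull (h : IsCore G C) {S : Finset V} (hS : S ⊆ C) :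
    dsum G (hull G C S) + 2 * S.card =
      2 * (hull G C S).card + ∑ a ∈ S, ∑ b ∈ S, wt G C a b := by
  classical
  have hd : Disjoint S (Cᶜ.filter fun x => nbrs G x ∩ C ⊆ S) := by
    rw [Finset.disjoint_left]
    intro u hu hu2
    exact (Finset.mem_compl.1 (Finset.mem_filter.1 hu2).1) (hS hu)
  rw [hull, dsum_core_union hd, Finset.card_union_of_disjoint hd, h.sum_wt,
    ← Finset.sum_filter]
  have : ∑ x ∈ Cᶜ.filter fun x => nbrs G x ∩ C ⊆ S, (2 * (nbrs G x ∩ S).card +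
      (nbrs G x ∩ Cᶜ.filter fun x => nbrs G x ∩ C ⊆ S).card) =
      ∑ x ∈ Cᶜ.filter fun x => nbrs G x ∩ C ⊆ S, (2 + (nbrs G x ∩ C).card) := by
    refine Finset.sum_congr rfl fun x hx => ?_
    obtain ⟨hx, hc⟩ := Finset.mem_filter.1 hx
    rw [Finset.mem_compl] at hx
    have e1 : nbrs G x ∩ S = nbrs G x ∩ C := by
      ext u
      simp only [Finset.mem_inter]
      exact ⟨fun hu => ⟨hu.1, hS hu.2⟩, fun hu => ⟨hu.1, hc (Finset.mem_inter.2 hu)⟩⟩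
    rw [e1]
    rcases h.trace_cases hx with ⟨a, ha, b, hb, hab, -, f1, f2⟩ |
      ⟨a, ha, y, hy, -, f1, -, f2, f3⟩
    · have f4 : (nbrs G x ∩ C).card = 2 := by rw [f2, Finset.card_pair hab]
      have f5 : (nbrs G x ∩ Cᶜ.filter fun x => nbrs G x ∩ C ⊆ S) = ∅ := by
        rw [Finset.eq_empty_iff_forall_notMem]
        intro u hu
        rw [f1, Finset.mem_inter, ← f2, Finset.mem_filter, Finset.mem_compl] at hu
        exact hu.2.1 (Finset.mem_inter.1 hu.1).2
      rw [f4, f5, Finset.card_empty]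
    · have f4 : (nbrs G x ∩ C).card = 1 := by rw [f2, Finset.card_singleton]
      have f5 : (nbrs G x ∩ Cᶜ.filter fun x => nbrs G x ∩ C ⊆ S) = {y} := by
        ext u
        simp only [f1, Finset.mem_inter, Finset.mem_filter, Finset.mem_compl, Finset.mem_insert,
          Finset.mem_singleton]
        constructor
        · rintro ⟨rfl | rfl, h1, -⟩
          · exact absurd ha h1
          · rfl
        · rintro rfl
          exact ⟨Or.inr rfl, hy, by rw [f3, ← f2]; exact hc⟩
      rw [f4, f5, Finset.card_singleton]
  rw [this, Finset.sum_add_distrib]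
  simp only [Finset.sum_const, smul_eq_mul]
  omega

lemma even_wt_self (h : IsCore G C) {a : V} (ha : a ∈ C) : Even (wt G C a a) := by
  have h1 := h.dsum_hull (S := {a}) (by simpa using ha)
  have h2 := dsum_eq_edges G (hull G C {a})
  simp only [Finset.sum_singleton, Finset.card_singleton] at h1
  rw [Nat.even_iff]
  omega

lemma adj_of_wt_ne_zero (h : IsCore G C) {a b : V} (hab : a ≠ b) (hw : wt G C a b ≠ 0) :
    G.Adj a b := by
  by_contra hn
  obtain ⟨x, hx⟩ : ∃ x, x ∈ Cᶜ.filter fun x => nbrs G x ∩ C = {a, b} := by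
    by_contra! hno
    rw [wt, if_neg hn, Finset.eq_empty_of_forall_notMem hno] at hw
    simp at hw
  obtain ⟨hx, e⟩ := Finset.mem_filter.1 hx
  rcases h.trace_cases (Finset.mem_compl.1 hx) with ⟨p, -, q, -, -, hpq, -, f⟩ |
    ⟨p, -, y, -, -, -, -, f, -⟩
  · rw [e] at f
    have h1 : a ∈ ({p, q} : Finset V) := by rw [← f]; simp
    have h2 : b ∈ ({p, q} : Finset V) := by rw [← f]; simp
    simp only [Finset.mem_insert, Finset.mem_singleton] at h1 h2
    rcases h1 with rfl | rfl <;> rcases h2 with rfl | rfl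
    exacts [hab rfl, hn hpq, hn hpq.symm, hab rfl]
  · rw [e] at f
    have h1 : a ∈ ({p} : Finset V) := by rw [← f]; simp
    have h2 : b ∈ ({p} : Finset V) := by rw [← f]; simp
    rw [Finset.mem_singleton] at h1 h2
    exact hab (h1.trans h2.symm)

end IsCore

end Weights

section CoreMinors

variable {V : Type} [Fintype V] [DecidableEq V] {G : SimpleGraph V} {C : Finset V}

/-- Twice the number of edges inside `S` after suppressing the vertices outside `C`. -/
noncomputable def swt (G : SimpleGraph V) (C S : Finset V) : ℕ := ∑ a ∈ S, ∑ b ∈ S, wt G C a b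

lemma IsBasedCore.swt_left {v w : V} (h : IsBasedCore G C v w) {S : Finset V} (hS : S ⊆ C)
    (hv : v ∉ S) : swt G C S ≤ 2 * S.card + 2 := by
  have h1 := h.dsum_hull hS
  have h2 := h.dsum_left (hull G C S) (by rwa [mem_hull_core h.left_mem])
  rw [swt]
  omega

lemma IsBasedCore.swt_right {v w : V} (h : IsBasedCore G C v w) {S : Finset V} (hS : S ⊆ C)
    (hw : w ∉ S) : swt G C S ≤ 2 * S.card + 2 :=
  h.swap.swt_left hS hw

lemma IsBasedCore.swt_both {v w : V} (h : IsBasedCore G C v w) {S : Finset V} (hS : S ⊆ C)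
    (hv : v ∉ S) (hw : w ∉ S) : swt G C S ≤ 2 * S.card := by
  have h1 := h.dsum_hull hS
  have h2 := h.dsum_both (hull G C S) (by rwa [mem_hull_core h.left_mem])
    (by rwa [mem_hull_core h.right_mem])
  rw [swt]
  omega

lemma IsCore.card_nbrs_le (h : IsCore G C) {z : V} (hz : z ∉ C) : (nbrs G z).card ≤ 2 := by
  rcases h.ear_or_pendant z hz with ⟨a, -, b, -, -, -, e⟩ | ⟨a, -, b, -, -, e, -⟩ <;>
  · rw [e]
    exact Finset.card_le_two

lemma IsCore.exists_adj (h : IsCore G C) {z : V} (hz : z ∉ C) : ∃ c ∈ C, G.Adj z c := by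
  rcases h.ear_or_pendant z hz with ⟨a, ha, b, -, -, -, e⟩ | ⟨a, ha, b, -, -, e, -⟩ <;>
  · refine ⟨a, ha, ?_⟩
    rw [← mem_nbrs, e]
    simp

namespace ObsApexPseudoforest

lemma exists_dense_core (h : ObsApexPseudoforest G) (hC : IsCore G C) (z : V) :
    ∃ S ⊆ C, z ∉ S ∧ 2 * S.card < swt G C S := by
  obtain ⟨T, h1, h2⟩ := h.exists_dense z
  have h3 := hC.dsum_add_le T
  exact ⟨T ∩ C, Finset.inter_subset_right, fun hz => h1 (Finset.mem_inter.1 hz).1, by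
    rw [swt]
    omega⟩

lemma exists_core_delete (h : ObsApexPseudoforest G) (hC : IsCore G C) {a b : V} (ha : a ∈ C)
    (hb : b ∈ C) (hw : wt G C a b ≠ 0) :
    ∃ z ∈ C, ∀ S ⊆ C, z ∉ S → swt G C S ≤ 2 * S.card + if a ∈ S ∧ b ∈ S then 2 else 0 := by
  obtain ⟨x, y, hxy, hC2, hhull⟩ : ∃ x y, G.Adj x y ∧ (∀ c ∈ C, ∀ z ∉ C, s(z, c) ≠ s(x, y)) ∧
      ∀ S ⊆ C, (x ∈ hull G C S ∧ y ∈ hull G C S) → (a ∈ S ∧ b ∈ S) := by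
    rcases eq_or_ne a b with rfl | hab
    · obtain ⟨x, hx⟩ : ∃ x, x ∈ Cᶜ.filter fun x => nbrs G x ∩ C = {a, a} := by
        by_contra! hno
        rw [wt, if_neg (G.loopless.irrefl a), Finset.eq_empty_of_forall_notMem hno] at hw
        simp at hw
      obtain ⟨hx, e⟩ := Finset.mem_filter.1 hx
      rw [Finset.mem_compl] at hx
      rcases hC.trace_cases hx with ⟨p, -, q, -, hpq, -, -, f⟩ | ⟨p, hp, y, hy, hxy, f, -, f1, -⟩
      · rw [e] at f
        have := congrArg Finset.card f
        rw [Finset.card_pair hpq] at this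
        simp at this
      · refine ⟨x, y, by rw [← mem_nbrs, f]; simp, ?_, ?_⟩
        · intro c hc z hz e
          rcases Sym2.eq_iff.1 e with ⟨rfl, rfl⟩ | ⟨rfl, rfl⟩ <;> contradiction
        · intro S hS hh
          have := (mem_hull_of_notMem hS hx).1 hh.1
          rw [e] at this
          exact ⟨this (by simp), this (by simp)⟩
    · refine ⟨a, b, hC.adj_of_wt_ne_zero hab hw, ?_, ?_⟩
      · intro c hc z hz e
        rcases Sym2.eq_iff.1 e with ⟨rfl, rfl⟩ | ⟨rfl, rfl⟩ <;> contradiction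
      · intro S hS hh
        rwa [mem_hull_core ha, mem_hull_core hb] at hh
  obtain ⟨z, hz, hzs⟩ : ∃ z ∈ C, SparseOff (G.deleteEdges {s(x, y)}) z := by
    obtain ⟨z, hz⟩ := h.exists_sparseOff_delete hxy
    by_cases hzC : z ∈ C
    · exact ⟨z, hzC, hz⟩
    · obtain ⟨c, hc, hzc⟩ := hC.exists_adj hzC
      refine ⟨c, hc, hz.move ?_ (deleteEdges_adj.2 ⟨hzc, hC2 c hc z hzC⟩)⟩
      refine (Finset.card_le_card fun u hu => ?_).trans (hC.card_nbrs_le hzC)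
      rw [mem_nbrs] at hu ⊢
      exact deleteEdges_le _ hu
  refine ⟨z, hz, fun S hS hzS => ?_⟩
  have h1 := hC.dsum_hull hS
  have h2 := hzs (hull G C S) (by rwa [mem_hull_core hz])
  have h3 := dsum_delete_add G hxy (hull G C S)
  have h4 := hhull S hS
  rw [swt]
  by_cases h5 : a ∈ S ∧ b ∈ S
  · rw [if_pos h5]
    split_ifs at h3 <;> omega
  · rw [if_neg h5]
    rw [if_neg (mt h4 h5)] at h3
    omega

lemma exists_core_contract (h : ObsApexPseudoforest G) (hC : IsCore G C) {a b : V} (ha : a ∈ C)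
    (hb : b ∈ C) (hab : a ≠ b) (hw : wt G C a b ≠ 0) :
    ∃ z ∈ C, z ≠ b ∧ ∀ S ⊆ C, z ∉ S →
      (a ∉ S → b ∉ S → swt G C S ≤ 2 * S.card) ∧
      (a ∈ S → b ∈ S → swt G C S + 2 ≤ 2 * S.card + 2 * wt G C a b +
        2 * (S.filter fun r => r ≠ a ∧ r ≠ b ∧ wt G C a r ≠ 0 ∧ wt G C b r ≠ 0).card) := by
  classical
  have hadj := hC.adj_of_wt_ne_zero hab hw
  obtain ⟨z, hz, hzb, hzs⟩ : ∃ z ∈ C, z ≠ b ∧ SparseOff (mergeInto G a b) z := by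
    obtain ⟨z, hzb, hz⟩ := h.exists_sparseOff_contract hadj
    have hz : SparseOff (mergeInto G a b) z := by
      intro T hT
      by_cases hbT : b ∈ T
      · have h1 := dsum_erase (mergeInto G a b) hbT
        have h2 := hz (T.erase b) (Finset.notMem_erase b T)
          fun hh => hT (Finset.mem_of_mem_erase hh)
        have h3 : nbrs (mergeInto G a b) b = ∅ := by
          ext u
          simp [mergeInto]
        have h4 := Finset.card_erase_le (s := T) (a := b)
        rw [h3, Finset.empty_inter, Finset.card_empty] at h1
        omega
      · exact hz T hbT hT
    by_cases hzC : z ∈ C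
    · exact ⟨z, hzC, hzb, hz⟩
    · obtain ⟨c, hc, hzc⟩ := hC.exists_adj hzC
      have hza : z ≠ a := fun e => hzC (e ▸ ha)
      have hcard : (nbrs (mergeInto G a b) z).card ≤ 2 := by
        refine le_trans ?_ (hC.card_nbrs_le hzC)
        refine (Finset.card_le_card ?_).trans
          (Finset.card_image_le (s := nbrs G z) (f := fun u => if u = b then a else u))
        intro u hu
        simp only [mem_nbrs, mergeInto, hza, false_and, false_or] at hu
        rw [Finset.mem_image]
        obtain ⟨-, hub, -, hu | ⟨rfl, hu⟩⟩ := hu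
        · exact ⟨u, by simpa using hu, if_neg hub⟩
        · exact ⟨b, by simpa using hu.symm, if_pos rfl⟩
      by_cases hcb : c = b
      · subst hcb
        exact ⟨a, ha, hab, hz.move hcard ⟨hzb, hab, hza, Or.inr (Or.inr ⟨rfl, hzc.symm⟩)⟩⟩
      · exact ⟨c, hc, hcb, hz.move hcard ⟨hzb, hcb, hzc.ne, Or.inl hzc⟩⟩
  refine ⟨z, hz, hzb, fun S hS hzS => ?_⟩
  have h1 := hC.dsum_hull hS
  constructor
  · intro haS hbS
    have h2 := hzs (hull G C S) (by rwa [mem_hull_core hz])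
    rw [dsum_mergeInto_of_notMem G (by rwa [mem_hull_core ha]) (by rwa [mem_hull_core hb])] at h2
    rw [swt]
    omega
  · intro haS hbS
    have hbH : b ∈ hull G C S := by rwa [mem_hull_core hb]
    have haH : a ∈ hull G C S := by rwa [mem_hull_core ha]
    have h2 := hzs ((hull G C S).erase b)
      (by rw [Finset.mem_erase, mem_hull_core hz]; exact fun hh => hzS hh.2)
    have h3 := dsum_mergeInto_of_mem G hadj (T := (hull G C S).erase b)
      (Finset.mem_erase.2 ⟨hab, haH⟩) (Finset.notMem_erase b _)
    rw [Finset.insert_erase hbH] at h3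
    rw [Finset.card_erase_of_mem hbH] at h2
    have h4 := Finset.card_pos.2 ⟨b, hbH⟩
    have h5 : nbrs G a ∩ nbrs G b ∩ (hull G C S).erase b ⊆
        (Cᶜ.filter fun x => nbrs G x ∩ C = {a, b}) ∪
          S.filter fun r => r ≠ a ∧ r ≠ b ∧ wt G C a r ≠ 0 ∧ wt G C b r ≠ 0 := by
      intro u hu
      simp only [Finset.mem_inter, mem_nbrs, Finset.mem_erase] at hu
      obtain ⟨⟨hau, hbu⟩, -, huS⟩ := hu
      rw [Finset.mem_union]
      by_cases huC : u ∈ C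
      · right
        rw [mem_hull_core huC] at huS
        refine Finset.mem_filter.2 ⟨huS, hau.ne', hbu.ne', ?_, ?_⟩
        · rw [wt, if_pos hau]
          omega
        · rw [wt, if_pos hbu]
          omega
      · left
        have h6 : {a, b} ⊆ nbrs G u ∩ C := by
          intro v hv
          rw [Finset.mem_insert, Finset.mem_singleton] at hv
          rw [Finset.mem_inter, mem_nbrs]
          rcases hv with rfl | rfl
          exacts [⟨hau.symm, ha⟩, ⟨hbu.symm, hb⟩]
        refine Finset.mem_filter.2 ⟨Finset.mem_compl.2 huC, (Finset.eq_of_subset_of_card_le h6 ?_).symm⟩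
        rw [Finset.card_pair hab]
        exact (Finset.card_le_card Finset.inter_subset_left).trans (hC.card_nbrs_le huC)
    have h6 := (Finset.card_le_card h5).trans (Finset.card_union_le _ _)
    have h7 : wt G C a b = 1 + (Cᶜ.filter fun x => nbrs G x ∩ C = {a, b}).card := by
      rw [wt, if_pos hadj]
    rw [swt]
    omega

end ObsApexPseudoforest

end CoreMinors

section CoreIso

lemma exists_equiv_commute {α β : Type*} [Finite α] [Finite β] {f : α → α} {g : β → β}
    (hf : Function.Involutive f) (hg : Function.Involutive g) (hf' : ∀ x, f x ≠ x)
    (hg' : ∀ x, g x ≠ x) (h : Nat.card α = Nat.card β) : ∃ e : α ≃ β, ∀ x, e (f x) = g (e x) := by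
  classical
  obtain ⟨e₀⟩ := Finite.card_eq.1 h
  cases nonempty_fintype α
  have key (f : α → α) (hf : Function.Involutive f) (hf' : ∀ x, f x ≠ x) :
      (hf.toPerm f).cycleType = Multiset.replicate (Fintype.card α / 2) 2 := by
    have h2 : ∀ n ∈ (hf.toPerm f).cycleType, n = 2 := by
      intro n hn
      have h3 := Equiv.Perm.two_le_of_mem_cycleType hn
      have h4 := Equiv.Perm.dvd_of_mem_cycleType hn
      have h5 : orderOf (hf.toPerm f) ∣ 2 := orderOf_dvd_of_pow_eq_one (by
        ext x
        simp [sq, hf x])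
      have h6 := Nat.le_of_dvd (by norm_num) (h4.trans h5)
      omega
    have h3 := Multiset.eq_replicate_of_mem h2
    have h4 := Equiv.Perm.sum_cycleType (hf.toPerm f)
    have h5 : (hf.toPerm f).support = Finset.univ := by
      ext x
      simp [hf' x]
    rw [h5, Finset.card_univ, h3, Multiset.sum_replicate] at h4
    rw [h3, ← h4]
    simp
  have hg2 : Function.Involutive (fun x => e₀.symm (g (e₀ x))) := fun x => by simp [hg _]
  have hc : IsConj (hf.toPerm f) (hg2.toPerm _) := by
    rw [Equiv.Perm.isConj_iff_cycleType_eq, key f hf hf', key _ hg2]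
    intro x hx
    exact hg' (e₀ x) (by simpa [Equiv.symm_apply_eq] using hx)
  obtain ⟨c, hc⟩ := isConj_iff.1 hc
  refine ⟨c.trans e₀, fun x => ?_⟩
  have := congrArg (fun p : Equiv.Perm α => e₀ (p (c x))) hc
  simpa using this

namespace IsCore

variable {V : Type} [Fintype V] [DecidableEq V] {G : SimpleGraph V} {C : Finset V}

lemma adj_outside (h : IsCore G C) {x y : V} (hx : x ∉ C) (hy : y ∉ C) (hxy : G.Adj x y) :
    ∃ a ∈ C, nbrs G x = {a, y} ∧ nbrs G x ∩ C = {a} ∧ nbrs G y ∩ C = {a} := by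
  rcases h.trace_cases hx with ⟨a, ha, b, hb, -, -, e, -⟩ | ⟨a, ha, z, hz, -, e, -, h1, h2⟩
  · have : y ∈ nbrs G x := by simpa using hxy
    rw [e] at this
    simp only [Finset.mem_insert, Finset.mem_singleton] at this
    rcases this with rfl | rfl <;> contradiction
  · have : y ∈ nbrs G x := by simpa using hxy
    rw [e] at this
    simp only [Finset.mem_insert, Finset.mem_singleton] at this
    rcases this with rfl | rfl
    · contradiction
    · exact ⟨a, ha, e, h1, h2⟩

lemma exists_partner (h : IsCore G C) {x a : V} (hx : x ∉ C) (he : nbrs G x ∩ C = {a}) :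
    ∃ y ∉ C, nbrs G y ∩ C = {a} ∧ ∀ z ∉ C, G.Adj x z ↔ z = y := by
  rcases h.trace_cases hx with ⟨b, hb, c, hc, hbc, -, -, e⟩ | ⟨b, hb, y, hy, -, e, -, h1, h2⟩
  · rw [he] at e
    have h1 : b ∈ ({a} : Finset V) := e ▸ by simp
    have h2 : c ∈ ({a} : Finset V) := e ▸ by simp
    simp only [Finset.mem_singleton] at h1 h2
    exact absurd (h1.trans h2.symm) hbc
  · refine ⟨y, hy, by rw [h2, ← h1, he], fun z hz => ?_⟩
    rw [← mem_nbrs, e]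
    simp only [Finset.mem_insert, Finset.mem_singleton]
    exact or_iff_right (by rintro rfl; exact hz hb)

/-- Matching up the vertices outside the core that see the same core vertices. -/
lemma exists_fiber_equiv {V' : Type} [Fintype V'] [DecidableEq V'] {G' : SimpleGraph V'}
    {C' : Finset V'} (h : IsCore G C) (h' : IsCore G' C') {a b : V} {a' b' : V'} (hab : a = b ↔ a' = b')
    (hc : (Cᶜ.filter fun x => nbrs G x ∩ C = {a, b}).card =
      (C'ᶜ.filter fun x => nbrs G' x ∩ C' = {a', b'}).card) :
    ∃ e : {x // x ∉ C ∧ nbrs G x ∩ C = {a, b}} ≃ {x // x ∉ C' ∧ nbrs G' x ∩ C' = {a', b'}},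
      ∀ x y, G'.Adj (e x : V') (e y) ↔ G.Adj (x : V) y := by
  have hcard : Nat.card {x // x ∉ C ∧ nbrs G x ∩ C = {a, b}} =
      Nat.card {x // x ∉ C' ∧ nbrs G' x ∩ C' = {a', b'}} := by
    rw [Nat.card_eq_fintype_card, Nat.card_eq_fintype_card, Fintype.card_subtype,
      Fintype.card_subtype]
    convert hc using 2 <;> ext x <;> simp
  by_cases hne : a = b
  · obtain rfl := hne
    obtain rfl := hab.1 rfl
    have key {V : Type} [Fintype V] [DecidableEq V] {G : SimpleGraph V} {C : Finset V} (a : V)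
        (h : IsCore G C) : ∃ f : {x // x ∉ C ∧ nbrs G x ∩ C = {a, a}} →
          {x // x ∉ C ∧ nbrs G x ∩ C = {a, a}},
          ∀ x y : {x // x ∉ C ∧ nbrs G x ∩ C = {a, a}}, G.Adj (x : V) y ↔ y = f x := by
      have (x : {x // x ∉ C ∧ nbrs G x ∩ C = {a, a}}) :
          ∃ z : {x // x ∉ C ∧ nbrs G x ∩ C = {a, a}},
            ∀ y : {x // x ∉ C ∧ nbrs G x ∩ C = {a, a}}, G.Adj (x : V) y ↔ y = z := by
        obtain ⟨z, hz, e, h1⟩ := h.exists_partner x.2.1 (x.2.2.trans (Finset.pair_eq_singleton a))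
        exact ⟨⟨z, hz, e.trans (Finset.pair_eq_singleton a).symm⟩,
          fun y => by rw [h1 y y.2.1, Subtype.ext_iff]⟩
      choose f hf using this
      exact ⟨f, hf⟩
    obtain ⟨f, hf⟩ := key a h
    obtain ⟨g, hg⟩ := key a' h'
    have inv {V : Type} {G : SimpleGraph V} {p : V → Prop} {f : Subtype p → Subtype p}
        (hf : ∀ x y : Subtype p, G.Adj (x : V) y ↔ y = f x) :
        Function.Involutive f ∧ ∀ x, f x ≠ x := by
      refine ⟨fun x => ?_, fun x hx => ?_⟩
      · exact ((hf _ _).1 ((hf _ _).2 rfl).symm).symm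
      · exact G.irrefl ((hf x x).2 hx.symm)
    obtain ⟨e, he⟩ := exists_equiv_commute (inv hf).1 (inv hg).1 (inv hf).2 (inv hg).2 hcard
    refine ⟨e, fun x y => ?_⟩
    rw [hf, hg, ← he, e.apply_eq_iff_eq]
  · obtain ⟨e⟩ := Finite.card_eq.1 hcard
    refine ⟨e, fun x y => ?_⟩
    have hne' : a' ≠ b' := mt hab.2 hne
    have key {V : Type} [Fintype V] [DecidableEq V] {G : SimpleGraph V} {C : Finset V} {a b : V}
        (h : IsCore G C) (hab : a ≠ b) (x y : {x // x ∉ C ∧ nbrs G x ∩ C = {a, b}}) :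
        ¬ G.Adj (x : V) y := by
      intro hxy
      obtain ⟨c, -, -, h1, -⟩ := h.adj_outside x.2.1 y.2.1 hxy
      rw [x.2.2] at h1
      have h2 : a ∈ ({c} : Finset V) := h1 ▸ by simp
      have h3 : b ∈ ({c} : Finset V) := h1 ▸ by simp
      simp only [Finset.mem_singleton] at h2 h3
      exact hab (h2.trans h3.symm)
    exact iff_of_false (key h' hne' _ _) (key h hne _ _)

/-- Two graphs are isomorphic if they have cores that agree in adjacencies and in the numbers of
vertices outside that see given core vertices. -/
theorem nonempty_iso {V' ι : Type} [Fintype V'] [DecidableEq V'] [Fintype ι] [DecidableEq ι]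
    {G' : SimpleGraph V'} {φ : ι → V} {φ' : ι → V'} (hφ : Function.Injective φ)
    (hφ' : Function.Injective φ') (h : IsCore G (Finset.univ.image φ))
    (h' : IsCore G' (Finset.univ.image φ')) (hadj : ∀ i j, G.Adj (φ i) (φ j) ↔ G'.Adj (φ' i) (φ' j))
    (hc : ∀ i j, ((Finset.univ.image φ)ᶜ.filter fun x =>
        nbrs G x ∩ Finset.univ.image φ = {φ i, φ j}).card =
      ((Finset.univ.image φ')ᶜ.filter fun x =>
        nbrs G' x ∩ Finset.univ.image φ' = {φ' i, φ' j}).card) : Nonempty (G ≃g G') := by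
  classical
  set C := Finset.univ.image φ with hC
  set C' := Finset.univ.image φ' with hC'
  have htr {V : Type} [Fintype V] [DecidableEq V] {G : SimpleGraph V} {φ : ι → V}
      (hφ : Function.Injective φ) (x : V) (t : Finset ι) :
      (Finset.univ.filter fun i => G.Adj x (φ i)) = t ↔
        nbrs G x ∩ Finset.univ.image φ = t.image φ := by
    have : nbrs G x ∩ Finset.univ.image φ =
        (Finset.univ.filter fun i => G.Adj x (φ i)).image φ := by
      ext y
      simp only [Finset.mem_inter, mem_nbrs, Finset.mem_image, Finset.mem_filter, Finset.mem_univ,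
        true_and]
      constructor
      · rintro ⟨h1, i, rfl⟩
        exact ⟨i, h1, rfl⟩
      · rintro ⟨i, h1, rfl⟩
        exact ⟨h1, i, rfl⟩
    rw [this, (Finset.image_injective hφ).eq_iff]
  have hfib (t : Finset ι) :
      ∃ e : {x : {x // x ∉ C} // (Finset.univ.filter fun i => G.Adj x (φ i)) = t} ≃
        {x : {x // x ∉ C'} // (Finset.univ.filter fun i => G'.Adj x (φ' i)) = t},
        ∀ x y, G'.Adj (e x : V') (e y) ↔ G.Adj (x : V) y := by
    by_cases ht : ∃ i j, t = {i, j}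
    · obtain ⟨i, j, rfl⟩ := ht
      obtain ⟨e, he⟩ := h.exists_fiber_equiv h' (a := φ i) (b := φ j) (a' := φ' i) (b' := φ' j)
        (by rw [hφ.eq_iff, hφ'.eq_iff]) (hc i j)
      have conv {V : Type} [Fintype V] [DecidableEq V] {G : SimpleGraph V} {φ : ι → V}
          (hφ : Function.Injective φ) (x : V) :
          (Finset.univ.filter fun i => G.Adj x (φ i)) = {i, j} ↔
            nbrs G x ∩ Finset.univ.image φ = {φ i, φ j} := by
        rw [htr hφ, Finset.image_insert, Finset.image_singleton]
      let E {V : Type} [Fintype V] [DecidableEq V] {G : SimpleGraph V} {φ : ι → V}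
          (hφ : Function.Injective φ) :
          {x : {x // x ∉ Finset.univ.image φ} //
            (Finset.univ.filter fun i => G.Adj x (φ i)) = {i, j}} ≃
          {x // x ∉ Finset.univ.image φ ∧ nbrs G x ∩ Finset.univ.image φ = {φ i, φ j}} :=
        ⟨fun x => ⟨x.1.1, x.1.2, (conv hφ _).1 x.2⟩, fun x => ⟨⟨x.1, x.2.1⟩, (conv hφ _).2 x.2.2⟩,
          fun _ => rfl, fun _ => rfl⟩
      exact ⟨(E hφ).trans (e.trans (E hφ').symm), fun x y => he _ _⟩
    · have empty {V : Type} [Fintype V] [DecidableEq V] {G : SimpleGraph V} {φ : ι → V}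
          (hφ : Function.Injective φ) (h : IsCore G (Finset.univ.image φ)) :
          IsEmpty {x : {x // x ∉ Finset.univ.image φ} //
            (Finset.univ.filter fun i => G.Adj x (φ i)) = t} := by
        refine ⟨fun x => ht ?_⟩
        obtain ⟨p, hp, q, hq, e⟩ := h.exists_trace x.1.2
        simp only [Finset.mem_image, Finset.mem_univ, true_and] at hp hq
        obtain ⟨i, rfl⟩ := hp
        obtain ⟨j, rfl⟩ := hq
        refine ⟨i, j, Finset.image_injective hφ ?_⟩
        rw [← (htr hφ _ _).1 x.2, e, Finset.image_insert, Finset.image_singleton]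
      have := empty hφ h
      have := empty hφ' h'
      exact ⟨Equiv.equivOfIsEmpty _ _, fun x => isEmptyElim x⟩
  choose e he using hfib
  let E : {x // x ∉ C} ≃ {x // x ∉ C'} :=
    (Equiv.sigmaFiberEquiv fun x : {x // x ∉ C} => Finset.univ.filter fun i => G.Adj x (φ i)).symm.trans
      ((Equiv.sigmaCongrRight e).trans
        (Equiv.sigmaFiberEquiv fun x : {x // x ∉ C'} => Finset.univ.filter fun i => G'.Adj x (φ' i)))
  have hE (x : {x // x ∉ C}) (t) (ht : (Finset.univ.filter fun i => G.Adj x (φ i)) = t) :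
      E x = (e t ⟨x, ht⟩).1 := by
    subst ht
    rfl
  have hEt (x : {x // x ∉ C}) : (Finset.univ.filter fun i => G'.Adj (E x) (φ' i)) =
      Finset.univ.filter fun i => G.Adj x (φ i) := by
    rw [hE x _ rfl]
    exact (e _ ⟨x, rfl⟩).2
  have hcross (x : {x // x ∉ C}) (i : ι) : G'.Adj (E x) (φ' i) ↔ G.Adj x (φ i) := by
    simpa using congrArg (i ∈ ·) (hEt x)
  have tr {V : Type} [Fintype V] [DecidableEq V] {G : SimpleGraph V} {φ : ι → V}
      (hφ : Function.Injective φ) (h : IsCore G (Finset.univ.image φ))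
      (x y : {x // x ∉ Finset.univ.image φ}) (hxy : G.Adj (x : V) y) :
      (Finset.univ.filter fun i => G.Adj x (φ i)) = Finset.univ.filter fun i => G.Adj y (φ i) := by
    obtain ⟨a, ha, -, h1, h2⟩ := h.adj_outside x.2 y.2 hxy
    rw [htr hφ, h1, ← h2]
    exact (htr hφ _ _).1 rfl
  have hout (x y : {x // x ∉ C}) : G'.Adj (E x) (E y) ↔ G.Adj (x : V) y := by
    by_cases hxy : (Finset.univ.filter fun i => G.Adj x (φ i)) =
        Finset.univ.filter fun i => G.Adj y (φ i)
    · rw [hE x _ hxy, hE y _ rfl, he]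
    · refine iff_of_false (fun h1 => hxy ?_) (fun h1 => hxy (tr hφ h x y h1))
      rw [← hEt x, ← hEt y]
      exact tr hφ' h' _ _ h1
  have hmem (x : V) : x ∈ C ↔ ∃ i, φ i = x := by simp [hC]
  have hmem' (x : V') : x ∈ C' ↔ ∃ i, φ' i = x := by simp [hC']
  let P : ι ⊕ {x // x ∉ C} ≃ V := Equiv.ofBijective (Sum.elim φ Subtype.val) (by
    refine ⟨hφ.sumElim Subtype.val_injective fun i x hx => x.2 ((hmem _).2 ⟨i, hx⟩), fun x => ?_⟩
    by_cases hx : x ∈ C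
    · obtain ⟨i, rfl⟩ := (hmem x).1 hx
      exact ⟨Sum.inl i, rfl⟩
    · exact ⟨Sum.inr ⟨x, hx⟩, rfl⟩)
  let P' : ι ⊕ {x // x ∉ C'} ≃ V' := Equiv.ofBijective (Sum.elim φ' Subtype.val) (by
    refine ⟨hφ'.sumElim Subtype.val_injective fun i x hx => x.2 ((hmem' _).2 ⟨i, hx⟩), fun x => ?_⟩
    by_cases hx : x ∈ C'
    · obtain ⟨i, rfl⟩ := (hmem' x).1 hx
      exact ⟨Sum.inl i, rfl⟩
    · exact ⟨Sum.inr ⟨x, hx⟩, rfl⟩)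
  refine ⟨⟨P.symm.trans ((Equiv.sumCongr (Equiv.refl ι) E).trans P'), fun {a b} => ?_⟩⟩
  obtain ⟨s, rfl⟩ := P.surjective a
  obtain ⟨t, rfl⟩ := P.surjective b
  simp only [Equiv.trans_apply, Equiv.symm_apply_apply]
  rcases s with i | x <;> rcases t with j | y
  · exact (hadj i j).symm
  · exact ((G'.adj_comm _ _).trans (hcross y i)).trans (G.adj_comm _ _)
  · exact hcross x j
  · exact hout x y

end IsCore

end CoreIso

section Packing

/-- The number whose base-256 digits are `f 0, …, f (n - 1)`. -/
def pack (f : ℕ → ℕ) : ℕ → ℕ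
  | 0 => 0
  | n + 1 => Nat.add (pack f n) (Nat.mul (f n) (Nat.pow 256 n))

/-- The byte of `T` that starts at bit `s`. -/
def byte (T s : ℕ) : ℕ := Nat.land (Nat.shiftRight T s) 255

lemma pack_succ (f : ℕ → ℕ) (n : ℕ) : pack f (n + 1) = 2 ^ (8 * n) * f n + pack f n := by
  change pack f n + f n * 256 ^ n = _
  rw [pow_mul, mul_comm (f n), add_comm]
  norm_num

lemma pack_congr {f g : ℕ → ℕ} {n : ℕ} (h : ∀ i < n, f i = g i) : pack f n = pack g n := by
  induction n with
  | zero => rfl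
  | succ n ih => rw [pack_succ, pack_succ, h n (by omega), ih fun i hi => h i (by omega)]

lemma pack_lt {f : ℕ → ℕ} {n : ℕ} (h : ∀ i < n, f i < 256) : pack f n < 2 ^ (8 * n) := by
  induction n with
  | zero => simp [pack]
  | succ n ih =>
    have h1 := ih fun i hi => h i (by omega)
    have h2 := h n (by omega)
    have h3 : 2 ^ (8 * n) * f n ≤ 2 ^ (8 * n) * 255 := Nat.mul_le_mul_left _ (by omega)
    rw [pack_succ, show 8 * (n + 1) = 8 * n + 8 by ring, pow_add]
    omega

lemma testBit_pack {f : ℕ → ℕ} {n : ℕ} (h : ∀ i < n, f i < 256) (i : ℕ) {j : ℕ} (hj : j < 8) :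
    (pack f n).testBit (8 * i + j) = (decide (i < n) && (f i).testBit j) := by
  induction n with
  | zero => simp [pack]
  | succ n ih =>
    have h1 : ∀ i < n, f i < 256 := fun i hi => h i (by omega)
    rw [pack_succ, Nat.testBit_two_pow_mul_add _ (pack_lt h1), ih h1]
    rcases lt_trichotomy i n with hi | rfl | hi
    · simp [show 8 * i + j < 8 * n by omega, hi, show i < n + 1 by omega]
    · simp
    · have : (f n).testBit (8 * i + j - 8 * n) = false :=
        Nat.testBit_lt_two_pow ((h n (by omega)).trans_le
          (show 2 ^ 8 ≤ 2 ^ (8 * i + j - 8 * n) from Nat.pow_le_pow_right (by norm_num) (by omega)))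
      simp [show ¬ 8 * i + j < 8 * n by omega, this, show ¬ i < n + 1 by omega]

lemma land_pack {f g : ℕ → ℕ} {n : ℕ} (hf : ∀ i < n, f i < 256) (hg : ∀ i < n, g i < 256) :
    Nat.land (pack f n) (pack g n) = pack (fun i => Nat.land (f i) (g i)) n := by
  change pack f n &&& pack g n = pack (fun i => f i &&& g i) n
  have hfg : ∀ i < n, f i &&& g i < 256 := fun i hi => Nat.and_lt_two_pow (n := 8) _ (hg i hi)
  refine Nat.eq_of_testBit_eq fun s => ?_
  rw [← Nat.div_add_mod s 8, Nat.testBit_and]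
  have hs : s % 8 < 8 := Nat.mod_lt _ (by norm_num)
  rw [testBit_pack hf _ hs, testBit_pack hg _ hs, testBit_pack hfg _ hs, Nat.testBit_and]
  cases decide (s / 8 < n) <;> simp

lemma byte_pack {f : ℕ → ℕ} {n : ℕ} (h : ∀ i < n, f i < 256) {i : ℕ} (hi : i < n) :
    byte (pack f n) (8 * i) = f i := by
  change (pack f n >>> (8 * i)) &&& (2 ^ 8 - 1) = f i
  refine Nat.eq_of_testBit_eq fun s => ?_
  rw [Nat.testBit_and, Nat.testBit_two_pow_sub_one, Nat.testBit_shiftRight]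
  by_cases hs : s < 8
  · simp [testBit_pack h i hs, hs, hi]
  · rw [Nat.testBit_lt_two_pow ((h i hi).trans_le
      (show 2 ^ 8 ≤ 2 ^ s from Nat.pow_le_pow_right (by norm_num) (by omega)))]
    simp [hs]

lemma pack_injective {f g : ℕ → ℕ} {n : ℕ} (hf : ∀ i < n, f i < 256) (hg : ∀ i < n, g i < 256)
    (h : pack f n = pack g n) : ∀ i < n, f i = g i := fun i hi => by
  rw [← byte_pack hf hi, ← byte_pack hg hi, h]

lemma shiftRight_pack {f : ℕ → ℕ} {n m : ℕ} (h : ∀ i < n + m, f i < 256) :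
    Nat.shiftRight (pack f (n + m)) (8 * n) = pack (fun i => f (n + i)) m := by
  have h2 : ∀ i < m, f (n + i) < 256 := fun i hi => h _ (by omega)
  refine Nat.eq_of_testBit_eq fun s => ?_
  have hs : s % 8 < 8 := Nat.mod_lt _ (by norm_num)
  rw [← Nat.div_add_mod s 8, testBit_pack h2 _ hs]
  refine (Nat.testBit_shiftRight _).trans ?_
  rw [← add_assoc, ← mul_add, testBit_pack h _ hs]
  simp

lemma pack_add (f g : ℕ → ℕ) (n : ℕ) :
    Nat.add (pack f n) (pack g n) = pack (fun i => f i + g i) n := by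
  change pack f n + pack g n = _
  induction n with
  | zero => rfl
  | succ n ih =>
    rw [pack_succ, pack_succ, pack_succ, ← ih]
    ring

lemma pack_sub {f g : ℕ → ℕ} {n : ℕ} (h : ∀ i < n, g i ≤ f i) :
    Nat.sub (pack f n) (pack g n) = pack (fun i => f i - g i) n := by
  have h1 := pack_add (fun i => f i - g i) g n
  rw [pack_congr (g := f) fun i hi => Nat.sub_add_cancel (h i hi)] at h1
  rw [← h1]
  exact Nat.add_sub_cancel _ (pack g n)

lemma pack_mul (c : ℕ) (f : ℕ → ℕ) (n : ℕ) :
    Nat.mul c (pack f n) = pack (fun i => c * f i) n := by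
  change c * pack f n = _
  induction n with
  | zero => rfl
  | succ n ih =>
    rw [pack_succ, pack_succ, ← ih]
    ring

lemma pack_eq_zero {f : ℕ → ℕ} {n : ℕ} : pack f n = 0 ↔ ∀ i < n, f i = 0 := by
  induction n with
  | zero => simp [pack]
  | succ n ih =>
    rw [pack_succ, Nat.add_eq_zero_iff, ih, Nat.forall_lt_succ_right]
    simp
    tauto

/-- The bytes selected by `b` have a vanishing top bit. -/
lemma land_pack_top {f : ℕ → ℕ} {b : ℕ → Bool} {n : ℕ} (hf : ∀ i < n, f i < 256) :
    Nat.land (pack f n) (pack (fun i => 128 * (b i).toNat) n) = 0 ↔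
      ∀ i < n, b i = true → f i < 128 := by
  rw [land_pack hf (fun i _ => by cases b i <;> simp), pack_eq_zero]
  refine forall₂_congr fun i hi => ?_
  have h1 : ∀ a < 256, (Nat.land a 128 = 0 ↔ a < 128) := by decide +kernel
  cases b i
  · simp
  · simpa using h1 _ (hf i hi)

end Packing

section Patterns

/-- Whether the core vertices `p` and `q` both belong to the set coded by `S`. -/
def both (S p q : ℕ) : Bool := S.testBit p && S.testBit q

/-- Size of the subset of `{0, …, 5}` coded by `S`. -/
def size (S : ℕ) : ℕ :=
  (S.testBit 0).toNat + (S.testBit 1).toNat + (S.testBit 2).toNat + (S.testBit 3).toNat +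
    (S.testBit 4).toNat + (S.testBit 5).toNat

/-- Sum over the pairs `p ≤ q < 6`. -/
def pairSum (f : ℕ → ℕ → ℕ) : ℕ := ∑ q ∈ Finset.range 6, ∑ p ∈ Finset.range (q + 1), f p q

/-- The weight inside the set coded by `S`. -/
def load (W : ℕ → ℕ → ℕ) (S : ℕ) : ℕ := pairSum fun p q => (both S p q).toNat * W p q

/-- Contribution of one unit of weight on the pair `p ≤ q` to lane `i`. The first four lanes make
the low bits of different vectors differ. The 64 lanes from 4 hold the weights of vertex sets; they
are followed by the six degrees, the number of neighbours of `0` and of `1` after the first two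
vertices, the sort keys of the last four vertices, and the single weights. -/
def coef (i p q : ℕ) : ℕ :=
  if i < 4 then if (q * (q + 1) / 2 + p) % 4 = i then 2 ^ ((q * (q + 1) / 2 + p) / 4) else 0
  else if i < 68 then (both (i - 4) p q).toNat
  else if i < 74 then (i == 68 + p).toNat + (i == 68 + q).toNat
  else if i < 76 then (i == 74 + p && 2 ≤ q).toNat
  else if i < 80 then
    if i = 74 + q then if p = 0 then 16 else if p = 1 then 8 else (p != q).toNat
    else (i == 74 + p && p != q).toNat
  else (i == 80 + 6 * q + p).toNat

/-- Content of lane `i` at weight zero. -/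
def base (i : ℕ) : ℕ :=
  if i < 4 then 0 else if i < 68 then 126 - size (i - 4) else if i < 74 then 118 else 0

/-- Content of lane `i` at weight `W`. -/
def lane (W : ℕ → ℕ → ℕ) (i : ℕ) : ℕ := base i + pairSum fun p q => coef i p q * W p q

/-- All lanes packed into one number. -/
def enc (W : ℕ → ℕ → ℕ) : ℕ := pack (lane W) 116

/-- The pattern `W` is not sparse off any of the first `k` vertices. -/
def DenseOff (k : ℕ) (W : ℕ → ℕ → ℕ) : Prop :=
  ∀ z < k, ∃ S < 64, S.testBit z = false ∧ size S < load W S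

/-- The weights of the cores of obstructions, where the base of the core comes first. -/
structure IsPattern (k : ℕ) (W : ℕ → ℕ → ℕ) : Prop where
  le_six : k ≤ 6
  eq_zero : ∀ p q, k ≤ q → W p q = 0
  load_le_add_one : ∀ S < 64, S.testBit 0 = false ∨ S.testBit 1 = false → load W S ≤ size S + 1
  load_le : ∀ S < 64, S.testBit 0 = false → S.testBit 1 = false → load W S ≤ size S
  dense : DenseOff k W
  delete : ∀ q < k, ∀ p ≤ q, W p q ≠ 0 → ∃ z < k, ∀ S < 64, S.testBit z = false →
    load W S ≤ size S + (both S p q).toNat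
  contract : ∀ q < k, ∀ p < q, W p q ≠ 0 → ∃ z < k, z ≠ q ∧ ∀ S < 64, S.testBit z = false →
    (S.testBit p = false → S.testBit q = false → load W S ≤ size S) ∧
    (both S p q = true → load W S + 1 ≤ size S + W p q + ((Finset.range k).filter fun r =>
      S.testBit r = true ∧ r ≠ p ∧ r ≠ q ∧ W (min p r) (max p r) ≠ 0 ∧
        W (min q r) (max q r) ≠ 0).card)
  two_le_degree : ∀ p < k, p < 2 → 120 ≤ lane W (68 + p)
  three_le_degree : ∀ p < k, 2 ≤ p → 121 ≤ lane W (68 + p)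
  degree_le : ∀ p < k, 2 ≤ p → lane W (68 + p) + k ≤ 127
  sorted : ∀ i, i = 74 ∨ i = 76 ∨ i = 77 ∨ i = 78 →
    lane (fun p q => min (W p q) 1) (i + 1) ≤ lane (fun p q => min (W p q) 1) i

lemma pairSum_le {f g : ℕ → ℕ → ℕ} (h : ∀ q < 6, ∀ p ≤ q, f p q ≤ g p q) :
    pairSum f ≤ pairSum g :=
  Finset.sum_le_sum fun q hq => Finset.sum_le_sum fun p hp =>
    h q (Finset.mem_range.1 hq) p (by have := Finset.mem_range.1 hp; omega)

lemma pairSum_add (f g : ℕ → ℕ → ℕ) :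
    pairSum (fun p q => f p q + g p q) = pairSum f + pairSum g := by
  simp only [pairSum, Finset.sum_add_distrib]

lemma mul_pairSum (c : ℕ) (f : ℕ → ℕ → ℕ) : pairSum (fun p q => c * f p q) = c * pairSum f := by
  simp only [pairSum, Finset.mul_sum]

/-- The pattern with a single unit of weight on the pair `p ≤ q`. -/
def single (p q : ℕ) (x y : ℕ) : ℕ := if x = p ∧ y = q then 1 else 0

lemma pairSum_single {p q : ℕ} (hpq : p ≤ q) (hq : q < 6) (f : ℕ → ℕ → ℕ) :
    pairSum (fun x y => f x y * single p q x y) = f p q := by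
  rw [pairSum, Finset.sum_eq_single q, Finset.sum_eq_single p]
  · simp [single]
  · intro x _ hx
    simp [single, hx]
  · intro h
    exact absurd (Finset.mem_range.2 (by omega)) h
  · intro y _ hy
    exact Finset.sum_eq_zero fun x _ => by simp [single, hy]
  · intro h
    exact absurd (Finset.mem_range.2 hq) h

lemma lane_le {W X : ℕ → ℕ → ℕ} (h : ∀ q < 6, ∀ p ≤ q, X p q ≤ W p q) (i : ℕ) :
    lane X i ≤ lane W i :=
  Nat.add_le_add_left (pairSum_le fun q hq p hp => Nat.mul_le_mul_left _ (h q hq p hp)) _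

lemma load_mono {W X : ℕ → ℕ → ℕ} (h : ∀ q < 6, ∀ p ≤ q, X p q ≤ W p q) (S : ℕ) :
    load X S ≤ load W S :=
  pairSum_le fun q hq p hp => Nat.mul_le_mul_left _ (h q hq p hp)

lemma lane_bound : ∀ i < 116, base i + 3 * pairSum (coef i) + 6 < 256 := by
  decide +kernel

lemma lane_lt {X : ℕ → ℕ → ℕ} (h : ∀ q < 6, ∀ p ≤ q, X p q ≤ 3) {i : ℕ} (hi : i < 116) :
    lane X i + 6 < 256 := by
  have h1 := lane_bound i hi
  have h2 := lane_le h i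
  have h3 : lane (fun _ _ => 3) i = base i + 3 * pairSum (coef i) := by
    rw [lane, ← mul_pairSum]
    simp only [mul_comm]
  omega

lemma base_set {S : ℕ} (hS : S < 64) : base (4 + S) = 126 - size S := by
  simp [base, show 4 + S < 68 by omega]

lemma size_le (S : ℕ) : size S ≤ 6 := by
  have h (b : Bool) : b.toNat ≤ 1 := Bool.toNat_le b
  have h0 := h (S.testBit 0)
  have h1 := h (S.testBit 1)
  have h2 := h (S.testBit 2)
  have h3 := h (S.testBit 3)
  have h4 := h (S.testBit 4)
  have h5 := h (S.testBit 5)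
  rw [size]
  omega

lemma lane_set (X : ℕ → ℕ → ℕ) {S : ℕ} (hS : S < 64) :
    lane X (4 + S) + size S = 126 + load X S := by
  have h := size_le S
  have h1 : (pairSum fun p q => coef (4 + S) p q * X p q) = load X S := by
    simp [coef, load, show 4 + S < 68 by omega]
  rw [lane, base_set hS, h1]
  omega

lemma coef_weight {p q x y : ℕ} (hp : p ≤ q) (hq : q < 6) (hx : x ≤ y) (hy : y < 6) :
    coef (80 + 6 * q + p) x y = single p q x y := by
  have : ∀ q < 6, ∀ p ≤ q, ∀ y < 6, ∀ x ≤ y, coef (80 + 6 * q + p) x y = single p q x y := by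
    decide +kernel
  exact this q hq p hp y hy x hx

lemma pairSum_congr {f g : ℕ → ℕ → ℕ} (h : ∀ q < 6, ∀ p ≤ q, f p q = g p q) :
    pairSum f = pairSum g :=
  (pairSum_le fun q hq p hp => (h q hq p hp).le).antisymm
    (pairSum_le fun q hq p hp => (h q hq p hp).ge)

lemma lane_weight (X : ℕ → ℕ → ℕ) {p q : ℕ} (hp : p ≤ q) (hq : q < 6) :
    lane X (80 + 6 * q + p) = X p q := by
  have h1 : base (80 + 6 * q + p) = 0 := by
    simp [base, show ¬ 80 + 6 * q + p < 4 by omega, show ¬ 80 + 6 * q + p < 68 by omega,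
      show ¬ 80 + 6 * q + p < 74 by omega]
  rw [lane, h1, zero_add, pairSum_congr fun y hy x hx => by
    rw [coef_weight hp hq hx hy, mul_comm]]
  exact pairSum_single hp hq X

namespace IsPattern

variable {k : ℕ} {W : ℕ → ℕ → ℕ}

lemma le_three (h : IsPattern k W) {p q : ℕ} (hpq : p ≤ q) (hq : q < 6) : W p q ≤ 3 := by
  by_contra! hlt
  have hqk : q < k := by
    by_contra! hk
    rw [h.eq_zero p q hk] at hlt
    omega
  obtain ⟨z, hz, hdel⟩ := h.delete q hqk p hpq (by omega)
  by_cases hzpq : z = p ∨ z = q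
  · obtain ⟨S, hS, hSz, hd⟩ := h.dense z hz
    have h1 := hdel S hS hSz
    have h2 : both S p q = false := by
      rw [both, Bool.and_eq_false_iff]
      rcases hzpq with rfl | rfl
      · exact Or.inl hSz
      · exact Or.inr hSz
    rw [h2] at h1
    simp at h1
    omega
  · obtain ⟨S, hS, hSz, hb, hs⟩ : ∃ S < 64, S.testBit z = false ∧ both S p q = true ∧
        size S ≤ 2 := by
      have c1 : ∀ q < 6, ∀ p < 6, ∀ z < 6,
          z = p ∨ z = q ∨ (2 ^ p ||| 2 ^ q).testBit z = false := by
        decide +kernel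
      have c2 : ∀ q < 6, ∀ p < 6, both (2 ^ p ||| 2 ^ q) p q = true ∧
          size (2 ^ p ||| 2 ^ q) ≤ 2 ∧ (2 ^ p ||| 2 ^ q) < 64 := by
        decide +kernel
      have h6 := h.le_six
      obtain ⟨h1, h2, h3⟩ := c2 q hq p (by omega)
      have h4 := c1 q hq p (by omega) z (by omega)
      exact ⟨_, h3, by tauto, h1, h2⟩
    have h1 := hdel S hS hSz
    have h2 : W p q ≤ load W S := by
      rw [← pairSum_single hpq hq W]
      refine pairSum_le fun y hy x hx => ?_
      rw [single]
      split_ifs with he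
      · obtain ⟨rfl, rfl⟩ := he
        simp [hb]
      · simp
    rw [hb] at h1
    simp at h1
    omega

/-- Patterns are minimal with respect to being dense. -/
lemma not_dense (h : IsPattern k W) {X : ℕ → ℕ → ℕ} (hX : ∀ q < 6, ∀ p ≤ q, X p q ≤ W p q)
    {p q : ℕ} (hpq : p ≤ q) (hq : q < 6) (hlt : X p q < W p q) : ¬ DenseOff k X := by
  intro hd
  have hqk : q < k := by
    by_contra! hk
    rw [h.eq_zero p q hk] at hlt
    omega
  obtain ⟨z, hz, hdel⟩ := h.delete q hqk p hpq (by omega)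
  obtain ⟨S, hS, hSz, hS2⟩ := hd z hz
  have h1 := hdel S hS hSz
  have h2 : load X S + (both S p q).toNat ≤ load W S := by
    rw [← pairSum_single hpq hq (fun p q => (both S p q).toNat), load, ← pairSum_add]
    refine pairSum_le fun y hy x hx => ?_
    rw [← mul_add]
    refine Nat.mul_le_mul_left _ ?_
    have := hX y hy x hx
    rw [single]
    split_ifs with he
    · obtain ⟨rfl, rfl⟩ := he
      omega
    · omega
  omega

end IsPattern

end Patterns

section Search

/-- Call `f` on `n`, after evaluating `n`. -/
def force (n : ℕ) (f : ℕ → Bool) : Bool :=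
  @Nat.rec (fun _ => Bool) (f 0) (fun m _ => f (Nat.succ m)) n

lemma force_eq (n : ℕ) (f : ℕ → Bool) : force n f = f n := by
  cases n <;> rfl

/-- Call `f` on `l`, after evaluating all entries of `l`. -/
def forceList (l : List ℕ) : (List ℕ → Bool) → Bool :=
  List.rec (fun f => f []) (fun a _ ih f => force a fun a => ih fun l => f (a :: l)) l

lemma forceList_eq (l : List ℕ) (f : List ℕ → Bool) : forceList l f = f l := by
  induction l generalizing f with
  | nil => rfl
  | cons a l ih =>
    change force a (fun a => forceList l fun l => f (a :: l)) = _
    rw [force_eq, ih]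

/-- One unit of weight on the pair `p ≤ q`. -/
def unit (p q : ℕ) : ℕ := pack (fun i => coef i p q) 116

/-- Whether lane `i` belongs to a vertex set with property `f`. -/
def laneOf (f : ℕ → Bool) (i : ℕ) : Bool := Nat.ble 4 i && Nat.blt i 68 && f (i - 4)

/-- The number with the bottom bit set in the lanes of the vertex sets `S` with `f S`. -/
def ones (f : ℕ → Bool) : ℕ := pack (fun i => (laneOf f i).toNat) 116

/-- The number with the top bit set in the lanes of the vertex sets `S` with `f S`. -/
def mask (f : ℕ → Bool) : ℕ := pack (fun i => 128 * (laneOf f i).toNat) 116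

/-- Whether the masks in `l` all meet `T`. -/
noncomputable def meetsAll (l : List ℕ) (T : ℕ) : Bool :=
  @List.rec ℕ (fun _ => Bool) true
    (fun m _ ih => @Bool.rec (fun _ => Bool) ih false (Nat.beq (Nat.land T m) 0)) l

/-- For every `z < k`, the mask of the sets avoiding `z`. -/
def avoids (k : ℕ) : List ℕ := (List.range k).map fun z => mask fun S => !S.testBit z

/-- Headroom that makes the bounds on loads and degrees visible in the top bits. -/
def slack (k : ℕ) : ℕ :=
  pack (fun i => if i < 68 then
    (laneOf (fun S => !S.testBit 0 && !S.testBit 1) i).toNat else if i < 74 then k else 0) 116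

/-- The top bits that witness violated bounds. -/
def bound : ℕ :=
  pack (fun i => 128 * (if i < 68 then
    laneOf (fun S => !S.testBit 0 || !S.testBit 1) i else Nat.ble 70 i && Nat.blt i 74).toNat) 116

/-- Instructions for the enumeration of weights: an edge adds at most one unit, a loop at most
three, and an ear at most two if there already is an edge. The remaining ones compare lanes with
one another or with constants. -/
inductive Step
  | edge (M : ℕ)
  | loop (M : ℕ)
  | ear (s M : ℕ)
  | le (s t : ℕ)
  | low (m s : ℕ)

/-- Add `M` up to `j` times to the current state, checking every new state by `next`. -/
noncomputable def climb (next : ℕ → (ℕ → Bool) → Bool) (M : ℕ) (f : ℕ → Bool) (j : ℕ) :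
    ℕ → Bool :=
  @Nat.rec (fun _ => ℕ → Bool) f
    (fun _ ih T => @Bool.rec (fun _ => Bool) false (next (Nat.add T M) ih) (f T)) j

/-- Continue with `f` unless the state `T` is out of bounds or dense. -/
noncomputable def visit (one slack bound : ℕ) (av : List ℕ) (leaf : ℕ → Bool) (T : ℕ)
    (f : ℕ → Bool) : Bool :=
  force T fun T => @Bool.rec (fun _ => Bool) true
    (@Bool.rec (fun _ => Bool) (f T) (leaf T) (meetsAll av (Nat.add T one)))
    (Nat.beq (Nat.land (Nat.add T slack) bound) 0)

/-- Check the leaves of the enumeration along `l`. -/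
noncomputable def search (next : ℕ → (ℕ → Bool) → Bool) (l : List Step) : ℕ → Bool :=
  @List.rec Step (fun _ => ℕ → Bool) (fun _ => true) (fun s _ ih T =>
    @Step.rec (fun _ => Bool)
      (fun M => climb next M ih 1 T)
      (fun M => climb next M ih 3 T)
      (fun s M => @Bool.rec (fun _ => Bool) (climb next M ih 2 T) (ih T) (Nat.beq (byte T s) 0))
      (fun s t => @Bool.rec (fun _ => Bool) true (ih T) (Nat.ble (byte T s) (byte T t)))
      (fun m s => @Bool.rec (fun _ => Bool) true (ih T) (Nat.ble m (byte T s)))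
      s) l

/-- Symbolic form of the instructions. -/
inductive Site
  | edge (p q : ℕ)
  | loop (p : ℕ)
  | ear (p q : ℕ)
  | le (i j : ℕ)
  | low (m p : ℕ)

/-- The instruction described by a symbol. -/
def Site.step : Site → Step
  | .edge p q => .edge (unit p q)
  | .loop p => .loop (unit p p)
  | .ear p q => .ear (8 * (80 + 6 * q + p)) (unit p q)
  | .le i j => .le (8 * i) (8 * j)
  | .low m p => .low m (8 * (68 + p))

/-- Whether the instruction concerns the first `k` vertices. -/
def Site.valid (k : ℕ) : Site → Bool
  | .edge _ q => Nat.blt q k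
  | .loop p => Nat.blt p k
  | .ear _ q => Nat.blt q k
  | .le _ _ => true
  | .low _ p => Nat.blt p k

/-- The enumeration for six vertices. -/
def sites : List Site :=
  [.edge 0 1, .edge 0 2, .edge 1 2, .edge 0 3, .edge 1 3, .le 77 76, .edge 0 4, .edge 1 4,
    .le 78 77, .edge 0 5, .edge 1 5, .le 79 78, .edge 2 3, .edge 2 4, .edge 2 5, .edge 3 4,
    .edge 3 5, .edge 4 5, .le 75 74, .le 77 76, .le 78 77, .le 79 78,
    .loop 2, .ear 0 2, .ear 1 2, .ear 2 3, .ear 2 4, .ear 2 5, .low 121 2,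
    .loop 3, .ear 0 3, .ear 1 3, .ear 3 4, .ear 3 5, .low 121 3,
    .loop 4, .ear 0 4, .ear 1 4, .ear 4 5, .low 121 4,
    .loop 5, .ear 0 5, .ear 1 5, .low 121 5, .ear 0 1, .loop 0, .low 120 0, .loop 1, .low 120 1]

/-- The instructions for `k` vertices. -/
def steps (k : ℕ) : List Step := (sites.filter (Site.valid k)).map Site.step

/-- Call `f` on `l`, after evaluating all instructions of `l`. -/
noncomputable def forceSteps (l : List Step) : (List Step → Bool) → Bool :=
  List.rec (fun f => f []) (fun a _ ih f =>
    @Step.rec (fun _ => Bool)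
      (fun M => force M fun M => ih fun l => f (.edge M :: l))
      (fun M => force M fun M => ih fun l => f (.loop M :: l))
      (fun s M => force s fun s => force M fun M => ih fun l => f (.ear s M :: l))
      (fun s t => force s fun s => force t fun t => ih fun l => f (.le s t :: l))
      (fun m s => force m fun m => force s fun s => ih fun l => f (.low m s :: l)) a) l

/-- The enumeration of all weights on `k` vertices. -/
noncomputable def run (k : ℕ) (leaf : ℕ → Bool) : Bool :=
  forceSteps (steps k) fun l => forceList (avoids k) fun av =>
  force (ones fun _ => true) fun one => force (slack k) fun sl => force bound fun bd =>
  force (pack base 116) fun T => search (visit one sl bd av leaf) l T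

end Search

section Soundness

lemma meetsAll_iff {l : List ℕ} {T : ℕ} : meetsAll l T = true ↔ ∀ m ∈ l, Nat.land T m ≠ 0 := by
  induction l with
  | nil => simp [meetsAll]
  | cons m l ih =>
    change @Bool.rec (fun _ => Bool) (meetsAll l T) false (Nat.beq (Nat.land T m) 0) = true ↔ _
    rw [List.forall_mem_cons, ← ih]
    cases h : Nat.beq (Nat.land T m) 0
    · have h1 := Nat.ne_of_beq_eq_false h
      exact (and_iff_right h1).symm
    · have h1 := Nat.eq_of_beq_eq_true h
      exact iff_of_false Bool.false_ne_true fun h2 => h2.1 h1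

lemma visit_eq (one slack bound : ℕ) (av : List ℕ) (leaf : ℕ → Bool) {T : ℕ} (f : ℕ → Bool)
    (h : Nat.land (Nat.add T slack) bound = 0) : visit one slack bound av leaf T f =
      if meetsAll av (Nat.add T one) = true then leaf T else f T := by
  rw [visit, force_eq, h]
  change @Bool.rec (fun _ => Bool) (f T) (leaf T) (meetsAll av (Nat.add T one)) = _
  cases meetsAll av (Nat.add T one) <;> rfl

lemma climb_succ (next : ℕ → (ℕ → Bool) → Bool) (M : ℕ) (f : ℕ → Bool) (j T : ℕ) :
    climb next M f (j + 1) T = (f T && next (Nat.add T M) (climb next M f j)) := by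
  change @Bool.rec (fun _ => Bool) false (next (Nat.add T M) (climb next M f j)) (f T) = _
  cases f T <;> rfl

lemma laneOf_iff {f : ℕ → Bool} {i : ℕ} : laneOf f i = true ↔ ∃ S < 64, i = 4 + S ∧ f S = true := by
  simp only [laneOf, Bool.and_eq_true, Nat.ble_eq, Nat.blt_eq]
  constructor
  · rintro ⟨⟨h1, h2⟩, h3⟩
    exact ⟨i - 4, by omega, by omega, h3⟩
  · rintro ⟨S, h1, rfl, h3⟩
    exact ⟨⟨by omega, by omega⟩, by simpa using h3⟩

lemma laneOf_set (f : ℕ → Bool) {S : ℕ} (hS : S < 64) : laneOf f (4 + S) = f S := by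
  rw [Bool.eq_iff_iff, laneOf_iff]
  constructor
  · rintro ⟨S', -, h2, h3⟩
    rwa [Nat.add_left_cancel h2]
  · exact fun h => ⟨S, hS, rfl, h⟩

lemma land_mask_ne_zero {g : ℕ → ℕ} (hg : ∀ i < 116, g i < 256) {f : ℕ → Bool} :
    Nat.land (pack g 116) (mask f) ≠ 0 ↔ ∃ S < 64, f S = true ∧ 128 ≤ g (4 + S) := by
  rw [mask, ne_eq, land_pack_top hg]
  push Not
  constructor
  · rintro ⟨i, -, h1, h2⟩
    obtain ⟨S, hS, rfl, h3⟩ := laneOf_iff.1 h1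
    exact ⟨S, hS, h3, h2⟩
  · rintro ⟨S, hS, h1, h2⟩
    exact ⟨4 + S, by omega, by rwa [laneOf_set f hS], h2⟩

/-- The pattern `X` with the weight of one pair replaced. -/
def upd (X : ℕ → ℕ → ℕ) (p q v : ℕ) (x y : ℕ) : ℕ := if x = p ∧ y = q then v else X x y

lemma lane_upd_succ (X : ℕ → ℕ → ℕ) {p q : ℕ} (hpq : p ≤ q) (hq : q < 6) (v i : ℕ) :
    lane (upd X p q (v + 1)) i = lane (upd X p q v) i + coef i p q := by
  rw [lane, lane, ← pairSum_single hpq hq (coef i), add_assoc, ← pairSum_add]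
  congr 1
  refine pairSum_congr fun y _ x _ => ?_
  rw [← mul_add, upd, upd, single]
  split_ifs <;> rfl

lemma enc_add_unit (X : ℕ → ℕ → ℕ) {p q : ℕ} (hpq : p ≤ q) (hq : q < 6) (v : ℕ) :
    Nat.add (enc (upd X p q v)) (unit p q) = enc (upd X p q (v + 1)) := by
  rw [enc, unit, pack_add, enc]
  exact pack_congr fun i _ => (lane_upd_succ X hpq hq v i).symm

lemma enc_congr {X Y : ℕ → ℕ → ℕ} (h : ∀ q < 6, ∀ p ≤ q, X p q = Y p q) : enc X = enc Y :=
  pack_congr fun i _ => by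
    rw [lane, lane, pairSum_congr fun q hq p hp => by rw [h q hq p hp]]

lemma byte_enc {X : ℕ → ℕ → ℕ} (hX : ∀ q < 6, ∀ p ≤ q, X p q ≤ 3) {i : ℕ} (hi : i < 116) :
    byte (enc X) (8 * i) = lane X i :=
  byte_pack (fun i hi => by have := lane_lt hX hi; omega) hi

/-- The visible lanes of dense patterns. -/
lemma meetsAll_avoids {X : ℕ → ℕ → ℕ} (hX : ∀ q < 6, ∀ p ≤ q, X p q ≤ 3) {k : ℕ} :
    meetsAll (avoids k) (Nat.add (enc X) (ones fun _ => true)) = true ↔ DenseOff k X := by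
  rw [meetsAll_iff, enc, ones, pack_add]
  simp only [avoids, List.forall_mem_map, List.mem_range, DenseOff]
  refine forall₂_congr fun z hz => ?_
  rw [land_mask_ne_zero]
  · refine exists_congr fun S => and_congr_right fun hS => ?_
    rw [laneOf_set _ hS]
    have := lane_set X hS
    simp
    omega
  · intro i hi
    have := lane_lt hX hi
    have := Bool.toNat_le (laneOf (fun _ => true) i)
    omega

namespace IsPattern

variable {k : ℕ} {W : ℕ → ℕ → ℕ}

lemma land_bound (h : IsPattern k W) {X : ℕ → ℕ → ℕ} (hX : ∀ q < 6, ∀ p ≤ q, X p q ≤ W p q) :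
    Nat.land (Nat.add (enc X) (slack k)) bound = 0 := by
  have h3 : ∀ q < 6, ∀ p ≤ q, X p q ≤ 3 := fun q hq p hp => (hX q hq p hp).trans (h.le_three hp hq)
  have h6 := h.le_six
  rw [enc, slack, pack_add, bound, land_pack_top]
  · intro i hi hb
    have hmono := lane_le hX i
    split_ifs at hb with hi2
    · obtain ⟨S, hS, rfl, hf⟩ := laneOf_iff.1 hb
      rw [if_pos hi2, laneOf_set _ hS]
      have e1 := lane_set X hS
      have e2 := load_mono hX S
      have e3 := h.load_le_add_one S hS (by simpa using hf)
      cases h0 : S.testBit 0 <;> cases h1 : S.testBit 1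
      · have e4 := h.load_le S hS h0 h1
        simp
        omega
      all_goals
        simp
        omega
    · rw [if_neg hi2]
      simp only [Bool.and_eq_true, Nat.ble_eq, Nat.blt_eq] at hb
      rw [if_pos hb.2]
      obtain ⟨p, rfl⟩ := Nat.exists_eq_add_of_le (show 68 ≤ i by omega)
      by_cases hp : p < k
      · have := h.degree_le p hp (by omega)
        omega
      · have e : lane W (68 + p) = 118 := by
          have : (pairSum fun x y => coef (68 + p) x y * W x y) = pairSum fun _ _ => 0 := by
            refine pairSum_congr fun y hy x hx => ?_
            by_cases hyk : k ≤ y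
            · rw [h.eq_zero x y hyk, mul_zero]
            · have c : coef (68 + p) x y = 0 := by
                have e1 : ¬ p = x := by omega
                have e2 : ¬ p = y := by omega
                simp [coef, hb.2, show ¬ 68 + p < 4 by omega, e1, e2]
              rw [c, zero_mul]
          rw [lane, this]
          simp [pairSum, base, hb.2, show ¬ 68 + p < 4 by omega]
        omega
  · intro i hi
    have := lane_lt h3 hi
    have := Bool.toNat_le (laneOf (fun S => !S.testBit 0 && !S.testBit 1) i)
    split_ifs <;> omega

/-- The search continues at patterns below `W`, or a leaf accepts `W`. -/
lemma of_visit (h : IsPattern k W) {P : Prop} {leaf f : ℕ → Bool}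
    (hleaf : leaf (enc W) = true → P) {X : ℕ → ℕ → ℕ} (hX : ∀ q < 6, ∀ p ≤ q, X p q ≤ W p q)
    (hv : visit (ones fun _ => true) (slack k) bound (avoids k) leaf (enc X) f = true) :
    P ∨ ¬ DenseOff k X ∧ f (enc X) = true := by
  have h3 : ∀ q < 6, ∀ p ≤ q, X p q ≤ 3 := fun q hq p hp => (hX q hq p hp).trans (h.le_three hp hq)
  rw [visit_eq _ _ _ _ _ _ (h.land_bound hX)] at hv
  split_ifs at hv with hm <;> rw [meetsAll_avoids h3] at hm
  · refine Or.inl (hleaf ?_)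
    rwa [← enc_congr fun q hq p hp => ?_]
    by_contra hne
    exact h.not_dense hX hp hq (lt_of_le_of_ne (hX q hq p hp) hne) hm
  · exact Or.inr ⟨hm, hv⟩

lemma of_climb {P : Prop} {next : ℕ → (ℕ → Bool) → Bool} {f : ℕ → Bool}
    (hnext : ∀ X f, (∀ q < 6, ∀ p ≤ q, X p q ≤ W p q) → next (enc X) f = true →
      P ∨ ¬ DenseOff k X ∧ f (enc X) = true) {X : ℕ → ℕ → ℕ} (hX : ∀ q < 6, ∀ p ≤ q, X p q ≤ W p q)
    {p q : ℕ} (hpq : p ≤ q) (hq : q < 6) {w : ℕ} (hw : w ≤ W p q) (j v : ℕ) (hvw : v ≤ w)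
    (hj : w ≤ v + j) (hd : ¬ DenseOff k (upd X p q v))
    (hc : climb next (unit p q) f j (enc (upd X p q v)) = true) : P ∨ ¬ DenseOff k (upd X p q w) ∧ f (enc (upd X p q w)) = true := by
  induction j generalizing v with
  | zero =>
    obtain rfl : w = v := by omega
    exact Or.inr ⟨hd, hc⟩
  | succ j ih =>
    rw [climb_succ, Bool.and_eq_true] at hc
    obtain ⟨hf, hc⟩ := hc
    rcases hvw.eq_or_lt with rfl | hlt
    · exact Or.inr ⟨hd, hf⟩
    · rw [enc_add_unit X hpq hq] at hc
      have hu : ∀ y < 6, ∀ x ≤ y, upd X p q (v + 1) x y ≤ W x y := fun y hy x hx => by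
        rw [upd]
        split_ifs with he
        · obtain ⟨rfl, rfl⟩ := he
          exact hlt.trans_le hw
        · exact hX y hy x hx
      rcases hnext _ _ hu hc with hP | ⟨hd2, hc2⟩
      · exact Or.inl hP
      · exact ih (v + 1) hlt (by omega) hd2 hc2

end IsPattern

end Soundness

section Runs

/-- The units that an instruction may add to the pair `x ≤ y`. -/
def Site.room : Site → ℕ → ℕ → ℕ
  | .edge p q, x, y => single p q x y
  | .loop p, x, y => 3 * single p p x y
  | .ear p q, x, y => 2 * single p q x y
  | _, _, _ => 0

/-- The units that the instructions in `l` may add to the pair `x ≤ y`. -/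
def pend (l : List Site) (x y : ℕ) : ℕ := (l.map fun s => s.room x y).sum

/-- The part of `W` that is complete before following the instructions in `l`. -/
def before (l : List Site) (W : ℕ → ℕ → ℕ) (x y : ℕ) : ℕ := min (W x y) (3 - pend l x y)

/-- Whether `f p q` for all `p ≤ q < 6`. -/
def allPairs (f : ℕ → ℕ → Bool) : Bool :=
  (List.range 6).all fun q => (List.range (q + 1)).all fun p => f p q

lemma allPairs_iff {f : ℕ → ℕ → Bool} :
    allPairs f = true ↔ ∀ q < 6, ∀ p ≤ q, f p q = true := by
  simp only [allPairs, List.all_eq_true, List.mem_range, Nat.lt_succ_iff]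

/-- The instruction may be followed by those in `l` in an enumeration of all patterns. -/
def Site.good (l : List Site) : Site → Bool
  | .edge p q => p ≤ q && q < 6
  | .loop p => p < 6 && pend l p p == 0
  | .ear p q => p ≤ q && q < 6 && pend l p q == 0
  | .le i j => i == j + 1 && (j == 74 || j == 76 || j == 77 || j == 78) &&
    (allPairs (fun p q => (coef i p q = 0 ∧ coef j p q = 0) ∨ pend l p q = 2) ||
    (76 ≤ j && allPairs fun p q =>
      (coef i p q = 0 ∧ coef j p q = 0) ∨ pend l p q = if p < 2 then 2 else 3))
  | .low m p => p < 6 && m == (if p < 2 then 120 else 121) &&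
    allPairs fun x y => coef (68 + p) x y = 0 ∨ pend l x y = 0

/-- All instructions in `l` are followed by suitable ones. -/
def allGood : List Site → Bool
  | [] => true
  | s :: l => s.good l && allGood l

lemma allGood_sites : allGood sites = true := by
  decide +kernel

lemma search_ear (next : ℕ → (ℕ → Bool) → Bool) (s M : ℕ) (l : List Step) (T : ℕ) :
    search next (.ear s M :: l) T =
      if byte T s = 0 then search next l T else climb next M (search next l) 2 T := by
  change @Bool.rec (fun _ => Bool) (climb next M (search next l) 2 T) (search next l T)
    (Nat.beq (byte T s) 0) = _
  cases h : Nat.beq (byte T s) 0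
  · rw [if_neg (Nat.ne_of_beq_eq_false h)]
  · rw [if_pos (Nat.eq_of_beq_eq_true h)]

lemma search_le (next : ℕ → (ℕ → Bool) → Bool) {s t T : ℕ} (l : List Step)
    (h : byte T s ≤ byte T t) : search next (.le s t :: l) T = search next l T := by
  change @Bool.rec (fun _ => Bool) true (search next l T) (Nat.ble (byte T s) (byte T t)) = _
  rw [Nat.ble_eq_true_of_le h]

lemma search_low (next : ℕ → (ℕ → Bool) → Bool) {m s T : ℕ} (l : List Step)
    (h : m ≤ byte T s) : search next (.low m s :: l) T = search next l T := by
  change @Bool.rec (fun _ => Bool) true (search next l T) (Nat.ble m (byte T s)) = _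
  rw [Nat.ble_eq_true_of_le h]

lemma search_edge (next : ℕ → (ℕ → Bool) → Bool) (M : ℕ) (l : List Step) (T : ℕ) :
    search next (.edge M :: l) T = climb next M (search next l) 1 T := rfl

lemma search_loop (next : ℕ → (ℕ → Bool) → Bool) (M : ℕ) (l : List Step) (T : ℕ) :
    search next (.loop M :: l) T = climb next M (search next l) 3 T := rfl

lemma forceSteps_eq (l : List Step) (f : List Step → Bool) : forceSteps l f = f l := by
  induction l generalizing f with
  | nil => rfl
  | cons a l ih =>
    cases a with
    | edge M =>
      change force M (fun M => forceSteps l fun l => f (.edge M :: l)) = _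
      rw [force_eq, ih]
    | loop M =>
      change force M (fun M => forceSteps l fun l => f (.loop M :: l)) = _
      rw [force_eq, ih]
    | ear s M =>
      change force s (fun s => force M fun M => forceSteps l fun l => f (.ear s M :: l)) = _
      rw [force_eq, force_eq, ih]
    | le s t =>
      change force s (fun s => force t fun t => forceSteps l fun l => f (.le s t :: l)) = _
      rw [force_eq, force_eq, ih]
    | low m s =>
      change force m (fun m => force s fun s => forceSteps l fun l => f (.low m s :: l)) = _
      rw [force_eq, force_eq, ih]

lemma pend_sites {p q : ℕ} (hp : p ≤ q) (hq : q < 6) : pend sites p q = 3 := by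
  have : ∀ q < 6, ∀ p ≤ q, pend sites p q = 3 := by decide +kernel
  exact this q hq p hp

lemma lane_congr {X Y : ℕ → ℕ → ℕ} {i : ℕ}
    (h : ∀ q < 6, ∀ p ≤ q, coef i p q ≠ 0 → X p q = Y p q) : lane X i = lane Y i := by
  rw [lane, lane]
  congr 1
  refine pairSum_congr fun q hq p hp => ?_
  by_cases hc : coef i p q = 0
  · rw [hc, zero_mul, zero_mul]
  · rw [h q hq p hp hc]

lemma lane_base_le {X : ℕ → ℕ → ℕ} (hX : ∀ p q, X p q ≤ 1) {j : ℕ}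
    (hj : j = 74 ∨ j = 76 ∨ j = 77 ∨ j = 78) (h76 : 76 ≤ j) (h : lane X (j + 1) ≤ lane X j) :
    lane (fun p q => if p < 2 then X p q else 0) (j + 1) ≤
      lane (fun p q => if p < 2 then X p q else 0) j := by
  rcases hj with rfl | rfl | rfl | rfl
  · omega
  all_goals
    simp [lane, pairSum, Finset.sum_range_succ, coef, base] at h ⊢
    have h1 := hX 2 3
    have h2 := hX 2 4
    have h3 := hX 2 5
    have h4 := hX 3 4
    have h5 := hX 3 5
    have h6 := hX 4 5
    omega

lemma before_cons {s : Site} {l : List Site} {W : ℕ → ℕ → ℕ} {x y : ℕ} :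
    before (s :: l) W x y = min (W x y) (3 - (s.room x y + pend l x y)) := rfl

lemma before_cons_of_room {s : Site} {l : List Site} {W : ℕ → ℕ → ℕ}
    (h : ∀ q < 6, ∀ p ≤ q, s.room p q = 0 ∨ W p q = 0) :
    ∀ q < 6, ∀ p ≤ q, before (s :: l) W p q = before l W p q := by
  intro q hq p hp
  rcases h q hq p hp with h0 | h0
  · rw [before_cons, h0, zero_add, before]
  · rw [before, before, h0, Nat.zero_min, Nat.zero_min]

namespace IsPattern

variable {k : ℕ} {W : ℕ → ℕ → ℕ}

lemma lane_before_le (h : IsPattern k W) {l : List Site} {i j : ℕ}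
    (hg : (Site.le i j).good l = true) : lane (before l W) i ≤ lane (before l W) j := by
  simp only [Site.good, Bool.and_eq_true, Bool.or_eq_true, beq_iff_eq, decide_eq_true_eq,
    or_assoc, allPairs_iff] at hg
  obtain ⟨⟨rfl, hj⟩, hp | ⟨h76, hp⟩⟩ := hg
  · have e (m : ℕ) (hm : m = j + 1 ∨ m = j) :
        lane (before l W) m = lane (fun p q => min (W p q) 1) m :=
      lane_congr fun q hq p hpq hc => by
        rw [before, (hp q hq p hpq).resolve_left (by rcases hm with rfl | rfl <;> simp [hc])]
    rw [e _ (Or.inl rfl), e _ (Or.inr rfl)]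
    exact h.sorted j hj
  · have e (m : ℕ) (hm : m = j + 1 ∨ m = j) : lane (before l W) m =
        lane (fun p q => if p < 2 then min (W p q) 1 else 0) m :=
      lane_congr fun q hq p hpq hc => by
        rw [before, (hp q hq p hpq).resolve_left (by rcases hm with rfl | rfl <;> simp [hc])]
        split_ifs
        · rfl
        · exact Nat.min_zero _
    rw [e _ (Or.inl rfl), e _ (Or.inr rfl)]
    exact lane_base_le (fun _ _ => min_le_right _ _) hj h76 (h.sorted j hj)

lemma le_lane_before (h : IsPattern k W) {l : List Site} {m p : ℕ}
    (hg : (Site.low m p).good l = true) (hp : p < k) : m ≤ lane (before l W) (68 + p) := by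
  simp only [Site.good, Bool.and_eq_true, beq_iff_eq, decide_eq_true_eq, allPairs_iff] at hg
  obtain ⟨⟨-, rfl⟩, hc⟩ := hg
  have e : lane (before l W) (68 + p) = lane W (68 + p) := lane_congr fun q hq x hx hx0 => by
    rw [before, (hc q hq x hx).resolve_left hx0]
    exact min_eq_left (h.le_three hx hq)
  rw [e]
  split_ifs with h2
  · exact h.two_le_degree p hp h2
  · exact h.three_le_degree p hp (by omega)

/-- The step from one state to the next one. -/
lemma before_step {P : Prop} {next : ℕ → (ℕ → Bool) → Bool} {f : ℕ → Bool}
    (hnext : ∀ X f, (∀ q < 6, ∀ p ≤ q, X p q ≤ W p q) → next (enc X) f = true →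
      P ∨ ¬ DenseOff k X ∧ f (enc X) = true) {s : Site} {l : List Site} {p q j : ℕ} (hpq : p ≤ q)
    (hq : q < 6) (hroom : ∀ x y, s.room x y = j * single p q x y)
    (hd : ¬ DenseOff k (before (s :: l) W))
    (hc : climb next (unit p q) f j
      (enc (before (s :: l) W)) = true) : P ∨ ¬ DenseOff k (before l W) ∧ f (enc (before l W)) = true := by
  have e1 : before (s :: l) W = upd (before l W) p q (before (s :: l) W p q) := by
    funext x y
    rw [upd]
    split_ifs with hxy
    · rw [hxy.1, hxy.2]
    · rw [before_cons, hroom, single, if_neg hxy, mul_zero, zero_add, before]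
  have e2 : before l W = upd (before l W) p q (before l W p q) := by
    funext x y
    rw [upd]
    split_ifs with hxy
    · rw [hxy.1, hxy.2]
    · rfl
  have e3 : before (s :: l) W p q = min (W p q) (3 - (j + pend l p q)) := by
    rw [before_cons, hroom, single, if_pos ⟨rfl, rfl⟩, mul_one]
  have e4 : before l W p q = min (W p q) (3 - pend l p q) := rfl
  have e5 : before (s :: l) W p q ≤ before l W p q ∧
      before l W p q ≤ before (s :: l) W p q + j := by omega
  rw [e1] at hd hc
  rw [e2]
  exact of_climb hnext (fun y _ x _ => min_le_left _ _) hpq hq (min_le_left _ _) j _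
    e5.1 e5.2 hd hc

lemma of_search (h : IsPattern k W) {P : Prop} {next : ℕ → (ℕ → Bool) → Bool}
    (hnext : ∀ X f, (∀ q < 6, ∀ p ≤ q, X p q ≤ W p q) → next (enc X) f = true →
      P ∨ ¬ DenseOff k X ∧ f (enc X) = true) (l : List Site) (hl : allGood l = true)
    (hd : ¬ DenseOff k (before l W))
    (hs : search next
      ((l.filter (Site.valid k)).map Site.step) (enc (before l W)) = true) : P := by
  have hle (l : List Site) : ∀ q < 6, ∀ p ≤ q, before l W p q ≤ 3 := fun q hq p hp =>
    (min_le_left _ _).trans (h.le_three hp hq)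
  induction l with
  | nil =>
    refine absurd h.dense ?_
    have e : ∀ S, load (before [] W) S = load W S := fun S => pairSum_congr fun q hq p hp => by
      rw [before]
      congr 1
      exact min_eq_left (h.le_three hp hq)
    simpa only [DenseOff, e] using hd
  | cons s l ih =>
    rw [allGood, Bool.and_eq_true] at hl
    obtain ⟨hs0, hl⟩ := hl
    have skip (h0 : ∀ q < 6, ∀ p ≤ q, s.room p q = 0 ∨ W p q = 0)
        (hs1 : search next
          ((l.filter (Site.valid k)).map Site.step) (enc (before (s :: l) W)) = true) : P := by
      have e := before_cons_of_room (l := l) h0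
      rw [enc_congr e] at hs1
      refine ih hl ?_ hs1
      have e1 : ∀ S, load (before (s :: l) W) S = load (before l W) S := fun S =>
        pairSum_congr fun q hq p hp => by rw [e q hq p hp]
      simpa only [DenseOff, e1] using hd
    by_cases hv : s.valid k = true
    swap
    · rw [List.filter_cons_of_neg hv] at hs
      refine skip (fun q hq p hp => ?_) hs
      by_contra hne
      push Not at hne
      obtain ⟨h1, h2⟩ := hne
      have hqk : q < k := by
        by_contra hk
        exact h2 (h.eq_zero p q (by omega))
      apply hv
      cases s <;> simp_all [Site.valid, Site.room, single]
    rw [List.filter_cons_of_pos hv, List.map_cons] at hs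
    have room_step {p q j : ℕ} (hpq : p ≤ q) (hq : q < 6)
        (hroom : ∀ x y, s.room x y = j * single p q x y)
        (hc : climb next (unit p q)
          (search next
            ((l.filter (Site.valid k)).map Site.step)) j (enc (before (s :: l) W)) = true) : P := by
      rcases before_step hnext hpq hq hroom hd hc with hP | ⟨h1, h2⟩
      · exact hP
      · exact ih hl h1 h2
    cases s with
    | edge p q =>
      simp only [Site.good, Bool.and_eq_true, decide_eq_true_eq] at hs0
      rw [Site.step, search_edge] at hs
      exact room_step hs0.1 hs0.2 (fun x y => (one_mul _).symm) hs
    | loop p =>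
      simp only [Site.good, Bool.and_eq_true, decide_eq_true_eq] at hs0
      rw [Site.step, search_loop] at hs
      exact room_step le_rfl hs0.1 (fun x y => rfl) hs
    | ear p q =>
      simp only [Site.good, Bool.and_eq_true, decide_eq_true_eq, beq_iff_eq] at hs0
      obtain ⟨⟨hpq, hq⟩, hp0⟩ := hs0
      rw [Site.step, search_ear, byte_enc (hle _) (by omega), lane_weight _ hpq hq] at hs
      split_ifs at hs with h0
      · refine skip (fun y hy x hx => ?_) hs
        rw [before_cons, hp0, Site.room, single, if_pos ⟨rfl, rfl⟩] at h0
        rw [Site.room, single]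
        split_ifs with hxy
        · rw [hxy.1, hxy.2]
          omega
        · exact Or.inl rfl
      · exact room_step hpq hq (fun x y => rfl) hs
    | le i j =>
      have h1 := h.lane_before_le hs0
      simp only [Site.good, Bool.and_eq_true, Bool.or_eq_true, beq_iff_eq, or_assoc] at hs0
      have e : before (.le i j :: l) W = before l W := by
        funext x y
        change min _ (3 - (0 + _)) = _
        rw [zero_add]
        rfl
      rw [e] at hs hd
      rw [Site.step, search_le] at hs
      · exact ih hl hd hs
      · rwa [byte_enc (hle _) (by omega), byte_enc (hle _) (by omega)]
    | low m p =>
      have h1 := h.le_lane_before hs0 (Nat.le_of_ble_eq_true hv)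
      simp only [Site.good, Bool.and_eq_true, decide_eq_true_eq] at hs0
      have e : before (.low m p :: l) W = before l W := by
        funext x y
        change min _ (3 - (0 + _)) = _
        rw [zero_add]
        rfl
      rw [e] at hs hd
      rw [Site.step, search_low] at hs
      · exact ih hl hd hs
      · rwa [byte_enc (hle _) (by omega)]

lemma of_run (h : IsPattern k W) (hk : 0 < k) {P : Prop} {leaf : ℕ → Bool}
    (hleaf : leaf (enc W) = true → P) (hr : run k leaf = true) : P := by
  have e0 : ∀ q < 6, ∀ p ≤ q, before sites W p q = 0 := fun q hq p hp => by
    rw [before, pend_sites hp hq]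
    exact Nat.min_zero _
  have e : pack base 116 = enc (before sites W) := pack_congr fun i _ => by
    rw [lane, pairSum_congr (g := fun _ _ => 0) fun q hq p hp => by rw [e0 q hq p hp, mul_zero]]
    simp [pairSum]
  rw [run, forceSteps_eq, forceList_eq, force_eq, force_eq, force_eq, force_eq, e] at hr
  refine h.of_search (fun X f hX hv => h.of_visit hleaf hX hv) sites allGood_sites ?_ hr
  intro hd
  obtain ⟨S, -, -, hS⟩ := hd 0 hk
  have : load (before sites W) S = 0 := by
    rw [load, pairSum_congr (g := fun _ _ => 0) fun q hq p hp => by rw [e0 q hq p hp, mul_zero]]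
    simp [pairSum]
  omega

end IsPattern

end Runs

section Leaves

/-- The pairs `p < q < k`. -/
def pairs (k : ℕ) : List (ℕ × ℕ) :=
  (List.range k).flatMap fun q => (List.range q).map fun p => (p, q)

/-- The pairs `p ≤ q < k`. -/
def pairsLoops (k : ℕ) : List (ℕ × ℕ) :=
  (List.range k).flatMap fun q => (List.range (q + 1)).map fun p => (p, q)

/-- The weight of the pair `p ≤ q`. -/
def weight (T p q : ℕ) : ℕ := byte T (Nat.mul 8 (Nat.add 80 (Nat.add (Nat.mul 6 q) p)))

/-- Whether some degree is too small. -/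
def lowDegree (k T : ℕ) : Bool := (List.range k).any fun p =>
  Nat.blt (byte T (Nat.mul 8 (Nat.add 68 p))) (cond (Nat.blt p 2) 120 121)

/-- The units of weight in the order of `pairsLoops`. -/
def units (k : ℕ) : List ℕ := (pairsLoops k).map fun x => unit x.1 x.2

/-- Whether some unit can be removed from a dense state. -/
noncomputable def deletable (av : List ℕ) (one T : ℕ) : List (ℕ × ℕ) → List ℕ → Bool
  | x :: l, u :: us => (!Nat.beq (weight T x.1 x.2) 0 &&
      force (Nat.add (Nat.sub T u) one) (meetsAll av)) || deletable av one T l us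
  | _, _ => false

/-- Whether `r` is a common neighbour of `p` and `q`. -/
def common (T p q r : ℕ) : Bool :=
  !Nat.beq r p && !Nat.beq r q && !Nat.beq (weight T (Nat.min p r) (Nat.max p r)) 0 &&
    !Nat.beq (weight T (Nat.min q r) (Nat.max q r)) 0

/-- The weight lost in lanes of vertex sets when a pair is contracted, where `B` marks the sets
containing the pair. -/
def loss (k T : ℕ) (Ps : List ℕ) (B p q : ℕ) : ℕ :=
  (List.range k).foldr (fun r s => cond (common T p q r) (Nat.add (Nat.land B (Ps.getD r 0)) s) s)
    (Nat.mul (weight T p q) B)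

/-- Whether a pair can be contracted in a dense state. Here the lists `Ps` and `Qs` mark the
vertex sets with or without given vertices. -/
noncomputable def contractible (k one : ℕ) (Ps Qs : List ℕ) (T : ℕ) : Bool :=
  (pairs k).any fun x => !Nat.beq (weight T x.1 x.2) 0 &&
    force (Nat.land (Ps.getD x.1 0) (Ps.getD x.2 0)) fun B =>
    force (Nat.add B (Nat.land (Qs.getD x.1 0) (Qs.getD x.2 0))) fun E =>
    force (Nat.sub (Nat.add T (Nat.add one B)) (loss k T Ps B x.1 x.2)) fun T' =>
    (List.range k).all fun z => Nat.beq z x.2 ||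
      !Nat.beq (Nat.land T' (Nat.mul 128 (Nat.land E (Qs.getD z 0)))) 0

/-- The neighbourhood of `x` in the graph with edges `l`, as a bit set. -/
def row (l : List (ℕ × ℕ)) (x : ℕ) : ℕ :=
  l.foldr (fun e m => cond (Nat.beq e.1 x) (Nat.lor (2 ^ e.2) m)
    (cond (Nat.beq e.2 x) (Nat.lor (2 ^ e.1) m) m)) 0

/-- The bit set with the elements of `l`. -/
def bits (l : List ℕ) : ℕ := l.foldr (fun a m => Nat.lor (2 ^ a) m) 0

/-- The vertices outside of the core `c`. -/
def outside (n : ℕ) (c : List ℕ) : List ℕ := (List.range n).filter fun x => !c.contains x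

/-- The number of vertices outside of the core `c` that see the core vertices `a` and `b`. -/
def seeing (n : ℕ) (l : List (ℕ × ℕ)) (c : List ℕ) (a b : ℕ) : ℕ :=
  (outside n c).countP fun x => Nat.beq (Nat.land (row l x) (bits c)) (Nat.lor (2 ^ a) (2 ^ b))

/-- The weight of a pair of vertices in the core `c`. -/
def coreWeight (n : ℕ) (l : List (ℕ × ℕ)) (c : List ℕ) (p q : ℕ) : ℕ :=
  cond (Nat.beq p q) (seeing n l c (c.getD p 0) (c.getD p 0) / 2)
    (((row l (c.getD p 0)).testBit (c.getD q 0)).toNat + seeing n l c (c.getD p 0) (c.getD q 0))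

/-- The weights of the core `c` as found in the last lanes of a state. -/
def code (n : ℕ) (l : List (ℕ × ℕ)) (c : List ℕ) : ℕ :=
  pack (fun i => cond (Nat.ble (i % 6) (i / 6) && Nat.blt (i / 6) c.length)
    (coreWeight n l c (i % 6) (i / 6)) 0) 36

/-- Whether `c` is a core of the graph with vertices `0, …, n - 1` and edges `l`. -/
def isCore (n : ℕ) (l : List (ℕ × ℕ)) (c : List ℕ) : Bool :=
  decide c.Nodup && (c.all fun a => Nat.blt a n) && (l.all fun e => !Nat.beq e.1 e.2) &&
  (outside n c).all fun x =>
    (c.any fun a => c.any fun b => !Nat.beq a b && (row l a).testBit b &&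
      Nat.beq (row l x) (Nat.lor (2 ^ a) (2 ^ b))) ||
    (c.any fun a => (outside n c).any fun y => !Nat.beq x y &&
      Nat.beq (row l x) (Nat.lor (2 ^ a) (2 ^ y)) && Nat.beq (row l y) (Nat.lor (2 ^ a) (2 ^ x)))

/-- The graphs in `OList` together with the cores that occur at leaves of the search. -/
def cores : List (ℕ × List (ℕ × ℕ) × List (List ℕ)) :=
  [(8, [(0, 1), (0, 2), (0, 3), (1, 2), (1, 3), (4, 5), (4, 6), (4, 7), (5, 6), (5, 7)],
    [[0, 4, 1, 5], [2, 4, 0, 1, 5], [2, 6, 0, 1, 4, 5]]),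
   (10, [(0, 1), (0, 2), (1, 2), (0, 3), (0, 4), (3, 4), (5, 6), (5, 7), (6, 7), (5, 8), (5, 9),
    (8, 9)], [[0, 5], [1, 5, 0], [1, 6, 0, 5]]),
   (9, [(0, 1), (0, 2), (0, 3), (1, 2), (1, 3), (4, 5), (4, 6), (5, 6), (4, 7), (4, 8), (7, 8)],
    [[0, 4, 1], [0, 5, 1, 4], [2, 4, 0, 1], [5, 0, 4, 1], [2, 5, 0, 1, 4]]),
   (8, [(0, 1), (0, 2), (1, 2), (2, 3), (2, 4), (3, 4), (3, 5), (4, 5), (5, 6), (5, 7), (6, 7)],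
    [[2, 5, 3, 4], [3, 2, 4, 5], [3, 4, 2, 5]]),
   (8, [(0, 1), (0, 2), (1, 2), (2, 3), (2, 4), (3, 4), (3, 5), (4, 6), (5, 6), (5, 7), (6, 7)],
    [[2, 5, 3, 4, 6], [3, 2, 4, 5, 6], [3, 4, 2, 5, 6], [3, 5, 4, 2, 6], [3, 6, 4, 5, 2],
    [5, 2, 3, 6, 4]]),
   (8, [(0, 1), (0, 2), (1, 2), (2, 3), (2, 4), (3, 4), (3, 5), (4, 5), (3, 6), (5, 6), (4, 7),
    (5, 7)], [[3, 4, 2, 5], [3, 4, 5, 2], [3, 5, 4, 2]]),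
   (7, [(0, 1), (0, 6), (1, 6), (2, 3), (2, 4), (2, 5), (3, 4), (3, 5), (4, 6), (5, 6)],
    [[2, 3, 4, 5, 6], [2, 4, 3, 5, 6], [2, 6, 4, 5, 3], [4, 2, 3, 6, 5], [4, 5, 2, 3, 6],
    [4, 6, 2, 3, 5]]),
   (7, [(0, 1), (0, 2), (1, 2), (2, 3), (2, 4), (2, 5), (3, 4), (3, 5), (4, 5), (4, 6), (5, 6)],
    [[2, 4, 3, 5], [2, 4, 5, 3], [4, 2, 3, 5], [4, 2, 5, 3], [4, 5, 2, 3], [4, 5, 3, 2]]),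
   (9, [(0, 1), (0, 2), (1, 2), (2, 3), (2, 4), (3, 4), (3, 5), (4, 5), (2, 6), (4, 6), (2, 7),
    (3, 7), (3, 8), (4, 8)], [[2, 3, 4], [3, 2, 4], [3, 4, 2]]),
   (9, [(0, 1), (1, 2), (2, 3), (3, 0), (0, 4), (1, 4), (1, 5), (2, 5), (2, 6), (3, 6), (0, 7),
    (0, 8), (7, 8)], [[0, 1, 3, 2], [0, 2, 1, 3], [0, 2, 3, 1], [1, 0, 2, 3], [1, 2, 0, 3],
    [2, 0, 1, 3], [2, 0, 3, 1], [2, 1, 3, 0]]),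
   (9, [(0, 1), (0, 2), (1, 2), (3, 4), (3, 5), (4, 5), (6, 7), (6, 8), (7, 8), (2, 3), (1, 8),
    (4, 8)], [[1, 3, 2, 8, 4], [1, 4, 8, 2, 3], [1, 8, 2, 4, 3], [2, 3, 1, 4, 8], [2, 4, 3, 1, 8],
    [2, 8, 1, 3, 4], [8, 1, 4, 2, 3], [8, 2, 1, 4, 3]]),
   (9, [(0, 1), (0, 2), (1, 2), (3, 4), (3, 5), (4, 5), (6, 7), (6, 8), (7, 8), (2, 3), (2, 7),
    (3, 6)], [[2, 3, 7, 6], [2, 6, 3, 7], [2, 6, 7, 3], [2, 7, 3, 6], [6, 2, 3, 7], [6, 2, 7, 3],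
    [6, 3, 7, 2]]),
   (9, [(0, 1), (0, 2), (1, 2), (3, 4), (3, 5), (4, 5), (6, 7), (6, 8), (7, 8), (2, 3), (2, 8),
    (3, 8)], [[2, 3, 8]]),
   (8, [(0, 1), (0, 2), (1, 2), (1, 4), (2, 3), (2, 4), (3, 4), (3, 5), (4, 5), (1, 6), (1, 7),
    (6, 7)], [[2, 1, 4, 3], [2, 4, 1, 3], [2, 4, 3, 1], [4, 1, 2, 3], [4, 2, 1, 3], [4, 2, 3, 1]]),
   (9, [(0, 1), (0, 2), (1, 2), (2, 3), (2, 4), (3, 4), (4, 5), (4, 6), (5, 6), (6, 7), (6, 8),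
    (7, 8), (2, 6)], [[2, 4, 6], [2, 6, 4], [4, 2, 6]]),
   (6, [(0, 2), (0, 3), (0, 4), (0, 5), (1, 2), (1, 3), (1, 4), (1, 5), (2, 3), (4, 5)],
    [[0, 1, 2, 3, 4, 5], [0, 1, 2, 4, 3, 5], [0, 1, 2, 4, 5, 3]]),
   (6, [(0, 1), (1, 3), (3, 2), (2, 0), (4, 0), (4, 1), (4, 2), (4, 3), (5, 0), (5, 1)],
    [[0, 1, 4, 2, 3], [4, 0, 1, 2, 3], [4, 0, 2, 1, 3]]),
   (8, [(0, 1), (1, 2), (2, 3), (3, 0), (4, 0), (4, 1), (5, 1), (5, 2), (6, 2), (6, 3), (7, 3),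
    (7, 0)], [[0, 1, 3, 2], [0, 2, 1, 3]]),
   (7, [(0, 2), (0, 3), (1, 2), (1, 3), (2, 3), (0, 4), (4, 1), (5, 0), (5, 4), (6, 4), (6, 1)],
    [[0, 1, 2, 3, 4], [0, 4, 2, 3, 1]]),
   (6, [(1, 2), (1, 4), (1, 5), (2, 4), (2, 5), (4, 5), (0, 1), (0, 4), (2, 3), (3, 5)],
    [[1, 2, 4, 5], [1, 2, 5, 4], [1, 4, 2, 5]]),
   (7, [(0, 1), (0, 3), (0, 4), (1, 3), (1, 4), (3, 5), (4, 5), (1, 2), (2, 4), (3, 6), (5, 6)],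
    [[1, 3, 0, 4, 5], [1, 4, 0, 3, 5], [3, 1, 0, 5, 4], [3, 4, 0, 1, 5], [3, 4, 1, 0, 5],
    [4, 1, 0, 5, 3], [4, 3, 0, 1, 5], [4, 3, 1, 0, 5]]),
   (8, [(0, 1), (0, 3), (1, 4), (3, 4), (1, 2), (2, 4), (7, 0), (7, 3), (5, 7), (5, 0), (6, 7),
    (6, 3)], [[0, 3, 7, 1, 4], [0, 7, 3, 1, 4]]),
   (7, [(2, 3), (2, 4), (2, 6), (3, 4), (3, 6), (4, 6), (5, 3), (5, 4), (0, 2), (0, 3), (1, 2),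
    (1, 4)], [[2, 3, 4, 6], [2, 3, 6, 4]]),
   (7, [(0, 1), (0, 2), (1, 2), (1, 3), (2, 4), (3, 5), (3, 6), (4, 5), (4, 6), (5, 6)],
    [[3, 1, 5, 6, 2, 4], [3, 2, 1, 5, 6, 4], [3, 4, 5, 6, 1, 2], [3, 5, 6, 1, 4, 2],
    [5, 1, 3, 4, 6, 2], [5, 1, 3, 6, 4, 2], [5, 3, 6, 4, 1, 2], [5, 6, 3, 4, 1, 2],
    [5, 6, 3, 4, 2, 1]]),
   (8, [(0, 1), (0, 3), (1, 3), (1, 2), (1, 5), (2, 5), (1, 7), (2, 7), (3, 4), (4, 5), (3, 5),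
    (3, 6), (5, 6)], [[1, 3, 5, 2], [1, 5, 2, 3], [1, 5, 3, 2], [5, 1, 2, 3], [5, 1, 3, 2],
    [5, 3, 1, 2]]),
   (9, [(2, 3), (2, 4), (3, 4), (5, 3), (5, 4), (8, 3), (8, 4), (0, 2), (0, 3), (7, 2), (7, 3),
    (1, 2), (1, 4), (6, 2), (6, 4)], [[2, 3, 4]]),
   (8, [(0, 2), (1, 2), (0, 3), (2, 3), (1, 6), (2, 6), (3, 4), (6, 7), (4, 5), (5, 7), (3, 7),
    (4, 7)], [[3, 2, 7, 4, 6], [3, 7, 4, 2, 6], [7, 2, 3, 6, 4], [7, 3, 4, 6, 2]]),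
   (7, [(0, 1), (0, 2), (1, 2), (1, 3), (1, 5), (3, 5), (3, 4), (3, 6), (4, 6), (2, 5), (5, 6)],
    [[1, 3, 5, 2, 6], [5, 1, 3, 2, 6]]),
   (9, [(0, 1), (0, 2), (1, 2), (3, 4), (3, 5), (4, 5), (6, 7), (6, 8), (7, 8), (2, 3), (1, 7),
    (4, 6)], [[1, 3, 2, 7, 4, 6], [1, 4, 2, 7, 3, 6], [1, 4, 2, 7, 6, 3], [1, 4, 7, 2, 3, 6],
    [1, 4, 7, 2, 6, 3], [1, 6, 7, 2, 4, 3], [1, 7, 2, 6, 3, 4], [1, 7, 2, 6, 4, 3]]),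
   (8, [(0, 1), (0, 2), (1, 2), (3, 4), (3, 5), (4, 5), (6, 7), (1, 6), (4, 6), (0, 7), (5, 7)],
    [[0, 4, 7, 1, 6, 5], [0, 5, 7, 1, 4, 6], [6, 0, 7, 1, 4, 5], [6, 1, 7, 4, 0, 5],
    [6, 7, 1, 4, 0, 5], [6, 7, 1, 4, 5, 0]]),
   (6, [(0, 1), (0, 2), (1, 2), (3, 4), (3, 5), (4, 5), (0, 3), (1, 4), (2, 5)],
    [[0, 1, 2, 3, 4, 5], [0, 3, 1, 2, 4, 5], [0, 3, 1, 2, 5, 4], [0, 4, 1, 3, 2, 5],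
    [0, 4, 3, 1, 2, 5]]),
   (6, [(0, 3), (0, 4), (0, 5), (1, 3), (1, 4), (1, 5), (2, 3), (2, 4), (2, 5)],
    [[0, 1, 3, 4, 5, 2], [0, 3, 4, 5, 1, 2]]),
   (5, [(0, 1), (0, 2), (0, 3), (0, 4), (1, 2), (1, 3), (1, 4), (2, 3), (2, 4)], [[0, 1, 2, 3, 4],
    [0, 1, 3, 2, 4], [0, 1, 3, 4, 2]])]

/-- The codes of the tabulated cores with `k` vertices. -/
def codes (k : ℕ) : List ℕ := cores.flatMap fun g =>
  (g.2.2.filter fun c => Nat.beq c.length k).map fun c => code g.1 g.2.1 c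

/-- The test applied to dense states. -/
noncomputable def leaf (k : ℕ) : ((ℕ → Bool) → Bool) → Bool := fun f =>
  forceList (avoids k) fun av => forceList (units k) fun us =>
  forceList ((List.range 6).map fun p => ones fun S => S.testBit p) fun Ps =>
  forceList ((List.range 6).map fun p => ones fun S => !S.testBit p) fun Qs =>
  force (ones fun _ => true) fun one => forceList (codes k) fun cs =>
  f fun T => lowDegree k T || deletable av one T (pairsLoops k) us ||
    cs.contains (Nat.shiftRight T 640) || contractible k one Ps Qs T

lemma card_le_of_mem_cores : ∀ g ∈ cores, g.1 ≤ 10 := by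
  decide +kernel

lemma isCore_cores : (cores.all fun g => g.2.2.all fun c => isCore g.1 g.2.1 c) = true := by
  decide +kernel

end Leaves

section LeafSoundness

lemma not_beq {m n : ℕ} : (!Nat.beq m n) = true ↔ m ≠ n := by
  rw [Bool.not_eq_true', Bool.eq_false_iff, ne_eq, Nat.beq_eq]

lemma laneOf_and (f g : ℕ → Bool) (i : ℕ) :
    laneOf (fun S => f S && g S) i = (laneOf f i && laneOf g i) := by
  simp only [laneOf]
  cases Nat.ble 4 i <;> cases Nat.blt i 68 <;> simp

lemma laneOf_or (f g : ℕ → Bool) (i : ℕ) :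
    laneOf (fun S => f S || g S) i = (laneOf f i || laneOf g i) := by
  simp only [laneOf]
  cases Nat.ble 4 i <;> cases Nat.blt i 68 <;> simp

lemma land_ones (f g : ℕ → Bool) :
    Nat.land (ones f) (ones g) = ones fun S => f S && g S := by
  have h (f : ℕ → Bool) (i : ℕ) : (laneOf f i).toNat < 256 :=
    (Bool.toNat_le _).trans_lt (by norm_num)
  rw [ones, ones, land_pack (fun i _ => h f i) (fun i _ => h g i)]
  refine pack_congr fun i _ => ?_
  rw [laneOf_and]
  cases laneOf f i <;> cases laneOf g i <;> rfl

lemma add_ones {f g : ℕ → Bool} (h : ∀ S, (f S && g S) = false) :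
    Nat.add (ones f) (ones g) = ones fun S => f S || g S := by
  rw [ones, ones, pack_add]
  refine pack_congr fun i _ => ?_
  have h1 := laneOf_and f g i
  simp only [h] at h1
  have h2 : laneOf (fun _ => false) i = false := by simp [laneOf]
  rw [h2] at h1
  rw [laneOf_or]
  revert h1
  cases laneOf f i <;> cases laneOf g i <;> simp

lemma mul_ones (f : ℕ → Bool) : Nat.mul 128 (ones f) = mask f := pack_mul _ _ _

lemma getD_map_range (F : ℕ → ℕ) {p n : ℕ} (hp : p < n) :
    ((List.range n).map F).getD p 0 = F p := by
  simp [List.getD, hp]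

lemma card_filter_range (k : ℕ) (P : ℕ → Prop) [DecidablePred P] :
    ((Finset.range k).filter P).card = (List.range k).countP fun r => decide (P r) := by
  rw [List.countP_eq_length_filter]
  rfl

lemma mem_pairs {k : ℕ} {x : ℕ × ℕ} : x ∈ pairs k ↔ x.1 < x.2 ∧ x.2 < k := by
  obtain ⟨p, q⟩ := x
  simp [pairs, and_comm]

lemma mem_pairsLoops {k : ℕ} {x : ℕ × ℕ} : x ∈ pairsLoops k ↔ x.1 ≤ x.2 ∧ x.2 < k := by
  obtain ⟨p, q⟩ := x
  simp [pairsLoops, and_comm]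

lemma exists_of_deletable {av : List ℕ} {one T : ℕ} {l : List (ℕ × ℕ)}
    (h : deletable av one T l (l.map fun x => unit x.1 x.2) = true) :
    ∃ x ∈ l, weight T x.1 x.2 ≠ 0 ∧
      meetsAll av (Nat.add (Nat.sub T (unit x.1 x.2)) one) = true := by
  induction l with
  | nil => simp [deletable] at h
  | cons x l ih =>
    rw [List.map_cons, deletable, Bool.or_eq_true, Bool.and_eq_true, force_eq] at h
    rcases h with ⟨h1, h2⟩ | h
    · refine ⟨x, List.mem_cons_self, ?_, h2⟩
      exact not_beq.1 h1
    · obtain ⟨y, hy, hy2⟩ := ih h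
      exact ⟨y, List.mem_cons_of_mem _ hy, hy2⟩

namespace IsPattern

variable {k : ℕ} {W : ℕ → ℕ → ℕ}

lemma enc_lt (h : IsPattern k W) {i : ℕ} (hi : i < 116) : lane W i + 6 < 256 :=
  lane_lt (fun _ hq _ hp => h.le_three hp hq) hi

lemma weight_enc (h : IsPattern k W) {p q : ℕ} (hp : p ≤ q) (hq : q < 6) :
    weight (enc W) p q = W p q := by
  rw [← lane_weight W hp hq, ← byte_enc (fun _ hq _ hp => h.le_three hp hq) (by omega)]
  simp only [weight]
  congr 1
  change 8 * (80 + (6 * q + p)) = _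
  omega

lemma not_lowDegree (h : IsPattern k W) : lowDegree k (enc W) = false := by
  rw [lowDegree, List.any_eq_false]
  intro p hp
  rw [List.mem_range] at hp
  have h6 := h.le_six
  have e : byte (enc W) (Nat.mul 8 (Nat.add 68 p)) = lane W (68 + p) :=
    byte_enc (fun _ hq _ hp => h.le_three hp hq) (show 68 + p < 116 by omega)
  rw [e, Nat.blt_eq, not_lt]
  cases h2 : Nat.blt p 2
  · have : ¬ p < 2 := by rw [← Nat.blt_eq, h2]; exact Bool.false_ne_true
    exact h.three_le_degree p hp (by omega)
  · exact h.two_le_degree p hp (by rwa [← Nat.blt_eq])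

lemma not_deletable (h : IsPattern k W) :
    deletable (avoids k) (ones fun _ => true) (enc W) (pairsLoops k) (units k) = false := by
  rw [Bool.eq_false_iff]
  intro hd
  obtain ⟨⟨p, q⟩, hx, h1, h2⟩ := exists_of_deletable hd
  obtain ⟨hpq, hq⟩ := mem_pairsLoops.1 hx
  simp only at hpq hq h1 h2
  have h6 := h.le_six
  rw [h.weight_enc hpq (by omega)] at h1
  obtain ⟨z, hz, hle⟩ := h.delete q hq p hpq h1
  have hcoef (i : ℕ) : coef i p q ≤ lane W i := by
    rw [lane, ← pairSum_single hpq (by omega) (coef i)]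
    refine le_add_left (pairSum_le fun y _ x _ => Nat.mul_le_mul_left _ ?_)
    rw [single]
    split_ifs with hxy
    · rw [hxy.1, hxy.2]
      omega
    · omega
  rw [meetsAll_iff, enc, unit, pack_sub fun i _ => hcoef i, ones, pack_add] at h2
  have h3 := h2 _ (List.mem_map_of_mem (List.mem_range.2 hz))
  rw [land_mask_ne_zero] at h3
  · obtain ⟨S, hS, hzS, hl⟩ := h3
    rw [laneOf_set _ hS] at hl
    have e1 := lane_set W hS
    have e2 := hle S hS (by simpa using hzS)
    have e3 : coef (4 + S) p q = (both S p q).toNat := by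
      simp [coef, show 4 + S < 68 by omega]
    have e4 := hcoef (4 + S)
    rw [e3] at hl e4
    simp only [Bool.toNat_true] at hl
    omega
  · intro i hi
    have := h.enc_lt hi
    have := Bool.toNat_le (laneOf (fun _ => true) i)
    omega

lemma common_enc (h : IsPattern k W) {p q r : ℕ} (hp : p < 6) (hq : q < 6) (hr : r < 6) :
    common (enc W) p q r = true ↔ r ≠ p ∧ r ≠ q ∧ W (min p r) (max p r) ≠ 0 ∧
      W (min q r) (max q r) ≠ 0 := by
  have e (p : ℕ) (hp : p < 6) :
      weight (enc W) (Nat.min p r) (Nat.max p r) = W (min p r) (max p r) :=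
    h.weight_enc min_le_max (max_lt hp hr)
  simp only [common, e p hp, e q hq, Bool.and_eq_true, not_beq, and_assoc]

end IsPattern

lemma foldr_loss {Ps : List ℕ} (hPs : ∀ r < 6, Ps.getD r 0 = ones fun S => S.testBit r)
    (c : ℕ → Bool) (f : ℕ → Bool) {s n : ℕ} {g : ℕ → ℕ} (hs : s = pack g n) (hn : n = 116)
    (l : List ℕ) (hl : ∀ r ∈ l, r < 6) :
    l.foldr (fun r s => cond (c r) (Nat.add (Nat.land (ones f) (Ps.getD r 0)) s) s) s =
    pack (fun i => (l.filter c).countP (fun r => laneOf (fun S => f S && S.testBit r) i) + g i)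
      n := by
  induction l with
  | nil =>
    rw [hs]
    exact pack_congr fun i _ => (zero_add _).symm
  | cons r l ih =>
    rw [List.foldr_cons, ih fun r hr => hl r (List.mem_cons_of_mem _ hr),
      hPs r (hl r List.mem_cons_self), land_ones]
    cases hc : c r
    · rw [List.filter_cons_of_neg (by simp [hc]), cond_false]
    · rw [List.filter_cons_of_pos hc, cond_true, ones, ← hn, pack_add]
      refine pack_congr fun i _ => ?_
      rw [List.countP_cons]
      cases laneOf (fun S => f S && S.testBit r) i
      · simp
      · simp
        omega

lemma IsPattern.not_contractible {k : ℕ} {W : ℕ → ℕ → ℕ} (h : IsPattern k W) {Ps Qs : List ℕ}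
    (hPs : ∀ r < 6, Ps.getD r 0 = ones fun S => S.testBit r)
    (hQs : ∀ r < 6, Qs.getD r 0 = ones fun S => !S.testBit r) :
    contractible k (ones fun _ => true) Ps Qs (enc W) = false := by
  rw [contractible, List.any_eq_false]
  rintro ⟨p, q⟩ hx hc
  obtain ⟨hpq, hq⟩ := mem_pairs.1 hx
  simp only at hpq hq
  have h6 := h.le_six
  rw [Bool.and_eq_true, not_beq, force_eq, force_eq, force_eq, List.all_eq_true] at hc
  obtain ⟨h1, hc⟩ := hc
  simp only at h1 hc
  rw [h.weight_enc hpq.le (by omega)] at h1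
  obtain ⟨z, hz, hzq, hle⟩ := h.contract q hq p hpq h1
  have hz1 := hc z (List.mem_range.2 hz)
  rw [Bool.or_eq_true, Nat.beq_eq, not_beq] at hz1
  replace hz1 := hz1.resolve_left hzq
  have hB : Nat.land (Ps.getD p 0) (Ps.getD q 0) = ones fun S => both S p q := by
    rw [hPs p (by omega), hPs q (by omega), land_ones]
    rfl
  have hE : Nat.add (ones fun S => both S p q) (ones fun S => !S.testBit p && !S.testBit q) =
      ones fun S => both S p q || (!S.testBit p && !S.testBit q) := add_ones fun S => by
    rw [both]
    cases S.testBit p <;> cases S.testBit q <;> rfl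
  rw [hB, hQs p (by omega), hQs q (by omega), hQs z (by omega), land_ones, hE, land_ones,
    mul_ones] at hz1
  obtain ⟨F, hF⟩ : ∃ F, F = (List.range k).filter (common (enc W) p q) := ⟨_, rfl⟩
  have hL : loss k (enc W) Ps (ones fun S => both S p q) p q = pack (fun i =>
      F.countP
        (fun r => laneOf (fun S => both S p q && S.testBit r) i) +
      W p q * (laneOf (fun S => both S p q) i).toNat) 116 := by
    rw [hF, loss, h.weight_enc hpq.le (by omega)]
    exact foldr_loss hPs _ _ (pack_mul _ _ _) rfl _ fun r hr => by
      have := List.mem_range.1 hr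
      omega
  have hcount (i : ℕ) : F.countP
      (fun r => laneOf (fun S => both S p q && S.testBit r) i) ≤ 6 :=
    List.countP_le_length.trans (hF ▸ (List.length_filter_le _ _).trans (by simpa using h6))
  have hcount0 (i : ℕ) (hi : laneOf (fun S => both S p q) i = false) :
      F.countP
      (fun r => laneOf (fun S => both S p q && S.testBit r) i) = 0 := by
    rw [List.countP_eq_zero]
    intro r _
    rw [laneOf_and, hi, Bool.false_and]
    exact Bool.false_ne_true
  have hone : Nat.add (ones fun _ => true) (ones fun S => both S p q) = pack (fun i =>
    (laneOf (fun _ => true) i).toNat + (laneOf (fun S => both S p q) i).toNat) 116 :=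
    pack_add _ _ _
  have hW3 := h.le_three hpq.le (show q < 6 by omega)
  rw [hL, hone, enc, pack_add, pack_sub] at hz1
  · rw [land_mask_ne_zero] at hz1
    · obtain ⟨S, hS, hES, hl⟩ := hz1
      rw [Bool.and_eq_true, Bool.not_eq_true'] at hES
      obtain ⟨h2, h3⟩ := hle S hS hES.2
      have e1 := lane_set W hS
      rw [laneOf_set _ hS, laneOf_set _ hS] at hl
      cases hb : both S p q
      · have h4 : S.testBit p = false ∧ S.testBit q = false := by
          have := hES.1
          rw [hb, Bool.false_or] at this
          revert this
          cases S.testBit p <;> cases S.testBit q <;> simp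
        have := h2 h4.1 h4.2
        rw [hb, hcount0 _ (by rw [laneOf_set _ hS, hb])] at hl
        simp only [Bool.toNat_true, Bool.toNat_false] at hl
        omega
      · have h4 := h3 hb
        have h5 : F.countP
            (fun r => laneOf (fun S => both S p q && S.testBit r) (4 + S)) =
            ((Finset.range k).filter fun r => S.testBit r = true ∧ r ≠ p ∧ r ≠ q ∧
              W (min p r) (max p r) ≠ 0 ∧ W (min q r) (max q r) ≠ 0).card := by
          rw [hF, card_filter_range, List.countP_filter]
          refine List.countP_congr fun r hr => ?_
          rw [laneOf_set _ hS, hb, Bool.true_and, Bool.and_eq_true, decide_eq_true_eq,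
            h.common_enc (by omega) (by omega) (by have := List.mem_range.1 hr; omega)]
        rw [hb, h5] at hl
        simp only [Bool.toNat_true] at hl
        omega
    · intro i hi
      have := h.enc_lt hi
      have := Bool.toNat_le (laneOf (fun _ => true) i)
      have := Bool.toNat_le (laneOf (fun S => both S p q) i)
      omega
  · intro i hi
    cases hb : laneOf (fun S => both S p q) i
    · rw [hcount0 i hb]
      simp
    · obtain ⟨S, hS, rfl, -⟩ := laneOf_iff.1 hb
      have e1 := lane_set W hS
      have e2 := size_le S
      have e3 := hcount (4 + S)
      simp only [Bool.toNat_true]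
      omega

/-- The search finds the code of every pattern. -/
theorem IsPattern.code_mem {k : ℕ} {W : ℕ → ℕ → ℕ} (h : IsPattern k W) (hk : 0 < k)
    (hr : leaf k (run k) = true) : Nat.shiftRight (enc W) 640 ∈ codes k := by
  rw [leaf, forceList_eq, forceList_eq, forceList_eq, forceList_eq, force_eq, forceList_eq] at hr
  refine h.of_run hk (fun hl => ?_) hr
  simpa only [h.not_lowDegree, h.not_deletable, Bool.false_or, Bool.or_false,
    List.contains_eq_mem, decide_eq_true_eq, h.not_contractible (fun _ => getD_map_range _)
    (fun _ => getD_map_range _)] using hl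

end LeafSoundness

section Table

variable {n : ℕ} {l : List (ℕ × ℕ)}

lemma testBit_pair (a b y : ℕ) : (Nat.lor (2 ^ a) (2 ^ b)).testBit y = true ↔ y = a ∨ y = b := by
  change (2 ^ a ||| 2 ^ b).testBit y = true ↔ _
  rw [Nat.testBit_or, Nat.testBit_two_pow, Nat.testBit_two_pow, Bool.or_eq_true,
    decide_eq_true_eq, decide_eq_true_eq, eq_comm, eq_comm (a := b)]

lemma testBit_insert (a m y : ℕ) :
    (Nat.lor (2 ^ a) m).testBit y = true ↔ y = a ∨ m.testBit y = true := by
  change (2 ^ a ||| m).testBit y = true ↔ _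
  rw [Nat.testBit_or, Nat.testBit_two_pow, Bool.or_eq_true, decide_eq_true_eq, eq_comm]

lemma testBit_bits (d : List ℕ) (y : ℕ) : (bits d).testBit y = true ↔ y ∈ d := by
  induction d with
  | nil => simp [bits]
  | cons a d ih => rw [bits, List.foldr_cons, testBit_insert, ← bits, ih, List.mem_cons]

lemma testBit_row (hl : ∀ e ∈ l, e.1 ≠ e.2) (x y : ℕ) :
    (row l x).testBit y = true ↔ (x, y) ∈ l ∨ (y, x) ∈ l := by
  induction l with
  | nil => simp [row]
  | cons e l ih =>
    obtain ⟨a, b⟩ := e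
    have hab : a ≠ b := hl _ List.mem_cons_self
    have ih := ih fun e he => hl e (List.mem_cons_of_mem _ he)
    rw [row, List.foldr_cons, ← row]
    simp only [List.mem_cons, Prod.mk.injEq]
    cases h1 : Nat.beq a x
    · have h1 : a ≠ x := by rw [ne_eq, ← Nat.beq_eq, h1]; exact Bool.false_ne_true
      cases h2 : Nat.beq b x
      · have h2 : b ≠ x := by rw [ne_eq, ← Nat.beq_eq, h2]; exact Bool.false_ne_true
        rw [cond_false, cond_false, ih]
        tauto
      · have h2 : b = x := by rwa [← Nat.beq_eq]
        rw [cond_false, cond_true, testBit_insert, ih]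
        subst h2
        tauto
    · have h1 : a = x := by rwa [← Nat.beq_eq]
      rw [cond_true, testBit_insert, ih]
      subst h1
      have : b ≠ a := hab.symm
      tauto

lemma mkGraph_adj (hl : ∀ e ∈ l, e.1 ≠ e.2) (x y : Fin n) :
    (mkGraph n l).Adj x y ↔ (row l x).testBit y = true := by
  rw [testBit_row hl, mkGraph, SimpleGraph.fromRel_adj, and_iff_right_iff_imp]
  rintro (h | h) rfl
  · exact hl _ h rfl
  · exact hl _ h rfl

lemma nbrs_mkGraph (hl : ∀ e ∈ l, e.1 ≠ e.2) {x a b : Fin n}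
    (h : row l x = Nat.lor (2 ^ (a : ℕ)) (2 ^ (b : ℕ))) : nbrs (mkGraph n l) x = {a, b} := by
  ext y
  rw [mem_nbrs, mkGraph_adj hl, h, testBit_pair, Finset.mem_insert, Finset.mem_singleton,
    Fin.ext_iff, Fin.ext_iff]

lemma mem_outside {d : List ℕ} {x : ℕ} : x ∈ outside n d ↔ x < n ∧ x ∉ d := by
  simp [outside]

lemma isCore_iff {d : List ℕ} : isCore n l d = true ↔
    d.Nodup ∧ (∀ a ∈ d, a < n) ∧ (∀ e ∈ l, e.1 ≠ e.2) ∧ ∀ x < n, x ∉ d →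
      (∃ a ∈ d, ∃ b ∈ d, a ≠ b ∧ (row l a).testBit b = true ∧
        row l x = Nat.lor (2 ^ a) (2 ^ b)) ∨
      (∃ a ∈ d, ∃ y ∈ outside n d, x ≠ y ∧ row l x = Nat.lor (2 ^ a) (2 ^ y) ∧
        row l y = Nat.lor (2 ^ a) (2 ^ x)) := by
  simp only [isCore, Bool.and_eq_true, decide_eq_true_eq, List.all_eq_true, Nat.blt_eq, not_beq,
    Bool.or_eq_true, List.any_eq_true, Nat.beq_eq, and_assoc, mem_outside, and_imp]

/-- The vertices of `mkGraph n l` listed in `d`. -/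
def place (d : List ℕ) (hc : ∀ a ∈ d, a < n) (i : Fin d.length) : Fin n :=
  ⟨d[i], hc _ (List.getElem_mem _)⟩

lemma mem_image_place {d : List ℕ} {hc : ∀ a ∈ d, a < n} {x : Fin n} :
    x ∈ Finset.univ.image (place d hc) ↔ (x : ℕ) ∈ d := by
  rw [Finset.mem_image, List.mem_iff_getElem]
  constructor
  · rintro ⟨i, -, rfl⟩
    exact ⟨i, i.2, rfl⟩
  · rintro ⟨i, hi, h⟩
    exact ⟨⟨i, hi⟩, Finset.mem_univ _, Fin.ext h⟩

lemma isCore_mkGraph {d : List ℕ} (h : isCore n l d = true) (hc : ∀ a ∈ d, a < n) :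
    IsCore (mkGraph n l) (Finset.univ.image (place d hc)) := by
  obtain ⟨-, -, hl, h⟩ := isCore_iff.1 h
  refine ⟨fun x hx => ?_⟩
  rw [mem_image_place] at hx
  rcases h x x.2 hx with ⟨a, ha, b, hb, hab, h1, h2⟩ | ⟨a, ha, y, hy, hxy, h1, h2⟩
  · exact Or.inl ⟨⟨a, hc a ha⟩, mem_image_place.2 ha, ⟨b, hc b hb⟩, mem_image_place.2 hb,
      fun e => hab (Fin.ext_iff.1 e), (mkGraph_adj hl _ _).2 h1, nbrs_mkGraph hl h2⟩
  · rw [mem_outside] at hy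
    exact Or.inr ⟨⟨a, hc a ha⟩, mem_image_place.2 ha, ⟨y, hy.1⟩,
      fun e => hy.2 (mem_image_place.1 e), fun e => hxy (Fin.ext_iff.1 e), nbrs_mkGraph hl h1,
      nbrs_mkGraph (x := ⟨y, hy.1⟩) hl h2⟩

lemma card_seeing {d : List ℕ} (hl : ∀ e ∈ l, e.1 ≠ e.2) (hc : ∀ a ∈ d, a < n)
    (i j : Fin d.length) : ((Finset.univ.image (place d hc))ᶜ.filter fun x =>
      nbrs (mkGraph n l) x ∩ Finset.univ.image (place d hc) = {place d hc i, place d hc j}).card =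
    seeing n l d d[i] d[j] := by
  have hcount (P : ℕ → Bool) :
      (List.range n).countP P = ((Finset.range n).filter fun x => P x = true).card := by
    rw [card_filter_range]
    simp
  rw [seeing, outside, List.countP_filter, hcount]
  have key (x : Fin n) : nbrs (mkGraph n l) x ∩ Finset.univ.image (place d hc) =
      {place d hc i, place d hc j} ↔
      Nat.land (row l x) (bits d) = Nat.lor (2 ^ d[i]) (2 ^ d[j]) := by
    have hb (y : ℕ) : (Nat.land (row l x) (bits d)).testBit y = true ↔
        (row l x).testBit y = true ∧ y ∈ d := by
      change (row l x &&& bits d).testBit y = true ↔ _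
      rw [Nat.testBit_and, Bool.and_eq_true, testBit_bits]
    constructor
    · intro h
      refine Nat.eq_of_testBit_eq fun y => Bool.eq_iff_iff.2 ?_
      rw [hb, testBit_pair]
      by_cases hy : y < n
      · have := Finset.ext_iff.1 h ⟨y, hy⟩
        rw [Finset.mem_inter, mem_nbrs, mkGraph_adj hl, mem_image_place, Finset.mem_insert,
          Finset.mem_singleton, Fin.ext_iff, Fin.ext_iff] at this
        exact this
      · refine iff_of_false (fun h => hy (hc y h.2)) ?_
        rintro (rfl | rfl) <;> exact hy (hc _ (List.getElem_mem _))
    · intro h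
      ext y
      rw [Finset.mem_inter, mem_nbrs, mkGraph_adj hl, mem_image_place, ← hb, h, testBit_pair,
        Finset.mem_insert, Finset.mem_singleton, Fin.ext_iff, Fin.ext_iff]
      rfl
  refine Finset.card_bij (fun x _ => (x : ℕ)) (fun x hx => ?_) (fun x _ y _ h => Fin.ext h)
    fun y hy => ?_
  · rw [Finset.mem_filter, Finset.mem_compl, mem_image_place, key] at hx
    simpa [x.2, hx.1] using hx.2
  · rw [Finset.mem_filter, Finset.mem_range, Bool.and_eq_true, Nat.beq_eq]
      at hy
    refine ⟨⟨y, hy.1⟩, ?_, rfl⟩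
    rw [Finset.mem_filter, Finset.mem_compl, mem_image_place, key]
    exact ⟨by simpa using hy.2.2, hy.2.1⟩

lemma OList_eq : OList = cores.map fun g => ⟨g.1, mkGraph g.1 g.2.1⟩ := rfl

lemma coreWeight_le {d : List ℕ} (p q : ℕ) : coreWeight n l d p q ≤ n + 1 := by
  have h (a b : ℕ) : seeing n l d a b ≤ n :=
    List.countP_le_length.trans ((List.length_filter_le _ _).trans List.length_range.le)
  rw [coreWeight]
  cases Nat.beq p q
  · have := h (d.getD p 0) (d.getD q 0)
    have := Bool.toNat_le ((row l (d.getD p 0)).testBit (d.getD q 0))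
    rw [cond_false]
    omega
  · have := h (d.getD p 0) (d.getD p 0)
    rw [cond_true]
    omega

lemma coreWeight_of_code_eq {d : List ℕ} {W : ℕ → ℕ → ℕ} (hn : n ≤ 10) (hc : d.length ≤ 6)
    (hW : ∀ q < 6, ∀ p ≤ q, W p q ≤ 3) (h : code n l d = Nat.shiftRight (enc W) 640) {p q : ℕ}
    (hpq : p ≤ q) (hq : q < d.length) : coreWeight n l d p q = W p q := by
  have h1 : Nat.shiftRight (enc W) 640 = pack (fun i => lane W (80 + i)) 36 :=
    shiftRight_pack (n := 80) (m := 36) fun i hi => by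
      have := lane_lt hW hi
      omega
  rw [h1, code] at h
  have h2 := pack_injective (fun i _ => ?_) (fun i hi => ?_) h (6 * q + p) (by omega)
  · rw [← add_assoc, lane_weight W hpq (by omega), show (6 * q + p) / 6 = q by omega,
      show (6 * q + p) % 6 = p by omega, show Nat.ble p q = true by rwa [Nat.ble_eq],
      show Nat.blt q d.length = true by rwa [Nat.blt_eq]] at h2
    exact h2
  · have := coreWeight_le (n := n) (l := l) (d := d) (i % 6) (i / 6)
    cases Nat.ble (i % 6) (i / 6) && Nat.blt (i / 6) d.length
    · simp
    · rw [cond_true]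
      omega
  · have := lane_lt hW (show 80 + i < 116 by omega)
    omega

/-- A graph whose core has a tabulated code is isomorphic to a graph in `OList`. -/
theorem inO_of_code_mem {V : Type} [Fintype V] [DecidableEq V] {G : SimpleGraph V} {k : ℕ}
    {φ : Fin k → V} (hφ : Function.Injective φ) (h : IsCore G (Finset.univ.image φ))
    {W : ℕ → ℕ → ℕ} (hk : k ≤ 6) (hW3 : ∀ q < 6, ∀ p ≤ q, W p q ≤ 3)
    (hW : ∀ p q : Fin k, p < q → W p q = wt G (Finset.univ.image φ) (φ p) (φ q))
    (hWs : ∀ p : Fin k, 2 * W p p = wt G (Finset.univ.image φ) (φ p) (φ p))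
    (hcode : Nat.shiftRight (enc W) 640 ∈ codes k) : InO G := by
  classical
  rw [codes, List.mem_flatMap] at hcode
  obtain ⟨⟨n, l, cs⟩, hg, hcode⟩ := hcode
  rw [List.mem_map] at hcode
  obtain ⟨d, hc, hcode⟩ := hcode
  rw [List.mem_filter, Nat.beq_eq] at hc
  obtain ⟨hc, rfl⟩ := hc
  have h1 := List.all_eq_true.1 (List.all_eq_true.1 isCore_cores _ hg) d hc
  have hn := card_le_of_mem_cores _ hg
  simp only at h1 hcode hn
  obtain ⟨hnd, hcn, hl, -⟩ := isCore_iff.1 h1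
  have h2 := isCore_mkGraph h1 hcn
  have hinj : Function.Injective (place d hcn) := fun i j hij =>
    Fin.ext ((List.Nodup.getElem_inj_iff hnd).1 (Fin.ext_iff.1 hij))
  have hcw {p q : Fin d.length} (hpq : p ≤ q) : coreWeight n l d p q = W p q :=
    coreWeight_of_code_eq hn hk hW3 hcode hpq q.2
  have hget (p : Fin d.length) : d.getD p 0 = d[p] := by simp
  have hwt (p q : Fin d.length) : wt (mkGraph n l) (Finset.univ.image (place d hcn))
      (place d hcn p) (place d hcn q) =
      ((row l d[p]).testBit d[q]).toNat + seeing n l d d[p] d[q] := by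
    rw [wt, ← card_seeing hl hcn]
    congr 1
    · have := mkGraph_adj hl (place d hcn p) (place d hcn q)
      change _ ↔ (row l d[p]).testBit d[q] = true at this
      cases hb : (row l d[p]).testBit d[q] <;> simp [this] <;> exact hb
  have hlt {p q : Fin d.length} (hpq : p < q) :
      wt G (Finset.univ.image φ) (φ p) (φ q) =
        wt (mkGraph n l) (Finset.univ.image (place d hcn)) (place d hcn p) (place d hcn q) := by
    rw [hwt, ← hW p q hpq, ← hcw hpq.le, coreWeight, hget, hget]
    have : Nat.beq p q = false := by
      rw [Bool.eq_false_iff, ne_eq, Nat.beq_eq]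
      exact hpq.ne ∘ Fin.ext
    rw [this, cond_false]
  have heq (p q : Fin d.length) :
      wt G (Finset.univ.image φ) (φ p) (φ q) =
        wt (mkGraph n l) (Finset.univ.image (place d hcn)) (place d hcn p) (place d hcn q) := by
    rcases lt_trichotomy p q with hpq | rfl | hpq
    · exact hlt hpq
    · have h3 := hcw (le_refl p)
      have h4 := h2.even_wt_self (mem_image_place.2 (List.getElem_mem p.2) : place d hcn p ∈ _)
      have h5 : ((row l d[p]).testBit d[p]).toNat = 0 := by
        have := (mkGraph n l).irrefl (v := place d hcn p)
        rw [mkGraph_adj hl] at this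
        change ¬ (row l d[p]).testBit d[p] = true at this
        simpa using this
      have h6 : Nat.beq p p = true := by rw [Nat.beq_eq]
      rw [coreWeight, h6, cond_true, hget] at h3
      rw [hwt, h5] at h4
      rw [hwt, h5, ← hWs, ← h3]
      obtain ⟨m, hm⟩ := h4
      omega
    · rw [wt_comm G, wt_comm (mkGraph n l)]
      exact hlt hpq
  have hadj (p q : Fin d.length) :
      G.Adj (φ p) (φ q) ↔ (mkGraph n l).Adj (place d hcn p) (place d hcn q) := by
    rcases eq_or_ne p q with rfl | hpq
    · simp
    · constructor
      · intro ha
        refine h2.adj_of_wt_ne_zero (hinj.ne hpq) ?_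
        rw [← heq, wt, if_pos ha]
        omega
      · intro ha
        refine h.adj_of_wt_ne_zero (hφ.ne hpq) ?_
        rw [heq, wt, if_pos ha]
        omega
  refine ⟨⟨n, mkGraph n l⟩, ?_, IsCore.nonempty_iso hφ hinj h h2 hadj fun p q => ?_⟩
  · rw [OList_eq, List.mem_map]
    exact ⟨_, hg, rfl⟩
  · have h3 := heq p q
    rw [wt, wt] at h3
    have h4 := hadj p q
    by_cases ha : G.Adj (φ p) (φ q)
    · rw [if_pos ha, if_pos (h4.1 ha)] at h3
      convert Nat.add_left_cancel h3
    · rw [if_neg ha, if_neg (mt h4.2 ha)] at h3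
      convert Nat.add_left_cancel h3

end Table

section Enumeration

lemma sum_sum_eq_two_mul {f g : ℕ → ℕ → ℕ} (hs : ∀ p q, f p q = f q p)
    (hd : ∀ p, 2 * g p p = f p p) (hlt : ∀ q, ∀ p < q, g p q = f p q) (n : ℕ) :
    ∑ p ∈ Finset.range n, ∑ q ∈ Finset.range n, f p q =
      2 * ∑ q ∈ Finset.range n, ∑ p ∈ Finset.range (q + 1), g p q := by
  induction n with
  | zero => simp
  | succ n ih =>
    simp only [Finset.sum_range_succ, Finset.sum_add_distrib] at ih ⊢
    rw [ih, Finset.sum_congr rfl fun p _ => hs n p, ← hd n,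
      Finset.sum_congr rfl fun p hp => (hlt n p (Finset.mem_range.1 hp)).symm]
    ring

lemma card_filter_testBit (S : ℕ) :
    ((Finset.range 6).filter fun p => S.testBit p = true).card = size S := by
  rw [Finset.card_filter]
  simp only [Finset.sum_range_succ, Finset.sum_range_zero, zero_add, size]
  congr <;> simp [Bool.toNat, Bool.cond_eq_ite]

lemma lane_low {X b : ℕ → ℕ → ℕ} (hs : ∀ p q, b p q = b q p)
    (hlt : ∀ q < 6, ∀ p < q, X p q = b p q) {j : ℕ} (hj : j < 2) :
    lane X (74 + j) = ∑ x ∈ Finset.Ico 2 6, b x j := by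
  have h (q : ℕ) (hq : q < 6) : lane X (74 + j) = ∑ x ∈ Finset.Ico 2 6, X j x := by
    rw [Finset.sum_Ico_succ_top, Finset.sum_Ico_succ_top, Finset.sum_Ico_succ_top,
      Finset.sum_Ico_succ_top, Finset.Ico_self, Finset.sum_empty] <;> try omega
    interval_cases j <;>
    · simp only [lane, pairSum, Finset.sum_range_succ, Finset.sum_range_zero, coef, base]
      simp
  rw [h 0 (by omega)]
  refine Finset.sum_congr rfl fun x hx => ?_
  rw [Finset.mem_Ico] at hx
  rw [hs, hlt x hx.2 j (by omega)]

lemma lane_high {X b : ℕ → ℕ → ℕ} (hs : ∀ p q, b p q = b q p) (hd : ∀ p, b p p = 0)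
    (hlt : ∀ q < 6, ∀ p < q, X p q = b p q) {j : ℕ} (hj : 2 ≤ j) (hj6 : j < 6) :
    lane X (74 + j) = 16 * b 0 j + 8 * b 1 j + ∑ x ∈ Finset.Ico 2 6, b x j := by
  rw [Finset.sum_Ico_succ_top, Finset.sum_Ico_succ_top, Finset.sum_Ico_succ_top,
    Finset.sum_Ico_succ_top, Finset.Ico_self, Finset.sum_empty] <;> try omega
  have h4 := hlt 3 (by omega) 2 (by omega)
  have h5 := hlt 4 (by omega) 2 (by omega)
  have h6 := hlt 4 (by omega) 3 (by omega)
  have h7 := hlt 5 (by omega) 2 (by omega)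
  have h8 := hlt 5 (by omega) 3 (by omega)
  have h9 := hlt 5 (by omega) 4 (by omega)
  have e1 := hlt j hj6 0 (by omega)
  have e2 := hlt j hj6 1 (by omega)
  rw [← e1, ← e2]
  interval_cases j <;>
  · simp only [lane, pairSum, Finset.sum_range_succ, Finset.sum_range_zero, coef, base]
    simp [hd, hs 3 2, hs 4 2, hs 4 3, hs 5 2, hs 5 3, hs 5 4, h4, h5, h6, h7, h8, h9, add_assoc]

variable {V : Type} [DecidableEq V] {C : Finset V} {k : ℕ}
  {φ : ℕ → V}

/-- The set of vertices coded by `S`. -/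
def chosen (k : ℕ) (φ : ℕ → V) (S : ℕ) : Finset V :=
  ((Finset.range k).filter fun p => S.testBit p = true).image φ

/-- `φ` enumerates `C`. -/
structure Enumerates (k : ℕ) (φ : ℕ → V) (C : Finset V) : Prop where
  le_six : k ≤ 6
  inj : Set.InjOn φ (Finset.range k)
  image : (Finset.range k).image φ = C

namespace Enumerates

lemma mem (h : Enumerates k φ C) {p : ℕ} (hp : p < k) : φ p ∈ C := by
  rw [← h.image]
  exact Finset.mem_image_of_mem _ (Finset.mem_range.2 hp)

lemma eq_iff (h : Enumerates k φ C) {p q : ℕ} (hp : p < k) (hq : q < k) : φ p = φ q ↔ p = q :=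
  ⟨fun e => h.inj (Finset.mem_coe.2 (Finset.mem_range.2 hp))
    (Finset.mem_coe.2 (Finset.mem_range.2 hq)) e, congrArg φ⟩

lemma chosen_subset (h : Enumerates k φ C) (S : ℕ) : chosen k φ S ⊆ C := by
  rw [← h.image]
  exact Finset.image_subset_image (Finset.filter_subset _ _)

lemma mem_chosen (h : Enumerates k φ C) {S p : ℕ} (hp : p < k) :
    φ p ∈ chosen k φ S ↔ S.testBit p = true := by
  rw [chosen, Finset.mem_image]
  constructor
  · rintro ⟨q, hq, e⟩
    rw [Finset.mem_filter, Finset.mem_range] at hq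
    rw [← (h.eq_iff hq.1 hp).1 e]
    exact hq.2
  · intro hS
    exact ⟨p, Finset.mem_filter.2 ⟨Finset.mem_range.2 hp, hS⟩, rfl⟩

lemma notMem_chosen (h : Enumerates k φ C) {S p : ℕ} (hp : p < k) (hS : S.testBit p = false) :
    φ p ∉ chosen k φ S := by
  rw [h.mem_chosen hp, hS]
  exact Bool.false_ne_true

lemma sum_chosen (h : Enumerates k φ C) (S : ℕ) (F : V → ℕ) :
    ∑ x ∈ chosen k φ S, F x =
      ∑ p ∈ Finset.range 6, if p < k ∧ S.testBit p = true then F (φ p) else 0 := by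
  rw [chosen, Finset.sum_image fun p hp q hq e => h.inj
    (Finset.mem_coe.2 (Finset.mem_of_mem_filter _ hp))
    (Finset.mem_coe.2 (Finset.mem_of_mem_filter _ hq)) e, ← Finset.sum_filter]
  refine Finset.sum_congr ?_ fun _ _ => rfl
  ext p
  have := h.le_six
  simp only [Finset.mem_filter, Finset.mem_range]
  exact ⟨fun hp => ⟨by omega, hp⟩, fun hp => hp.2⟩

lemma card_chosen_le (h : Enumerates k φ C) (S : ℕ) : (chosen k φ S).card ≤ size S := by
  rw [Finset.card_eq_sum_ones, h.sum_chosen, ← card_filter_testBit, Finset.card_filter]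
  refine Finset.sum_le_sum fun p _ => ?_
  split_ifs <;> simp_all

lemma exists_chosen (h : Enumerates k φ C) {T : Finset V} (hT : T ⊆ C) :
    ∃ S < 64, chosen k φ S = T ∧ size S = T.card := by
  have h6 := h.le_six
  let S := Nat.ofBits fun i : Fin 6 => decide (i.1 < k ∧ φ i ∈ T)
  have hS (p : ℕ) (hp : p < 6) : S.testBit p = true ↔ p < k ∧ φ p ∈ T := by
    rw [Nat.testBit_ofBits_lt _ _ hp, decide_eq_true_eq]
  have e : chosen k φ S = T := by
    ext x
    constructor
    · intro hx
      obtain ⟨p, hp, rfl⟩ := Finset.mem_image.1 hx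
      rw [Finset.mem_filter, Finset.mem_range] at hp
      exact ((hS p (by omega)).1 hp.2).2
    · intro hx
      have := hT hx
      rw [← h.image, Finset.mem_image] at this
      obtain ⟨p, hp, rfl⟩ := this
      rw [Finset.mem_range] at hp
      rw [h.mem_chosen hp, hS p (by omega)]
      exact ⟨hp, hx⟩
  refine ⟨S, Nat.ofBits_lt_two_pow _, e, ?_⟩
  rw [← e, Finset.card_eq_sum_ones, h.sum_chosen, ← card_filter_testBit, Finset.card_filter]
  refine Finset.sum_congr rfl fun p hp => ?_
  have := hS p (Finset.mem_range.1 hp)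
  split_ifs <;> simp_all

end Enumerates

variable [Fintype V] {G : SimpleGraph V}

/-- The weights of the core `C` with respect to the enumeration `φ`. -/
noncomputable def pattern (G : SimpleGraph V) (C : Finset V) (k : ℕ) (φ : ℕ → V) (p q : ℕ) : ℕ :=
  if q < k then if p = q then wt G C (φ p) (φ p) / 2 else wt G C (φ p) (φ q) else 0

lemma pattern_of_lt {p q : ℕ} (hpq : p < q) (hq : q < k) :
    pattern G C k φ p q = wt G C (φ p) (φ q) := by
  rw [pattern, if_pos hq, if_neg hpq.ne]

lemma pattern_min_max {p q : ℕ} (hpq : p ≠ q) (hp : p < k) (hq : q < k) :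
    pattern G C k φ (min p q) (max p q) = wt G C (φ p) (φ q) := by
  rcases hpq.lt_or_gt with h | h
  · rw [min_eq_left h.le, max_eq_right h.le, pattern_of_lt h hq]
  · rw [min_eq_right h.le, max_eq_left h.le, pattern_of_lt h hp, wt_comm]

namespace Enumerates

/-- The weights of the enumerated core as a symmetric function. -/
lemma weight_symm (h : Enumerates k φ C) (hC : IsCore G C) (c : ℕ → ℕ → ℕ)
    (hc : ∀ p q, c p q = c q p) :
    ∑ p ∈ Finset.range 6, ∑ q ∈ Finset.range 6,
      (if p < k ∧ q < k then c p q * wt G C (φ p) (φ q) else 0) =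
    2 * pairSum fun p q => c p q * pattern G C k φ p q := by
  refine sum_sum_eq_two_mul (fun p q => ?_) (fun p => ?_) (fun q p hpq => ?_) 6
  · rw [hc p q, wt_comm G C (φ p)]
    simp only [and_comm]
  · by_cases hp : p < k
    · obtain ⟨m, hm⟩ := hC.even_wt_self (h.mem hp)
      rw [pattern, if_pos hp, if_pos rfl, if_pos ⟨hp, hp⟩, mul_left_comm]
      congr 1
      omega
    · rw [pattern, if_neg hp, if_neg fun h => hp h.1, mul_zero, mul_zero]
  · by_cases hq : q < k
    · rw [if_pos ⟨hpq.trans hq, hq⟩, pattern_of_lt hpq hq]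
    · rw [if_neg fun h => hq h.2, pattern, if_neg hq, mul_zero]

lemma swt_chosen (h : Enumerates k φ C) (hC : IsCore G C) (S : ℕ) :
    swt G C (chosen k φ S) = 2 * load (pattern G C k φ) S := by
  rw [load, ← h.weight_symm hC (fun p q => (both S p q).toNat) fun p q => by
    rw [both, both, Bool.and_comm], swt, h.sum_chosen]
  refine Finset.sum_congr rfl fun p _ => ?_
  rw [h.sum_chosen]
  split_ifs with hp
  · refine Finset.sum_congr rfl fun q _ => ?_
    rw [both, hp.2, Bool.true_and]
    cases hq : S.testBit q <;> simp [hp.1]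
  · refine (Finset.sum_eq_zero fun q _ => ?_).symm
    split_ifs with hpq
    · rw [both]
      cases hp2 : S.testBit p
      · simp
      · exact absurd ⟨hpq.1, hp2⟩ hp
    · rfl

lemma lane_degree (h : Enumerates k φ C) (hC : IsCore G C) {p : ℕ} (hp : p < k) :
    lane (pattern G C k φ) (68 + p) = 118 + (nbrs G (φ p)).card := by
  have h6 := h.le_six
  have e1 : base (68 + p) = 118 := by
    simp [base, show ¬ 68 + p < 4 by omega, show ¬ 68 + p < 68 by omega,
      show 68 + p < 74 by omega]
  have e2 (x y : ℕ) : coef (68 + p) x y = (if x = p then 1 else 0) + (if y = p then 1 else 0) := by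
    simp only [coef, show ¬ 68 + p < 4 by omega, show ¬ 68 + p < 68 by omega,
      show 68 + p < 74 by omega, if_true, if_false]
    congr 1 <;>
    · simp only [Bool.toNat, Bool.cond_eq_ite, beq_iff_eq, Nat.add_left_cancel_iff]
      simp only [eq_comm]
  have e3 := h.weight_symm hC (coef (68 + p)) fun x y => by rw [e2, e2, add_comm]
  have e4 : ∑ y ∈ Finset.range 6, (if y < k then wt G C (φ p) (φ y) else 0) =
      (nbrs G (φ p)).card := by
    rw [hC.card_nbrs (h.mem hp), ← Finset.sum_filter, ← h.image, Finset.sum_image h.inj]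
    refine Finset.sum_congr ?_ fun _ _ => rfl
    ext y
    simp only [Finset.mem_filter, Finset.mem_range]
    omega
  have e5 : ∑ x ∈ Finset.range 6, ∑ y ∈ Finset.range 6,
      (if x < k ∧ y < k then coef (68 + p) x y * wt G C (φ x) (φ y) else 0) =
      2 * (nbrs G (φ p)).card := by
    have e6 (x y : ℕ) : (if x < k ∧ y < k then coef (68 + p) x y * wt G C (φ x) (φ y) else 0) =
        (if x = p then if y < k then wt G C (φ p) (φ y) else 0 else 0) +
        (if y = p then if x < k then wt G C (φ p) (φ x) else 0 else 0) := by
      rw [e2]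
      by_cases hx : x = p
      · subst hx
        by_cases hy : y = x
        · subst hy
          simp [hp, two_mul]
        · simp [hp, hy]
      · by_cases hy : y = p
        · subst hy
          simp [hp, hx, wt_comm G C (φ x)]
        · simp [hx, hy]
    have hp6 : p ∈ Finset.range 6 := Finset.mem_range.2 (by omega)
    simp only [e6, Finset.sum_add_distrib, Finset.sum_ite_eq', hp6, if_true]
    rw [Finset.sum_comm]
    simp only [Finset.sum_ite_eq', hp6, if_true, e4]
    omega
  rw [lane, e1]
  omega

end Enumerates

end Enumeration

section Patterning

open Classical in
/-- The number of neighbours of `x` in `C` other than `v` and `w`. -/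
noncomputable def coreDegree {V : Type} [DecidableEq V] (G : SimpleGraph V) (C : Finset V) (v w x : V) : ℕ :=
  (((C.erase v).erase w).filter fun y => G.Adj y x).card

lemma coreDegree_swap {V : Type} [DecidableEq V] {G : SimpleGraph V} {C : Finset V} (v w x : V) :
    coreDegree G C v w x = coreDegree G C w v x := by
  rw [coreDegree, coreDegree, Finset.erase_right_comm]

open Classical in
/-- The key by which the core vertices are sorted. -/
noncomputable def sortKey {V : Type} [DecidableEq V] (G : SimpleGraph V) (C : Finset V) (v w x : V) : ℕ :=
  16 * (if G.Adj v x then 1 else 0) + 8 * (if G.Adj w x then 1 else 0) + coreDegree G C v w x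

open Classical in
/-- Adjacency of enumerated vertices. -/
noncomputable def edgeCount {V : Type} (G : SimpleGraph V) (k : ℕ) (φ : ℕ → V) (p q : ℕ) : ℕ :=
  if p < k ∧ q < k ∧ G.Adj (φ p) (φ q) then 1 else 0

lemma edgeCount_comm {V : Type} {G : SimpleGraph V} {k : ℕ} {φ : ℕ → V} (p q : ℕ) :
    edgeCount G k φ p q = edgeCount G k φ q p := by
  classical
  refine if_congr ?_ rfl rfl
  rw [G.adj_comm]
  exact and_left_comm

lemma edgeCount_self {V : Type} {G : SimpleGraph V} {k : ℕ} {φ : ℕ → V} (p : ℕ) :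
    edgeCount G k φ p p = 0 := by
  simp [edgeCount]

open Classical in
lemma edgeCount_of_lt {V : Type} {G : SimpleGraph V} {k : ℕ} {φ : ℕ → V} {p q : ℕ} (hp : p < k)
    (hq : q < k) : edgeCount G k φ p q = if G.Adj (φ p) (φ q) then 1 else 0 :=
  if_congr ⟨fun h => h.2.2, fun h => ⟨hp, hq, h⟩⟩ rfl rfl

variable {V : Type} [DecidableEq V] {G : SimpleGraph V} {C : Finset V} {k : ℕ} {φ : ℕ → V}

lemma sum_edgeCount (h : Enumerates k φ C) (hk : 2 ≤ k) {j : ℕ} (hj : j < k) :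
    ∑ x ∈ Finset.Ico 2 6, edgeCount G k φ x j = coreDegree G C (φ 0) (φ 1) (φ j) := by
  classical
  have h6 := h.le_six
  simp only [edgeCount]
  rw [← Finset.card_filter, coreDegree]
  have e : (((C.erase (φ 0)).erase (φ 1)).filter fun y => G.Adj y (φ j)) =
      ((Finset.Ico 2 6).filter fun x => x < k ∧ j < k ∧ G.Adj (φ x) (φ j)).image φ := by
    ext y
    simp only [Finset.mem_filter, Finset.mem_erase, Finset.mem_image, Finset.mem_Ico]
    constructor
    · rintro ⟨⟨h1, h0, hy⟩, ha⟩
      rw [← h.image, Finset.mem_image] at hy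
      obtain ⟨x, hx, rfl⟩ := hy
      rw [Finset.mem_range] at hx
      have h2 : x ≠ 0 := fun e => h0 (e ▸ rfl)
      have h3 : x ≠ 1 := fun e => h1 (e ▸ rfl)
      exact ⟨x, ⟨by omega, hx, hj, ha⟩, rfl⟩
    · rintro ⟨x, ⟨hx, hxk, -, ha⟩, rfl⟩
      refine ⟨⟨fun e => ?_, fun e => ?_, h.mem hxk⟩, ha⟩
      · have := (h.eq_iff hxk (by omega)).1 e
        omega
      · have := (h.eq_iff hxk (by omega)).1 e
        omega
  rw [e, Finset.card_image_of_injOn]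
  intro x hx y hy exy
  simp only [Finset.coe_filter, Set.mem_ofPred_eq] at hx hy
  exact (h.eq_iff hx.2.1 hy.2.1).1 exy

variable [Fintype V]

lemma min_pattern (h : Enumerates k φ C) (hC : IsCore G C) {p q : ℕ} (hpq : p < q) :
    min (pattern G C k φ p q) 1 = edgeCount G k φ p q := by
  by_cases hq : q < k
  · rw [pattern_of_lt hpq hq, edgeCount]
    have hp : p < k := hpq.trans hq
    split_ifs with ha
    · rw [wt, if_pos ha.2.2]
      omega
    · have : wt G C (φ p) (φ q) = 0 := by
        by_contra hw
        exact ha ⟨hp, hq, hC.adj_of_wt_ne_zero (fun e => hpq.ne ((h.eq_iff hp hq).1 e)) hw⟩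
      rw [this]
      rfl
  · rw [pattern, if_neg hq, edgeCount, if_neg fun h => hq h.2.1]
    rfl

lemma exists_enumerates {v w : V} (h : IsBasedCore G C v w) :
    ∃ φ : ℕ → V, Enumerates C.card φ C ∧ φ 0 = v ∧ φ 1 = w ∧
      ∀ i, 2 ≤ i → i + 1 < C.card → sortKey G C v w (φ (i + 1)) ≤ sortKey G C v w (φ i) := by
  let r : V → V → Prop := fun x y => sortKey G C v w y ≤ sortKey G C v w x
  have : Std.Total r := ⟨fun x y => le_total _ _⟩
  have : IsTrans V r := ⟨fun x y z h1 h2 => h2.trans h1⟩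
  classical
  let L := ((C.erase v).erase w).toList.insertionSort r
  have hL : L.Perm ((C.erase v).erase w).toList := List.perm_insertionSort _ _
  have hs : L.Pairwise r := List.pairwise_insertionSort _ _
  have hmem (x : V) : x ∈ v :: w :: L ↔ x ∈ C := by
    rw [List.mem_cons, List.mem_cons, hL.mem_iff, Finset.mem_toList, Finset.mem_erase,
      Finset.mem_erase]
    constructor
    · rintro (rfl | rfl | hx)
      · exact h.left_mem
      · exact h.right_mem
      · exact hx.2.2
    · tauto
  have hnd : (v :: w :: L).Nodup := by
    rw [List.nodup_cons, List.nodup_cons, hL.nodup_iff, List.mem_cons, hL.mem_iff, hL.mem_iff]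
    refine ⟨?_, by simp, Finset.nodup_toList _⟩
    simp [h.ne]
  have hfin : (v :: w :: L).toFinset = C := by
    ext x
    rw [List.mem_toFinset, hmem]
  have hlen : (v :: w :: L).length = C.card := by
    rw [← List.toFinset_card_of_nodup hnd, hfin]
  have hget (p : ℕ) (hp : p < C.card) :
      (v :: w :: L).getD p v = (v :: w :: L)[p]'(by omega) := List.getD_eq_getElem _ _ _
  refine ⟨fun p => (v :: w :: L).getD p v, ⟨h.card_le, fun p hp q hq e => ?_, ?_⟩, rfl, rfl,
    fun i hi hik => ?_⟩
  · rw [Finset.coe_range, Set.mem_Iio] at hp hq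
    simp only [hget p hp, hget q hq] at e
    exact (List.Nodup.getElem_inj_iff hnd).1 e
  · ext x
    rw [← hmem, List.mem_iff_getElem, Finset.mem_image]
    constructor
    · rintro ⟨p, hp, rfl⟩
      rw [Finset.mem_range] at hp
      exact ⟨p, by omega, (hget p hp).symm⟩
    · rintro ⟨p, hp, rfl⟩
      exact ⟨p, Finset.mem_range.2 (by omega), hget p (by omega)⟩
  · obtain ⟨m, rfl⟩ : ∃ m, i = m + 2 := ⟨i - 2, by omega⟩
    rw [List.length_cons, List.length_cons] at hlen
    simp only [hget _ hik, hget _ (Nat.lt_of_succ_lt hik), List.getElem_cons_succ]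
    exact List.pairwise_iff_getElem.1 hs m (m + 1) (by omega) (by omega) (by omega)

lemma sorted_pattern {v w : V} (h : Enumerates k φ C) (hC : IsCore G C) (hk : 2 ≤ k)
    (hv : φ 0 = v) (hw : φ 1 = w) (hvw : coreDegree G C v w w ≤ coreDegree G C v w v)
    (hs : ∀ i, 2 ≤ i → i + 1 < k → sortKey G C v w (φ (i + 1)) ≤ sortKey G C v w (φ i))
    {i : ℕ} (hi : i = 74 ∨ i = 76 ∨ i = 77 ∨ i = 78) :
    lane (fun p q => min (pattern G C k φ p q) 1) (i + 1) ≤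
      lane (fun p q => min (pattern G C k φ p q) 1) i := by
  have hlt : ∀ q < 6, ∀ p < q,
      (fun p q => min (pattern G C k φ p q) 1) p q = edgeCount G k φ p q :=
    fun q _ p hpq => min_pattern h hC hpq
  have hkey {j : ℕ} (hj : j < k) (hj2 : 2 ≤ j) : sortKey G C v w (φ j) =
      lane (fun p q => min (pattern G C k φ p q) 1) (74 + j) := by
    have := h.le_six
    rw [lane_high edgeCount_comm edgeCount_self hlt hj2 (by omega), sum_edgeCount h hk hj, hv, hw,
      sortKey, edgeCount_of_lt (by omega) hj, edgeCount_of_lt (by omega) hj, hv, hw]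
  rcases hi with rfl | hi
  · have h0 := lane_low edgeCount_comm hlt (show 0 < 2 by omega)
    have h1 := lane_low edgeCount_comm hlt (show 1 < 2 by omega)
    rw [sum_edgeCount h hk (by omega), hv, hw] at h0 h1
    rw [h1, h0]
    exact hvw
  · obtain ⟨j, rfl, hj2, hj6⟩ : ∃ j, i = 74 + j ∧ 2 ≤ j ∧ j + 1 < 6 := ⟨i - 74, by omega⟩
    by_cases hj : j + 1 < k
    · rw [add_assoc, ← hkey hj (by omega), ← hkey (by omega) hj2]
      exact hs j hj2 hj
    · rw [add_assoc, lane_high edgeCount_comm edgeCount_self hlt (by omega) hj6]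
      have hz (x : ℕ) : edgeCount G k φ x (j + 1) = 0 := if_neg fun h => hj h.2.1
      simp [hz]

/-- The weights of the core of an obstruction form a pattern. -/
theorem isPattern_pattern (hG : ObsApexPseudoforest G) {v w : V} (hB : IsBasedCore G C v w)
    (h : Enumerates k φ C) (hk : 2 ≤ k) (hv : φ 0 = v) (hw : φ 1 = w)
    (hvw : coreDegree G C v w w ≤ coreDegree G C v w v)
    (hs : ∀ i, 2 ≤ i → i + 1 < k → sortKey G C v w (φ (i + 1)) ≤ sortKey G C v w (φ i)) :
    IsPattern k (pattern G C k φ) := by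
  have hC := hB.toIsCore
  have h6 := h.le_six
  have h0 {S : ℕ} (hS : S.testBit 0 = false) : v ∉ chosen k φ S :=
    hv ▸ h.notMem_chosen (by omega) hS
  have h1 {S : ℕ} (hS : S.testBit 1 = false) : w ∉ chosen k φ S :=
    hw ▸ h.notMem_chosen (by omega) hS
  have hne {p : ℕ} (hp : p < k) (hp2 : 2 ≤ p) : φ p ≠ v ∧ φ p ≠ w := by
    constructor
    · rw [← hv, ne_eq, h.eq_iff hp (by omega)]
      omega
    · rw [← hw, ne_eq, h.eq_iff hp (by omega)]
      omega
  have hcard : C.card = k := by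
    rw [← h.image, Finset.card_image_of_injOn h.inj, Finset.card_range]
  have hnz {p q : ℕ} (hpq : p ≤ q) (hq : q < k) (hW : pattern G C k φ p q ≠ 0) :
      wt G C (φ p) (φ q) ≠ 0 := by
    rw [pattern, if_pos hq] at hW
    split_ifs at hW with e
    · subst e
      omega
    · exact hW
  refine ⟨h6, fun p q hq => if_neg (by omega), fun S _ hS => ?_, fun S _ hS0 hS1 => ?_,
    fun z hz => ?_, fun q hq p hpq hW => ?_, fun q hq p hpq hW => ?_, fun p hp hp2 => ?_,
    fun p hp hp2 => ?_, fun p hp hp2 => ?_, fun i hi => sorted_pattern h hC hk hv hw hvw hs hi⟩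
  · have e1 := h.swt_chosen hC S
    have e2 := h.card_chosen_le S
    rcases hS with hS | hS
    · have := hB.swt_left (h.chosen_subset S) (h0 hS)
      omega
    · have := hB.swt_right (h.chosen_subset S) (h1 hS)
      omega
  · have e1 := h.swt_chosen hC S
    have e2 := h.card_chosen_le S
    have := hB.swt_both (h.chosen_subset S) (h0 hS0) (h1 hS1)
    omega
  · obtain ⟨T, hT, hzT, hd⟩ := hG.exists_dense_core hC (φ z)
    obtain ⟨S, hS, rfl, hsize⟩ := h.exists_chosen hT
    rw [h.mem_chosen hz, Bool.not_eq_true] at hzT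
    rw [h.swt_chosen hC] at hd
    exact ⟨S, hS, hzT, by omega⟩
  · have hp : p < k := by omega
    obtain ⟨z, hz, hd⟩ := hG.exists_core_delete hC (h.mem hp) (h.mem hq) (hnz hpq hq hW)
    rw [← h.image, Finset.mem_image] at hz
    obtain ⟨z, hz, rfl⟩ := hz
    rw [Finset.mem_range] at hz
    refine ⟨z, hz, fun S _ hzS => ?_⟩
    have e1 := hd _ (h.chosen_subset S) (h.notMem_chosen hz hzS)
    have e2 := h.card_chosen_le S
    rw [h.swt_chosen hC] at e1
    simp only [h.mem_chosen hp, h.mem_chosen hq] at e1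
    rw [both]
    cases hSp : S.testBit p <;> cases hSq : S.testBit q <;> simp [hSp, hSq] at e1 ⊢ <;> omega
  · have hp : p < k := by omega
    have hpq2 : φ p ≠ φ q := by
      rw [ne_eq, h.eq_iff hp hq]
      omega
    obtain ⟨z, hz, hzq, hd⟩ :=
      hG.exists_core_contract hC (h.mem hp) (h.mem hq) hpq2 (hnz hpq.le hq hW)
    rw [← h.image, Finset.mem_image] at hz
    obtain ⟨z, hz, rfl⟩ := hz
    rw [Finset.mem_range] at hz
    refine ⟨z, hz, fun e => hzq (e ▸ rfl), fun S _ hzS => ?_⟩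
    obtain ⟨d1, d2⟩ := hd _ (h.chosen_subset S) (h.notMem_chosen hz hzS)
    have e2 := h.card_chosen_le S
    rw [h.swt_chosen hC] at d1 d2
    refine ⟨fun hSp hSq => ?_, fun hb => ?_⟩
    · have := d1 (h.notMem_chosen hp hSp) (h.notMem_chosen hq hSq)
      omega
    · rw [both, Bool.and_eq_true] at hb
      have d3 := d2 ((h.mem_chosen hp).2 hb.1) ((h.mem_chosen hq).2 hb.2)
      have e3 : ((chosen k φ S).filter fun r => r ≠ φ p ∧ r ≠ φ q ∧ wt G C (φ p) r ≠ 0 ∧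
          wt G C (φ q) r ≠ 0) ⊆ ((Finset.range k).filter fun r => S.testBit r = true ∧ r ≠ p ∧
            r ≠ q ∧ pattern G C k φ (min p r) (max p r) ≠ 0 ∧
            pattern G C k φ (min q r) (max q r) ≠ 0).image φ := by
        intro x hx
        rw [Finset.mem_filter, chosen, Finset.mem_image] at hx
        obtain ⟨⟨r, hr, rfl⟩, hrp, hrq, hx⟩ := hx
        rw [Finset.mem_filter, Finset.mem_range] at hr
        have hrp : r ≠ p := fun e => hrp (e ▸ rfl)
        have hrq : r ≠ q := fun e => hrq (e ▸ rfl)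
        refine Finset.mem_image_of_mem _ (Finset.mem_filter.2 ⟨Finset.mem_range.2 hr.1, hr.2,
          hrp, hrq, ?_⟩)
        rwa [pattern_min_max hrp.symm hp hr.1, pattern_min_max hrq.symm hq hr.1]
      have e4 := (Finset.card_le_card e3).trans Finset.card_image_le
      rw [pattern_of_lt hpq hq]
      omega
  · have := hG.two_le_card_nbrs (φ p)
    rw [h.lane_degree hC hp]
    omega
  · have := hB.three_le _ (h.mem hp) (hne hp hp2).1 (hne hp hp2).2
    rw [h.lane_degree hC hp]
    omega
  · have := hB.le_nine _ (h.mem hp) (hne hp hp2).1 (hne hp hp2).2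
    rw [h.lane_degree hC hp]
    omega

lemma leaf_run {k : ℕ} (hk : 2 ≤ k) (hk6 : k ≤ 6) : leaf k (run k) = true := by
  interval_cases k
  · decide +kernel
  · decide +kernel
  · decide +kernel
  · decide +kernel
  · decide +kernel

/-- Every obstruction for apex-pseudoforests is listed. -/
theorem ObsApexPseudoforest.inO (h : ObsApexPseudoforest G) : InO G := by
  obtain ⟨C, v, w, hB, hvw⟩ : ∃ C v w, IsBasedCore G C v w ∧
      coreDegree G C v w w ≤ coreDegree G C v w v := by
    obtain ⟨C, v, w, hB⟩ := h.exists_isBasedCore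
    rcases le_total (coreDegree G C v w w) (coreDegree G C v w v) with hvw | hvw
    · exact ⟨C, v, w, hB, hvw⟩
    · exact ⟨C, w, v, hB.swap, by rwa [coreDegree_swap, coreDegree_swap w v]⟩
  obtain ⟨φ, hφ, h0, h1, hs⟩ := exists_enumerates hB
  have hk : 2 ≤ C.card := by
    rw [← Finset.card_pair hB.ne]
    exact Finset.card_le_card (Finset.insert_subset hB.left_mem
      (Finset.singleton_subset_iff.2 hB.right_mem))
  have hP := isPattern_pattern h hB hφ hk h0 h1 hvw hs
  have himg : Finset.univ.image (fun i : Fin C.card => φ i) = C := by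
    ext x
    rw [← Finset.ext_iff.1 hφ.image x, Finset.mem_image, Finset.mem_image]
    constructor
    · rintro ⟨i, -, rfl⟩
      exact ⟨i, Finset.mem_range.2 i.2, rfl⟩
    · rintro ⟨i, hi, rfl⟩
      exact ⟨⟨i, Finset.mem_range.1 hi⟩, Finset.mem_univ _, rfl⟩
  refine inO_of_code_mem (φ := fun i : Fin C.card => φ i)
    (fun i j e => Fin.ext ((hφ.eq_iff i.2 j.2).1 e)) (himg.symm ▸ hB.toIsCore) hφ.le_six
    (fun q hq p hpq => hP.le_three hpq hq) (fun p q hpq => ?_) (fun p => ?_)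
    (hP.code_mem (by omega) (leaf_run hk hφ.le_six))
  · rw [himg, pattern_of_lt hpq q.2]
  · rw [himg, pattern, if_pos p.2, if_pos rfl]
    obtain ⟨m, hm⟩ := hB.even_wt_self (hφ.mem p.2)
    omega

end Patterning

/-- Every obstruction for apex-pseudoforests not isomorphic to a member of `O`
is `K₄`-minor-free or triconnected. -/
theorem obstruction_K4_or_triconnected {V : Type} [Finite V] (G : SimpleGraph V)
    (h1 : ObsApexPseudoforest G) (h2 : ¬ InO G) :
    ¬ IsMinorOf (completeGraph (Fin 4)) G ∨ KConnected 3 G := by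
  classical
  have := Fintype.ofFinite V
  exact absurd h1.inO h2
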